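/- For every real d > 0, let k_d be the smallest integer k such that d < 2k·log k. Then the probability that the chromatic number of the Erdős–Rényi random graph G(n, d/n) lies in the set {k_d, k_d + 1} tends to 1 as n → ∞. -/

import Mathlib

open Finset Filter
open scoped Classical

/-- The probability that the Erdős–Rényi random graph `G(n,p)` (each of the
`n(n-1)/2` possible edges present independently with probability `p`) satisfies
the property `P`. -/
noncomputable def erdosRenyiProb (n : ℕ) (p : ℝ) (P : SimpleGraph (Fin n) → Prop) : ℝ :=
  ∑ G : SimpleGraph (Fin n),
    if P G then p ^ G.edgeFinset.card * (1 - p) ^ (n.choose 2 - G.edgeFinset.card) else 0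

namespace RandomColoring

lemma mul_log_ratio_mono {x y : ℝ} (hx : 0 ≤ x) (hxy : x ≤ y) (hy : y < 1) :
    y * (Real.log (1 + x) - Real.log (1 - x)) ≤ x * (Real.log (1 + y) - Real.log (1 - y)) := by
  have h1 := (Real.hasSum_log_sub_log_of_abs_lt_one (x := x)
    (by rw [abs_of_nonneg hx]; linarith)).mul_left y
  have h2 := (Real.hasSum_log_sub_log_of_abs_lt_one (x := y)
    (by rw [abs_of_nonneg (hx.trans hxy)]; linarith)).mul_left x
  refine hasSum_le (fun k => ?_) h1 h2
  have h3 : x ^ (2 * k) ≤ y ^ (2 * k) := pow_le_pow_left₀ hx hxy _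
  have h4 : 0 ≤ 2 * (1 / (2 * (k : ℝ) + 1)) * (x * y) :=
    mul_nonneg (by positivity) (mul_nonneg hx (hx.trans hxy))
  calc y * (2 * (1 / (2 * (k : ℝ) + 1)) * x ^ (2 * k + 1))
      = 2 * (1 / (2 * (k : ℝ) + 1)) * (x * y) * x ^ (2 * k) := by ring
    _ ≤ 2 * (1 / (2 * (k : ℝ) + 1)) * (x * y) * y ^ (2 * k) := mul_le_mul_of_nonneg_left h3 h4
    _ = _ := by ring

lemma two_mul_le_log_ratio {x : ℝ} (hx : 0 ≤ x) (hx1 : x < 1) :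
    2 * x ≤ Real.log (1 + x) - Real.log (1 - x) := by
  have h1 := Real.hasSum_log_sub_log_of_abs_lt_one (x := x)
    (by rw [abs_of_nonneg hx]; linarith)
  have := le_hasSum h1 0 (fun k _ => by positivity)
  simpa using this

/-- Twice the (shifted) negative binary entropy of `(1 + x) / 2`. -/
noncomputable def binPhi (x : ℝ) : ℝ := (1 + x) * Real.log (1 + x) + (1 - x) * Real.log (1 - x)

lemma continuous_binPhi : Continuous binPhi := by
  have h := Real.continuous_mul_log
  exact (h.comp (continuous_const.add continuous_id)).add
    (h.comp (continuous_const.sub continuous_id))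

lemma hasDerivAt_binPhi {x : ℝ} (h1 : -1 < x) (h2 : x < 1) :
    HasDerivAt binPhi (Real.log (1 + x) - Real.log (1 - x)) x := by
  have ha : HasDerivAt (fun y : ℝ => (1 + y) * Real.log (1 + y)) (Real.log (1 + x) + 1) x := by
    have := (Real.hasDerivAt_mul_log (x := 1 + x) (by linarith)).comp x
      ((hasDerivAt_id x).const_add 1)
    simpa [Function.comp_def] using this
  have hb : HasDerivAt (fun y : ℝ => (1 - y) * Real.log (1 - y)) (-(Real.log (1 - x) + 1)) x := by
    have := (Real.hasDerivAt_mul_log (x := 1 - x) (by linarith)).comp x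
      ((hasDerivAt_id x).const_sub 1)
    simpa [Function.comp_def] using this
  refine (ha.add hb).congr_deriv ?_
  ring

lemma binPhi_neg (x : ℝ) : binPhi (-x) = binPhi x := by
  unfold binPhi; rw [sub_neg_eq_add, ← sub_eq_add_neg]; ring

lemma hasDerivAt_binPhi_sub {x : ℝ} (a : ℝ) (h1 : -1 < x) (h2 : x < 1) :
    HasDerivAt (fun y => binPhi y - a * y ^ 2)
      (Real.log (1 + x) - Real.log (1 - x) - a * (2 * x)) x := by
  refine ((hasDerivAt_binPhi h1 h2).sub (((hasDerivAt_id x).pow 2).const_mul a)).congr_deriv ?_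
  simp

lemma sq_le_binPhi {x : ℝ} (hx : |x| ≤ 1) : x ^ 2 ≤ binPhi x := by
  wlog h0 : 0 ≤ x generalizing x
  · have := this (x := -x) (by rwa [abs_neg]) (by linarith)
    rwa [binPhi_neg, neg_sq] at this
  have hmono : MonotoneOn (fun y => binPhi y - 1 * y ^ 2) (Set.Icc 0 1) := by
    refine monotoneOn_of_deriv_nonneg (convex_Icc 0 1)
      (continuous_binPhi.sub (by fun_prop)).continuousOn ?_ ?_
    · intro y hy
      rw [interior_Icc] at hy
      exact (hasDerivAt_binPhi_sub 1 (by linarith [hy.1])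
        hy.2).differentiableAt.differentiableWithinAt
    · intro y hy
      rw [interior_Icc] at hy
      rw [(hasDerivAt_binPhi_sub 1 (by linarith [hy.1]) hy.2).deriv]
      linarith [two_mul_le_log_ratio hy.1.le hy.2]
  have := hmono (Set.left_mem_Icc.2 zero_le_one) ⟨h0, (abs_le.1 hx).2⟩ h0
  simp [binPhi] at this ⊢
  linarith

lemma binPhi_ge_quadratic {x x0 : ℝ} (hx : |x| ≤ 1) (h0 : 0 < x0) (h1 : x0 < 1) :
    binPhi x0 + (Real.log (1 + x0) - Real.log (1 - x0)) / (2 * x0) * (x ^ 2 - x0 ^ 2)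
      ≤ binPhi x := by
  wlog hx0 : 0 ≤ x generalizing x
  · have := this (x := -x) (by rwa [abs_neg]) (by linarith)
    rwa [binPhi_neg, neg_sq] at this
  set a := (Real.log (1 + x0) - Real.log (1 - x0)) / (2 * x0) with ha
  have haeq : a * (2 * x0) = Real.log (1 + x0) - Real.log (1 - x0) := by
    rw [ha]; field_simp
  have hx1 := (abs_le.1 hx).2
  have hcont : Continuous (fun y => binPhi y - a * y ^ 2) := continuous_binPhi.sub (by fun_prop)
  have key : binPhi x0 - a * x0 ^ 2 ≤ binPhi x - a * x ^ 2 := by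
    rcases le_total x x0 with hle | hle
    · have hanti : AntitoneOn (fun y => binPhi y - a * y ^ 2) (Set.Icc 0 x0) := by
        refine antitoneOn_of_deriv_nonpos (convex_Icc 0 x0) hcont.continuousOn ?_ ?_
        · intro y hy
          rw [interior_Icc] at hy
          exact (hasDerivAt_binPhi_sub a (by linarith [hy.1])
            (by linarith [hy.2])).differentiableAt.differentiableWithinAt
        · intro y hy
          rw [interior_Icc] at hy
          rw [(hasDerivAt_binPhi_sub a (by linarith [hy.1]) (by linarith [hy.2])).deriv]
          have := mul_log_ratio_mono hy.1.le hy.2.le h1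
          rw [← haeq] at this
          have h2 : x0 * (Real.log (1 + y) - Real.log (1 - y) - a * (2 * y)) ≤ 0 := by linarith
          by_contra hc
          push Not at hc
          have := mul_pos h0 hc
          linarith
      exact hanti ⟨hx0, hle⟩ (Set.right_mem_Icc.2 h0.le) hle
    · have hmono : MonotoneOn (fun y => binPhi y - a * y ^ 2) (Set.Icc x0 1) := by
        refine monotoneOn_of_deriv_nonneg (convex_Icc x0 1) hcont.continuousOn ?_ ?_
        · intro y hy
          rw [interior_Icc] at hy
          exact (hasDerivAt_binPhi_sub a (by linarith [hy.1])
            (by linarith [hy.2])).differentiableAt.differentiableWithinAt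
        · intro y hy
          rw [interior_Icc] at hy
          rw [(hasDerivAt_binPhi_sub a (by linarith [hy.1]) (by linarith [hy.2])).deriv]
          have := mul_log_ratio_mono h0.le hy.1.le hy.2
          rw [← haeq] at this
          have h2 : 0 ≤ x0 * (Real.log (1 + y) - Real.log (1 - y) - a * (2 * y)) := by linarith
          by_contra hc
          push Not at hc
          have := mul_neg_of_pos_of_neg h0 hc
          linarith
      exact hmono (Set.left_mem_Icc.2 h1.le) ⟨hle, hx1⟩ hle
  linarith

lemma mul_log_two_mul (q : ℝ) : q * Real.log (2 * q) = q * Real.log 2 + q * Real.log q := by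
  rcases eq_or_ne q 0 with rfl | h
  · simp
  · rw [Real.log_mul two_ne_zero h]; ring

lemma binPhi_eq (q : ℝ) :
    binPhi (2 * q - 1) = 2 * (q * Real.log q + (1 - q) * Real.log (1 - q) + Real.log 2) := by
  have h1 := mul_log_two_mul q
  have h2 := mul_log_two_mul (1 - q)
  unfold binPhi
  rw [show 1 + (2 * q - 1) = 2 * q by ring, show 1 - (2 * q - 1) = 2 * (1 - q) by ring]
  linear_combination 2 * h1 + 2 * h2

/-- Binary case of the mean-field Potts inequality. -/
lemma binary_potts {K q : ℝ} (hK : 2 < K) (h0 : 0 ≤ q) (h1 : q ≤ 1) :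
    (K - 1) * Real.log (K - 1) / (K - 2) * (q ^ 2 + (1 - q) ^ 2 / (K - 1) - 1 / K) ≤
      q * Real.log q + (1 - q) * Real.log (1 - q) + Real.log K - (1 - q) * Real.log (K - 1) := by
  have hx : |2 * q - 1| ≤ 1 := abs_le.2 ⟨by linarith, by linarith⟩
  have hKpos : 0 < K := by linarith
  have hx0 : 0 < 1 - 2 / K := by
    rw [sub_pos, div_lt_one hKpos]; exact hK
  have hx1 : 1 - 2 / K < 1 := by
    have : 0 < 2 / K := by positivity
    linarith
  have h := binPhi_ge_quadratic hx hx0 hx1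
  have e1 : (1 : ℝ) - 2 / K = 2 * (1 - 1 / K) - 1 := by ring
  have e2 : Real.log (1 - 1 / K) = Real.log (K - 1) - Real.log K := by
    rw [← Real.log_div (by linarith) hKpos.ne']
    congr 1; field_simp
  have e3 : Real.log (1 - (1 - 1 / K)) = - Real.log K := by
    rw [← Real.log_inv]; congr 1; ring
  have e4 : Real.log (1 + (1 - 2 / K)) = Real.log 2 + Real.log (K - 1) - Real.log K := by
    rw [← Real.log_mul (by norm_num) (by linarith), ← Real.log_div (by
      have : 0 < 2 * (K - 1) := by linarith
      exact this.ne') hKpos.ne']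
    congr 1; field_simp; ring
  have e5 : Real.log (1 - (1 - 2 / K)) = Real.log 2 - Real.log K := by
    rw [← Real.log_div (by norm_num) hKpos.ne']; congr 1; ring
  have e6 : binPhi (1 - 2 / K) = 2 * ((1 - 1 / K) * (Real.log (K - 1) - Real.log K)
      + (1 - (1 - 1 / K)) * (- Real.log K) + Real.log 2) := by
    rw [e1, binPhi_eq, e2, e3]
  rw [e6, binPhi_eq, e4, e5] at h
  have hK2 : K - 2 ≠ 0 := by linarith
  have hK1 : K - 1 ≠ 0 := by linarith
  have id1 : (Real.log 2 + Real.log (K - 1) - Real.log K - (Real.log 2 - Real.log K)) /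
      (2 * (1 - 2 / K)) * ((2 * q - 1) ^ 2 - (1 - 2 / K) ^ 2) =
      2 * ((K - 1) * Real.log (K - 1) / (K - 2) * (q ^ 2 + (1 - q) ^ 2 / (K - 1) - 1 / K)
        + (1 - q) * Real.log (K - 1) - (1 - 1 / K) * Real.log (K - 1)) := by
    have : 1 - 2 / K = (K - 2) / K := by field_simp
    rw [this]
    field_simp
    ring
  rw [id1] at h
  have e7 : (1 - 1 / K) * (Real.log (K - 1) - Real.log K) + (1 - (1 - 1 / K)) * -Real.log K
      = (1 - 1 / K) * Real.log (K - 1) - Real.log K := by ring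
  rw [e7] at h
  linarith

/-- The critical constant in the mean-field Potts inequality. -/
noncomputable def pottsC (m : ℕ) : ℝ :=
  if m = 2 then 1 else ((m : ℝ) - 1) * Real.log (m - 1) / (m - 2)

lemma pottsC_succ {m : ℕ} (hm : 2 ≤ m) : pottsC (m + 1) * m ≤ pottsC m * (m + 1) := by
  rcases eq_or_lt_of_le hm with rfl | hm3
  · have := Real.log_two_lt_d9
    norm_num [pottsC]
    linarith
  · unfold pottsC
    rw [if_neg (by omega), if_neg (by omega)]
    push_cast
    obtain ⟨j, rfl⟩ : ∃ j, m = j + 1 := ⟨m - 1, by omega⟩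
    have hj : (2 : ℝ) ≤ j := by
      have : 2 ≤ j := by omega
      exact_mod_cast this
    push_cast
    rw [show (j : ℝ) + 1 + 1 - 1 = j + 1 by ring, show (j : ℝ) + 1 - 1 = j by ring,
      show (j : ℝ) + 1 + 1 - 2 = j by ring, show (j : ℝ) + 1 - 2 = j - 1 by ring]
    have hlog : Real.log (j + 1) ≤ Real.log j + 1 / j := by
      have h := Real.log_le_sub_one_of_pos (x := ((j : ℝ) + 1) / j) (by positivity)
      rw [Real.log_div (by positivity) (by positivity)] at h
      have : ((j : ℝ) + 1) / j - 1 = 1 / j := by field_simp; ring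
      linarith
    have hmain : ((j : ℝ) ^ 2 - 1) * (j + 1) ≤ (j ^ 2 + j + 1) * j * Real.log j := by
      rcases eq_or_lt_of_le (show 2 ≤ j by omega) with h2 | h3
      · subst h2
        have := Real.log_two_gt_d9
        norm_num
        linarith
      · have h3' : (3 : ℝ) ≤ j := by exact_mod_cast h3
        have h1 : 1 ≤ Real.log j := by
          rw [Real.le_log_iff_exp_le (by linarith)]
          linarith [Real.exp_one_lt_d9]
        have : (0 : ℝ) ≤ (j ^ 2 + j + 1) * j := by positivity
        nlinarith
    have hj0 : (0 : ℝ) < j := by linarith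
    have hj1 : (0 : ℝ) < j - 1 := by linarith
    have h5 : ((j : ℝ) + 1) ^ 2 * (j - 1) * Real.log (j + 1) ≤ j ^ 2 * (j + 2) * Real.log j := by
      have h6 : ((j : ℝ) + 1) ^ 2 * (j - 1) * Real.log (j + 1) ≤
          ((j : ℝ) + 1) ^ 2 * (j - 1) * (Real.log j + 1 / j) :=
        mul_le_mul_of_nonneg_left hlog (by positivity)
      have h7 : ((j : ℝ) + 1) ^ 2 * (j - 1) * (1 / j) ≤ (j ^ 2 + j + 1) * Real.log j := by
        rw [mul_one_div, div_le_iff₀ hj0]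
        linarith
      nlinarith
    rw [div_mul_eq_mul_div, div_mul_eq_mul_div, div_le_div_iff₀ hj0 hj1]
    nlinarith

lemma pottsC_nonneg {m : ℕ} (hm : 2 ≤ m) : 0 ≤ pottsC m := by
  unfold pottsC
  split_ifs with h
  · norm_num
  · have : (3 : ℝ) ≤ m := by exact_mod_cast (by omega : 3 ≤ m)
    exact div_nonneg (mul_nonneg (by linarith) (Real.log_nonneg (by linarith))) (by linarith)

lemma binary_pottsC {m : ℕ} {q : ℝ} (hm : 2 ≤ m) (h0 : 0 ≤ q) (h1 : q ≤ 1) :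
    pottsC m * (q ^ 2 + (1 - q) ^ 2 / ((m : ℝ) - 1) - 1 / m) ≤
      q * Real.log q + (1 - q) * Real.log (1 - q) + Real.log m -
        (1 - q) * Real.log ((m : ℝ) - 1) := by
  unfold pottsC
  split_ifs with h
  · subst h
    have hx : |2 * q - 1| ≤ 1 := abs_le.2 ⟨by linarith, by linarith⟩
    have := sq_le_binPhi hx
    rw [binPhi_eq] at this
    norm_num
    nlinarith
  · exact binary_potts (by exact_mod_cast (by omega : 2 < m)) h0 h1

/-- The mean-field Potts inequality: relative entropy with respect to the uniform distribution
dominates the squared Euclidean distance, with the critical constant. -/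
theorem potts_inequality {ι : Type*} (m : ℕ) (hm : 2 ≤ m) (s : Finset ι) (hs : s.card = m)
    (y : ι → ℝ) (hy : ∀ i ∈ s, 0 ≤ y i) (hsum : ∑ i ∈ s, y i = 1) :
    pottsC m * (∑ i ∈ s, y i ^ 2 - 1 / m) ≤ ∑ i ∈ s, y i * Real.log (m * y i) := by
  have expand : ∀ (t : Finset ι) (z : ι → ℝ) (k : ℕ), k ≠ 0 → ∑ i ∈ t, z i = 1 →
      ∑ i ∈ t, z i * Real.log (k * z i) = Real.log k + ∑ i ∈ t, z i * Real.log (z i) := by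
    intro t z k hk ht
    have : ∀ i ∈ t, z i * Real.log (k * z i) = z i * Real.log k + z i * Real.log (z i) := by
      intro i _
      rcases eq_or_ne (z i) 0 with h | h
      · simp [h]
      · rw [Real.log_mul (by exact_mod_cast hk) h]; ring
    rw [sum_congr rfl this, sum_add_distrib, ← sum_mul, ht, one_mul]
  induction m, hm using Nat.le_induction generalizing s y with
  | base =>
    obtain ⟨a, b, hab, rfl⟩ := card_eq_two.1 hs
    rw [sum_pair hab] at hsum
    have hb : y b = 1 - y a := by linarith
    have h := binary_pottsC (m := 2) le_rfl (hy a (by simp)) (by linarith [hy b (by simp)])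
    rw [expand _ _ _ two_ne_zero (by rw [sum_pair hab, hsum]), sum_pair hab, sum_pair hab, hb]
    norm_num at h ⊢
    linarith
  | succ m hm ih =>
    have hne : s.Nonempty := card_pos.1 (by omega)
    obtain ⟨i, his, himax⟩ := exists_max_image s y hne
    have hm0 : (0 : ℝ) < m := by exact_mod_cast (by omega : 0 < m)
    set q := y i with hq
    have hq0 : 0 ≤ q := hy i his
    have hrest : ∑ j ∈ s.erase i, y j = 1 - q := by
      rw [← hsum, ← add_sum_erase s y his]; ring
    have hrest0 : 0 ≤ 1 - q := by
      rw [← hrest]; exact sum_nonneg fun j hj => hy j (mem_of_mem_erase hj)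
    have hqm : 1 ≤ ((m : ℝ) + 1) * q := by
      have : ∑ j ∈ s, y j ≤ s.card • q := sum_le_card_nsmul _ _ _ himax
      rw [hsum, hs, nsmul_eq_mul] at this
      push_cast at this
      exact this
    have hbin := binary_pottsC (m := m + 1) (by omega) hq0 (by linarith : q ≤ 1)
    rw [expand _ _ _ (by omega) hsum, ← add_sum_erase s _ his, ← add_sum_erase s _ his]
    push_cast at hbin ⊢
    rw [show (m : ℝ) + 1 - 1 = m by ring] at hbin
    have hcard : (s.erase i).card = m := by rw [card_erase_of_mem his, hs]; rfl
    have hc := pottsC_nonneg (m := m + 1) (by omega)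
    suffices h : pottsC (m + 1) * (∑ j ∈ s.erase i, y j ^ 2 - (1 - q) ^ 2 / m) ≤
        ∑ j ∈ s.erase i, y j * Real.log (y j) - (1 - q) * Real.log (1 - q)
          + (1 - q) * Real.log m by
      simp only [← hq]
      linarith
    rcases eq_or_lt_of_le hrest0 with h1 | h1
    · have hz : ∀ j ∈ s.erase i, y j = 0 :=
        (sum_eq_zero_iff_of_nonneg fun j hj => hy j (mem_of_mem_erase hj)).1 (by rw [hrest, ← h1])
      rw [sum_eq_zero (fun j hj => by rw [hz j hj]; ring),
        sum_eq_zero (fun j hj => by rw [hz j hj]; ring), ← h1]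
      simp
    · have hih := ih (s.erase i) hcard (fun j => y j / (1 - q))
        (fun j hj => div_nonneg (hy j (mem_of_mem_erase hj)) hrest0)
        (by rw [← sum_div, hrest, div_self h1.ne'])
      rw [expand _ _ _ (by omega) (by rw [← sum_div, hrest, div_self h1.ne'])] at hih
      have e1 : ∑ j ∈ s.erase i, (y j / (1 - q)) ^ 2 =
          (∑ j ∈ s.erase i, y j ^ 2) / (1 - q) ^ 2 := by
        rw [sum_div]; exact sum_congr rfl fun j _ => by rw [div_pow]
      have e2 : (1 - q) * ∑ j ∈ s.erase i, y j / (1 - q) * Real.log (y j / (1 - q)) =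
          ∑ j ∈ s.erase i, y j * Real.log (y j) - (1 - q) * Real.log (1 - q) := by
        have : ∀ j ∈ s.erase i, (1 - q) * (y j / (1 - q) * Real.log (y j / (1 - q))) =
            y j * Real.log (y j) - y j * Real.log (1 - q) := by
          intro j _
          rcases eq_or_ne (y j) 0 with h | h
          · simp [h]
          · rw [Real.log_div h h1.ne']
            field_simp
        rw [mul_sum, sum_congr rfl this, sum_sub_distrib, ← sum_mul, hrest]
      have hS : 0 ≤ (∑ j ∈ s.erase i, y j ^ 2) / (1 - q) ^ 2 - 1 / m := by
        have := sq_sum_le_card_mul_sum_sq (s := s.erase i) (f := y)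
        rw [hrest, hcard] at this
        rw [sub_nonneg, div_le_div_iff₀ hm0 (by positivity)]
        linarith
      have hcc : pottsC (m + 1) * (1 - q) ≤ pottsC m := by
        have h2 := pottsC_succ hm
        have h3 : pottsC (m + 1) * (1 - q) * (m + 1) ≤ pottsC (m + 1) * m := by
          rw [mul_assoc]
          exact mul_le_mul_of_nonneg_left (by linarith) hc
        exact le_of_mul_le_mul_right (h3.trans h2) (by positivity)
      rw [e1] at hih
      have h4 := mul_le_mul_of_nonneg_left hih hrest0
      rw [mul_add, e2] at h4
      have h5 := mul_le_mul_of_nonneg_right hcc hS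
      have h6 := mul_le_mul_of_nonneg_left h5 hrest0
      have e3 : (1 - q) * (pottsC (m + 1) * (1 - q) *
          ((∑ j ∈ s.erase i, y j ^ 2) / (1 - q) ^ 2 - 1 / m)) =
          pottsC (m + 1) * (∑ j ∈ s.erase i, y j ^ 2 - (1 - q) ^ 2 / m) := by
        field_simp
      rw [e3] at h6
      linarith

lemma sub_mul_rpow_neg_le {θ x y : ℝ} (hθ0 : 0 ≤ θ) (hθ1 : θ < 1) (hx : 0 < x) (hy : 0 ≤ y) :
    (x - y) * x ^ (-θ) ≤ (x ^ (1 - θ) - y ^ (1 - θ)) / (1 - θ) := by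
  have h1 : 0 < 1 - θ := by linarith
  rw [le_div_iff₀ h1]
  have hb := rpow_one_add_le_one_add_mul_self (s := y / x - 1) (p := 1 - θ)
    (by have : 0 ≤ y / x := by positivity
        linarith) h1.le (by linarith)
  rw [show 1 + (y / x - 1) = y / x by ring, Real.div_rpow hy hx.le] at hb
  have hxp : 0 < x ^ (1 - θ) := Real.rpow_pos_of_pos hx _
  rw [div_le_iff₀ hxp] at hb
  have e : x ^ (1 - θ) = x * x ^ (-θ) := by
    rw [sub_eq_add_neg, Real.rpow_add hx, Real.rpow_one]
  have : (1 + (1 - θ) * (y / x - 1)) * x ^ (1 - θ) =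
      x ^ (1 - θ) + (1 - θ) * (y - x) * x ^ (-θ) := by
    rw [e]; field_simp
  rw [this] at hb
  linarith

/-- The likelihood ratio of `a` successes in `N` trials for the empirical success probability
against the success probability `p`. -/
noncomputable def binRatio (p : ℝ) (N a : ℕ) : ℝ :=
  ((a : ℝ) / N) ^ a * (1 - (a : ℝ) / N) ^ (N - a) / (p ^ a * (1 - p) ^ (N - a))

lemma binRatio_nonneg {p : ℝ} (h0 : 0 < p) (h1 : p < 1) {N a : ℕ} (ha : a ≤ N) :
    0 ≤ binRatio p N a := by
  have : (a : ℝ) / N ≤ 1 := div_le_one_of_le₀ (by exact_mod_cast ha) (by positivity)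
  have h2 : 0 ≤ 1 - (a : ℝ) / N := by linarith
  have h3 : 0 < 1 - p := by linarith
  unfold binRatio
  positivity

lemma tail_mul_binRatio_le {p : ℝ} (h0 : 0 < p) (h1 : p < 1) {N a : ℕ} (ha : a ≤ N)
    (hpa : p * N ≤ a) :
    (∑ j ∈ Icc a N, (N.choose j : ℝ) * (p ^ j * (1 - p) ^ (N - j))) * binRatio p N a ≤ 1 := by
  have h3 : 0 < 1 - p := by linarith
  rcases Nat.eq_zero_or_pos N with rfl | hN
  · obtain rfl : a = 0 := by omega
    simp [binRatio]
  have hN' : (0 : ℝ) < N := by exact_mod_cast hN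
  set x : ℝ := (a : ℝ) / N with hx
  have hx0 : 0 ≤ x := by positivity
  have hx1 : x ≤ 1 := div_le_one_of_le₀ (by exact_mod_cast ha) (by positivity)
  have hpx : p ≤ x := by rw [hx, le_div_iff₀ hN']; exact hpa
  have key : ∀ j ∈ Icc a N, p ^ j * (1 - p) ^ (N - j) * (x ^ a * (1 - x) ^ (N - a)) ≤
      x ^ j * (1 - x) ^ (N - j) * (p ^ a * (1 - p) ^ (N - a)) := by
    intro j hj
    obtain ⟨haj, hjN⟩ := mem_Icc.1 hj
    obtain ⟨i, rfl⟩ := Nat.exists_eq_add_of_le haj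
    obtain ⟨l, rfl⟩ := Nat.exists_eq_add_of_le hjN
    rw [show a + i + l - (a + i) = l by omega, show a + i + l - a = i + l by omega]
    have hle : (p * (1 - x)) ^ i ≤ (x * (1 - p)) ^ i :=
      pow_le_pow_left₀ (mul_nonneg h0.le (by linarith)) (by nlinarith) _
    have hc : 0 ≤ p ^ a * (1 - p) ^ l * x ^ a * (1 - x) ^ l := by
      have : 0 ≤ 1 - x := by linarith
      positivity
    calc p ^ (a + i) * (1 - p) ^ l * (x ^ a * (1 - x) ^ (i + l))
        = p ^ a * (1 - p) ^ l * x ^ a * (1 - x) ^ l * (p * (1 - x)) ^ i := by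
          rw [mul_pow]; ring
      _ ≤ p ^ a * (1 - p) ^ l * x ^ a * (1 - x) ^ l * (x * (1 - p)) ^ i :=
          mul_le_mul_of_nonneg_left hle hc
      _ = _ := by rw [mul_pow]; ring
  have hden : 0 < p ^ a * (1 - p) ^ (N - a) := by positivity
  unfold binRatio
  rw [← hx, mul_div_assoc', div_le_one hden, sum_mul]
  have hbin : ∑ j ∈ range (N + 1), (N.choose j : ℝ) * (x ^ j * (1 - x) ^ (N - j)) = 1 := by
    have := add_pow x (1 - x) N
    rw [show x + (1 - x) = 1 by ring, one_pow] at this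
    exact (sum_congr rfl fun j _ => by ring).trans this.symm
  have hnn : 0 ≤ 1 - x := by linarith
  calc ∑ j ∈ Icc a N, (N.choose j : ℝ) * (p ^ j * (1 - p) ^ (N - j)) * (x ^ a * (1 - x) ^ (N - a))
      ≤ ∑ j ∈ Icc a N, (N.choose j : ℝ) * (x ^ j * (1 - x) ^ (N - j)) *
          (p ^ a * (1 - p) ^ (N - a)) := by
        refine sum_le_sum fun j hj => ?_
        have := mul_le_mul_of_nonneg_left (key j hj) (Nat.cast_nonneg (α := ℝ) (N.choose j))
        simpa only [mul_assoc] using this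
    _ ≤ ∑ j ∈ range (N + 1), (N.choose j : ℝ) * (x ^ j * (1 - x) ^ (N - j)) *
          (p ^ a * (1 - p) ^ (N - a)) := by
        refine sum_le_sum_of_subset_of_nonneg ?_ fun j _ _ => by positivity
        intro j hj
        rw [mem_range]
        have := (mem_Icc.1 hj).2
        omega
    _ = p ^ a * (1 - p) ^ (N - a) := by rw [← sum_mul, hbin, one_mul]

lemma binomial_half_moment {θ p : ℝ} (hθ0 : 0 ≤ θ) (hθ1 : θ < 1) (h0 : 0 < p) (h1 : p < 1)
    (N : ℕ) :
    ∑ a ∈ (range (N + 1)).filter (fun a : ℕ => p * N ≤ a),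
      (N.choose a : ℝ) * (p ^ a * (1 - p) ^ (N - a)) * binRatio p N a ^ θ ≤ 1 / (1 - θ) := by
  have h3 : 0 < 1 - p := by linarith
  set P : ℕ → ℝ := fun j => (N.choose j : ℝ) * (p ^ j * (1 - p) ^ (N - j)) with hP
  set T : ℕ → ℝ := fun a => ∑ j ∈ Icc a N, P j with hT
  have hP0 : ∀ j, 0 ≤ P j := fun j => by rw [hP]; positivity
  have hT0 : ∀ a, 0 ≤ T a := fun a => sum_nonneg fun j _ => hP0 j
  have hTpos : ∀ a ∈ range (N + 1), 0 < T a := by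
    intro a ha
    have haN : a ≤ N := by rw [mem_range] at ha; omega
    refine sum_pos' (fun j _ => hP0 j) ⟨a, mem_Icc.2 ⟨le_rfl, haN⟩, ?_⟩
    have : 0 < N.choose a := Nat.choose_pos haN
    have : (0 : ℝ) < N.choose a := by exact_mod_cast this
    rw [hP]; positivity
  have hTs : ∀ a ∈ range (N + 1), P a = T a - T (a + 1) := by
    intro a ha
    have haN : a ≤ N := by rw [mem_range] at ha; omega
    have : Icc a N = insert a (Icc (a + 1) N) := by
      ext j; simp only [mem_Icc, mem_insert]; omega
    rw [hT]
    simp only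
    rw [this, sum_insert (by simp)]
    ring
  have hT1 : T 0 = 1 := by
    have := add_pow p (1 - p) N
    rw [show p + (1 - p) = 1 by ring, one_pow] at this
    rw [hT]
    simp only [hP]
    have hI : Icc 0 N = range (N + 1) := by ext j; simp
    rw [hI]
    exact (sum_congr rfl fun j _ => by ring).trans this.symm
  have hTN : T (N + 1) = 0 := by simp [hT]
  calc ∑ a ∈ (range (N + 1)).filter (fun a : ℕ => p * N ≤ a), P a * binRatio p N a ^ θ
      ≤ ∑ a ∈ (range (N + 1)).filter (fun a : ℕ => p * N ≤ a), P a * T a ^ (-θ) := by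
        refine sum_le_sum fun a ha => mul_le_mul_of_nonneg_left ?_ (hP0 a)
        obtain ⟨ha1, ha2⟩ := mem_filter.1 ha
        have haN : a ≤ N := by rw [mem_range] at ha1; omega
        have h := tail_mul_binRatio_le h0 h1 haN ha2
        have hTa := hTpos a ha1
        rw [Real.rpow_neg hTa.le, ← Real.inv_rpow hTa.le]
        refine Real.rpow_le_rpow (binRatio_nonneg h0 h1 haN) ?_ hθ0
        rw [← one_div, le_div_iff₀ hTa, mul_comm]
        exact h
    _ ≤ ∑ a ∈ range (N + 1), P a * T a ^ (-θ) :=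
        sum_le_sum_of_subset_of_nonneg (filter_subset _ _) fun a _ _ =>
          mul_nonneg (hP0 a) (Real.rpow_nonneg (hT0 a) _)
    _ ≤ ∑ a ∈ range (N + 1), (T a ^ (1 - θ) / (1 - θ) - T (a + 1) ^ (1 - θ) / (1 - θ)) := by
        refine sum_le_sum fun a ha => ?_
        rw [hTs a ha, ← sub_div]
        exact sub_mul_rpow_neg_le hθ0 hθ1 (hTpos a ha) (hT0 _)
    _ = 1 / (1 - θ) := by
        rw [sum_range_sub', hT1, hTN, Real.one_rpow, Real.zero_rpow (by linarith)]
        simp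

lemma binRatio_reflect (p : ℝ) {N a : ℕ} (ha : a ≤ N) :
    binRatio (1 - p) N (N - a) = binRatio p N a := by
  unfold binRatio
  rcases Nat.eq_zero_or_pos N with rfl | hN
  · obtain rfl : a = 0 := by omega
    simp
  have hN' : (N : ℝ) ≠ 0 := by exact_mod_cast hN.ne'
  have e1 : ((N - a : ℕ) : ℝ) / N = 1 - (a : ℝ) / N := by
    rw [Nat.cast_sub ha, sub_div, div_self hN']
  rw [e1, Nat.sub_sub_self ha, sub_sub_cancel, sub_sub_cancel, mul_comm, mul_comm (p ^ a)]

/-- Exponential moments of the relative entropy of the empirical distribution of a binomial. -/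
lemma binomial_entropy_moment {θ p : ℝ} (hθ0 : 0 ≤ θ) (hθ1 : θ < 1) (h0 : 0 < p) (h1 : p < 1)
    (N : ℕ) :
    ∑ a ∈ range (N + 1), (N.choose a : ℝ) * (p ^ a * (1 - p) ^ (N - a)) * binRatio p N a ^ θ
      ≤ 2 / (1 - θ) := by
  have h3 : 0 < 1 - p := by linarith
  have hA := binomial_half_moment hθ0 hθ1 h0 h1 N
  have hB := binomial_half_moment hθ0 hθ1 h3 (by linarith) N
  rw [← sum_filter_add_sum_filter_not (range (N + 1)) (fun a : ℕ => p * N ≤ a)]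
  have hle : ∑ a ∈ (range (N + 1)).filter (fun a : ℕ => ¬ p * N ≤ a),
      (N.choose a : ℝ) * (p ^ a * (1 - p) ^ (N - a)) * binRatio p N a ^ θ ≤
      ∑ a ∈ (range (N + 1)).filter (fun a : ℕ => (1 - p) * N ≤ a),
      (N.choose a : ℝ) * ((1 - p) ^ a * (1 - (1 - p)) ^ (N - a)) * binRatio (1 - p) N a ^ θ := by
    have hinj : Set.InjOn (fun a => N - a)
        ((range (N + 1)).filter (fun a : ℕ => ¬ p * N ≤ a) : Set ℕ) := by
      intro a ha b hb hab
      simp only [coe_filter, mem_range, Set.mem_ofPred_eq] at ha hb hab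
      omega
    have : ∑ a ∈ (range (N + 1)).filter (fun a : ℕ => ¬ p * N ≤ a),
        (N.choose a : ℝ) * (p ^ a * (1 - p) ^ (N - a)) * binRatio p N a ^ θ =
        ∑ b ∈ ((range (N + 1)).filter (fun a : ℕ => ¬ p * N ≤ a)).image (fun a => N - a),
        (N.choose b : ℝ) * ((1 - p) ^ b * (1 - (1 - p)) ^ (N - b)) *
          binRatio (1 - p) N b ^ θ := by
      rw [sum_image hinj]
      refine sum_congr rfl fun a ha => ?_
      have haN : a ≤ N := by
        have := (mem_filter.1 ha).1
        rw [mem_range] at this; omega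
      rw [binRatio_reflect p haN, Nat.choose_symm haN, Nat.sub_sub_self haN, sub_sub_cancel,
        mul_comm ((1 - p) ^ (N - a))]
    rw [this]
    refine sum_le_sum_of_subset_of_nonneg ?_ fun a ha _ => ?_
    · intro b hb
      obtain ⟨a, ha, rfl⟩ := mem_image.1 hb
      obtain ⟨ha1, ha2⟩ := mem_filter.1 ha
      have haN : a ≤ N := by rw [mem_range] at ha1; omega
      refine mem_filter.2 ⟨by rw [mem_range]; omega, ?_⟩
      rw [Nat.cast_sub haN]
      push Not at ha2
      linarith
    · have haN : a ≤ N := by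
        have := (mem_filter.1 ha).1
        rw [mem_range] at this; omega
      have := binRatio_nonneg h3 (by linarith) haN
      have h4 : 0 ≤ 1 - (1 - p) := by linarith
      positivity
  have : 2 / (1 - θ) = 1 / (1 - θ) + 1 / (1 - θ) := by ring
  linarith

/-- The product `∏ c ^ c` over the colour-class sizes `c` of `τ`. -/
noncomputable def selfPow {α : Type} [Fintype α] {m : ℕ} (τ : α → Fin m) : ℝ :=
  ∏ j, (((univ.filter fun x => τ x = j).card : ℝ)) ^ (univ.filter fun x => τ x = j).card

lemma selfPow_nonneg {α : Type} [Fintype α] {m : ℕ} (τ : α → Fin m) : 0 ≤ selfPow τ :=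
  prod_nonneg fun _ _ => by positivity

/-- Extend a colouring of the complement of `A` by giving `A` a new last colour. -/
noncomputable def extendLast {α : Type} {m : ℕ} (A : Finset α) (τ : {x // x ∉ A} → Fin m) (x : α) :
    Fin (m + 1) :=
  if h : x ∈ A then Fin.last m else (τ ⟨x, h⟩).castSucc

lemma extendLast_eq_last {α : Type} {m : ℕ} (A : Finset α) (τ : {x // x ∉ A} → Fin m) (x : α) :
    extendLast A τ x = Fin.last m ↔ x ∈ A := by
  unfold extendLast
  split_ifs with h
  · simp [h]
  · simp [h]

lemma selfPow_extendLast {α : Type} [Fintype α] [DecidableEq α] {m : ℕ} (A : Finset α)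
    (τ : {x // x ∉ A} → Fin m) :
    selfPow (extendLast A τ) = selfPow τ * (A.card : ℝ) ^ A.card := by
  unfold selfPow
  rw [Fin.prod_univ_castSucc]
  congr 1
  · refine prod_congr rfl fun j _ => ?_
    have : (univ.filter fun x => extendLast A τ x = j.castSucc).card =
        (univ.filter fun x => τ x = j).card := by
      rw [← card_map (Function.Embedding.subtype fun x => x ∉ A)]
      congr 1
      ext x
      rw [Finset.mem_filter, Finset.mem_map]
      by_cases h : x ∈ A
      · simp [extendLast, h, (Fin.castSucc_lt_last j).ne']
      · simp [extendLast, h]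
    rw [this]
  · have : (univ.filter fun x => extendLast A τ x = Fin.last m) = A := by
      ext x; simp [extendLast_eq_last]
    rw [this]

lemma sum_extendLast {α : Type} [Fintype α] [DecidableEq α] {m : ℕ} (F : (α → Fin (m + 1)) → ℝ) :
    ∑ τ, F τ = ∑ A : Finset α, ∑ τ : {x // x ∉ A} → Fin m, F (extendLast A τ) := by
  rw [← sum_fiberwise univ (fun τ : α → Fin (m + 1) => univ.filter fun x => τ x = Fin.last m) F]
  refine sum_congr rfl fun A _ => ?_
  symm
  refine sum_bij (fun τ _ => extendLast A τ) ?_ ?_ ?_ ?_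
  · intro τ _
    rw [mem_filter]
    refine ⟨mem_univ _, ?_⟩
    ext x; simp [extendLast_eq_last]
  · intro τ _ τ' _ h
    funext x
    have := congrFun h x.1
    simpa [extendLast, x.2] using this
  · intro τ hτ
    have hA : ∀ x, x ∉ A → τ x ≠ Fin.last m := by
      intro x hx h
      apply hx
      rw [← (mem_filter.1 hτ).2]
      simp [h]
    refine ⟨fun x => (τ x.1).castPred (hA x.1 x.2), mem_univ _, ?_⟩
    funext x
    unfold extendLast
    split_ifs with h
    · rw [← (mem_filter.1 hτ).2] at h
      exact (mem_filter.1 h).2.symm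
    · simp
  · intros; rfl

/-- Exponential moments of the relative entropy of a uniform multinomial, in product form. -/
theorem multinomial_entropy_moment {θ : ℝ} (hθ0 : 0 ≤ θ) (hθ1 : θ < 1) (m : ℕ) (hm : 1 ≤ m) :
    ∃ C : ℝ, 0 < C ∧ ∀ (α : Type) [Fintype α] [DecidableEq α], ∑ τ : α → Fin m, selfPow τ ^ θ ≤
      C * (((m : ℝ) ^ Fintype.card α) ^ (1 - θ) *
        ((Fintype.card α : ℝ) ^ Fintype.card α) ^ θ) := by
  induction m, hm using Nat.le_induction with
  | base =>
    refine ⟨1, one_pos, fun α _ _ => ?_⟩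
    rw [Fintype.sum_unique]
    have : (univ.filter fun x : α => (default : α → Fin 1) x = 0) = univ :=
      filter_true_of_mem fun x _ => Subsingleton.elim _ _
    simp only [selfPow, Fin.prod_univ_one, this, card_univ]
    simp
  | succ m hm ih =>
    obtain ⟨C, hC, ih⟩ := ih
    have hθ : 0 < 1 - θ := by linarith
    refine ⟨C * (2 / (1 - θ)), by positivity, fun α _ _ => ?_⟩
    set N := Fintype.card α with hN
    have hm0 : (0 : ℝ) < m := by exact_mod_cast hm
    have hm1 : (0 : ℝ) < (m : ℝ) + 1 := by positivity
    set p : ℝ := 1 / (m + 1) with hp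
    have hp0 : 0 < p := by positivity
    have hq : 1 - p = m / (m + 1) := by rw [hp]; field_simp; ring
    have hp1 : p < 1 := by
      have : 0 < 1 - p := by rw [hq]; positivity
      linarith
    have step1 : ∑ τ : α → Fin (m + 1), selfPow τ ^ θ ≤
        ∑ A : Finset α, C * ((((m : ℝ) ^ (N - A.card)) ^ (1 - θ) *
        (((N - A.card : ℕ) : ℝ) ^ (N - A.card)) ^ θ) * ((A.card : ℝ) ^ A.card) ^ θ) := by
      rw [sum_extendLast]
      refine sum_le_sum fun A _ => ?_
      have hcard : Fintype.card {x // x ∉ A} = N - A.card := by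
        rw [Fintype.card_subtype_compl, Fintype.card_coe]
      have := ih {x // x ∉ A}
      rw [hcard] at this
      simp_rw [selfPow_extendLast]
      have e : ∀ τ : {x // x ∉ A} → Fin m, (selfPow τ * (A.card : ℝ) ^ A.card) ^ θ =
          selfPow τ ^ θ * ((A.card : ℝ) ^ A.card) ^ θ := fun τ =>
        Real.mul_rpow (selfPow_nonneg τ) (by positivity)
      simp_rw [e]
      rw [← sum_mul, ← mul_assoc]
      exact mul_le_mul_of_nonneg_right this (by positivity)
    have step2 : ∀ a ∈ range (N + 1), (N.choose a : ℝ) * ((((m : ℝ) ^ (N - a)) ^ (1 - θ) *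
        (((N - a : ℕ) : ℝ) ^ (N - a)) ^ θ) * ((a : ℝ) ^ a) ^ θ) =
        (N.choose a : ℝ) * (p ^ a * (1 - p) ^ (N - a)) * binRatio p N a ^ θ *
        (((m + 1 : ℝ) ^ N) ^ (1 - θ) * ((N : ℝ) ^ N) ^ θ) := by
      intro a ha
      have haN : a ≤ N := by rw [mem_range] at ha; omega
      have e1 : p ^ a * (1 - p) ^ (N - a) = (m : ℝ) ^ (N - a) / (m + 1) ^ N := by
        rw [hq, hp, div_pow, div_pow, one_pow, div_mul_div_comm, one_mul, ← pow_add,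
          Nat.add_sub_cancel' haN]
      have e2 : ((a : ℝ) / N) ^ a * (1 - (a : ℝ) / N) ^ (N - a) =
          (a : ℝ) ^ a * ((N - a : ℕ) : ℝ) ^ (N - a) / (N : ℝ) ^ N := by
        rcases Nat.eq_zero_or_pos N with h | h
        · have : a = 0 := by omega
          simp [h, this]
        · have hN' : (N : ℝ) ≠ 0 := by exact_mod_cast h.ne'
          have : 1 - (a : ℝ) / N = ((N - a : ℕ) : ℝ) / N := by
            rw [Nat.cast_sub haN, sub_div, div_self hN']
          rw [this, div_pow, div_pow, div_mul_div_comm, ← pow_add, Nat.add_sub_cancel' haN]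
      have hNN : (0 : ℝ) < (N : ℝ) ^ N := by
        rcases Nat.eq_zero_or_pos N with h | h
        · simp [h]
        · have : (0 : ℝ) < N := by exact_mod_cast h
          positivity
      unfold binRatio
      rw [e1, e2]
      set X : ℝ := (m : ℝ) ^ (N - a) with hX
      set Y : ℝ := (m + 1 : ℝ) ^ N with hY
      set A : ℝ := (a : ℝ) ^ a with hA
      set B : ℝ := ((N - a : ℕ) : ℝ) ^ (N - a) with hB
      set D : ℝ := (N : ℝ) ^ N with hD
      have hX0 : 0 < X := by positivity
      have hY0 : 0 < Y := by positivity
      have hA0 : 0 ≤ A := by positivity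
      have hB0 : 0 ≤ B := by positivity
      rw [Real.div_rpow (by positivity) (by positivity), Real.div_rpow (by positivity) hNN.le,
        Real.mul_rpow hA0 hB0, Real.div_rpow hX0.le hY0.le, Real.rpow_sub hX0, Real.rpow_sub hY0,
        Real.rpow_one, Real.rpow_one]
      have h1 : 0 < X ^ θ := Real.rpow_pos_of_pos hX0 _
      have h2 : 0 < Y ^ θ := Real.rpow_pos_of_pos hY0 _
      have h3 : 0 < D ^ θ := Real.rpow_pos_of_pos hNN _
      field_simp
    have step3 : ∑ A : Finset α, C * ((((m : ℝ) ^ (N - A.card)) ^ (1 - θ) *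
        (((N - A.card : ℕ) : ℝ) ^ (N - A.card)) ^ θ) * ((A.card : ℝ) ^ A.card) ^ θ) =
        C * ∑ a ∈ range (N + 1), (N.choose a : ℝ) * ((((m : ℝ) ^ (N - a)) ^ (1 - θ) *
        (((N - a : ℕ) : ℝ) ^ (N - a)) ^ θ) * ((a : ℝ) ^ a) ^ θ) := by
      rw [← mul_sum]
      congr 1
      have := sum_powerset_apply_card (f := fun a : ℕ => (((m : ℝ) ^ (N - a)) ^ (1 - θ) *
        (((N - a : ℕ) : ℝ) ^ (N - a)) ^ θ) * ((a : ℝ) ^ a) ^ θ) (x := (univ : Finset α))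
      rw [powerset_univ, card_univ, ← hN] at this
      rw [this]
      exact sum_congr rfl fun a _ => by rw [nsmul_eq_mul]
    rw [step3, sum_congr rfl step2, ← sum_mul] at step1
    refine step1.trans ?_
    push_cast
    rw [mul_assoc C]
    refine mul_le_mul_of_nonneg_left ?_ hC.le
    exact mul_le_mul_of_nonneg_right (binomial_entropy_moment hθ0 hθ1 hp0 hp1 N) (by positivity)

section Bernoulli

variable {ι : Type*} [Fintype ι] [DecidableEq ι]

/-- The probability that a random subset, containing each `i` independently with probability
`q i`, equals `A`. -/
noncomputable def wt (q : ι → ℝ) (A : Finset ι) : ℝ := ∏ i, if i ∈ A then q i else 1 - q i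

lemma sum_prod_ite_mem (f g : ι → ℝ) :
    ∑ A : Finset ι, ∏ i, (if i ∈ A then f i else g i) = ∏ i, (f i + g i) := by
  rw [prod_add, powerset_univ]
  refine sum_congr rfl fun A _ => ?_
  rw [prod_ite]
  congr 1
  · exact prod_congr (by ext; simp) fun _ _ => rfl
  · exact prod_congr (by ext; simp) fun _ _ => rfl

lemma sum_wt_mul_prod_ite (q f g : ι → ℝ) :
    ∑ A : Finset ι, wt q A * ∏ i, (if i ∈ A then f i else g i) =
      ∏ i, (q i * f i + (1 - q i) * g i) := by
  rw [← sum_prod_ite_mem]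
  refine sum_congr rfl fun A _ => ?_
  rw [wt, ← prod_mul_distrib]
  refine prod_congr rfl fun i _ => ?_
  split_ifs <;> rfl

lemma sum_wt (q : ι → ℝ) : ∑ A : Finset ι, wt q A = 1 := by
  have := sum_wt_mul_prod_ite q (fun _ => 1) (fun _ => 1)
  simpa using this

lemma wt_nonneg {q : ι → ℝ} (h0 : ∀ i, 0 ≤ q i) (h1 : ∀ i, q i ≤ 1) (A : Finset ι) :
    0 ≤ wt q A := by
  refine prod_nonneg fun i _ => ?_
  split_ifs
  · exact h0 i
  · linarith [h1 i]

lemma sum_wt_mul_subset (q : ι → ℝ) (S : Finset ι) :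
    ∑ A : Finset ι, wt q A * (if S ⊆ A then 1 else 0) = ∏ i ∈ S, q i := by
  have h : ∀ A : Finset ι, (if S ⊆ A then (1 : ℝ) else 0) =
      ∏ i, if i ∈ A then 1 else if i ∈ S then 0 else 1 := by
    intro A
    split_ifs with hS
    · symm
      refine prod_eq_one fun i _ => ?_
      split_ifs with h1 h2
      · rfl
      · exact absurd (hS h2) h1
      · rfl
    · obtain ⟨i, hi, hiA⟩ := not_subset.1 hS
      exact (prod_eq_zero (mem_univ i) (by simp [hi, hiA])).symm
  simp_rw [h]
  rw [sum_wt_mul_prod_ite, ← prod_subset (subset_univ S)]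
  · refine prod_congr rfl fun i hi => by simp [hi]
  · intro i _ hi
    simp [hi]

lemma wt_mul_wt_le (q : ι → ℝ) (A B : Finset ι) :
    wt q A * wt q B ≤ wt q (A ⊓ B) * wt q (A ⊔ B) := by
  apply le_of_eq
  simp only [wt, ← prod_mul_distrib, inf_eq_inter, sup_eq_union, mem_inter, mem_union]
  refine prod_congr rfl fun i _ => ?_
  by_cases h1 : i ∈ A <;> by_cases h2 : i ∈ B <;> simp [h1, h2, mul_comm]

/-- Harris' inequality for the event that the random set contains no member of a family. -/
lemma harris_avoid {q : ι → ℝ} (h0 : ∀ i, 0 ≤ q i) (h1 : ∀ i, q i ≤ 1)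
    (F : Finset (Finset ι)) :
    ∏ C ∈ F, (1 - ∏ i ∈ C, q i) ≤
      ∑ A : Finset ι, wt q A * (if ∀ C ∈ F, ¬ C ⊆ A then 1 else 0) := by
  induction F using Finset.induction_on with
  | empty => simp [sum_wt]
  | insert C F hC ih =>
    rw [prod_insert hC]
    set f : Finset ι → ℝ := fun A => if C ⊆ A then 1 else 0 with hf
    set g : Finset ι → ℝ := fun A => if ∀ C ∈ F, ¬ C ⊆ A then 0 else 1 with hg
    have hw := wt_nonneg h0 h1
    have hfm : Monotone f := by
      intro A B hAB
      simp only [hf]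
      by_cases h : C ⊆ A
      · simp [h, h.trans hAB]
      · simp only [h, if_false]; positivity
    have hgm : Monotone g := by
      intro A B hAB
      simp only [hg]
      by_cases h : ∀ C ∈ F, ¬ C ⊆ B
      · have h' : ∀ C ∈ F, ¬ C ⊆ A := fun C hC hCA => h C hC (hCA.trans hAB)
        rw [if_pos h, if_pos h']
      · rw [if_neg h]; split_ifs <;> norm_num
    have key := fkg (μ := wt q) (f := f) (g := g) (fun A => hw A)
      (fun A => by simp only [hf, Pi.zero_apply]; positivity)
      (fun A => by simp only [hg, Pi.zero_apply]; split_ifs <;> norm_num) hfm hgm (wt_mul_wt_le q)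
    rw [sum_wt, one_mul] at key
    have hEf : ∑ A, wt q A * f A = ∏ i ∈ C, q i := sum_wt_mul_subset q C
    have hEg : ∑ A, wt q A * g A =
        1 - ∑ A : Finset ι, wt q A * (if ∀ C ∈ F, ¬ C ⊆ A then 1 else 0) := by
      rw [eq_sub_iff_add_eq, ← sum_add_distrib]
      refine Eq.trans ?_ (sum_wt q)
      refine sum_congr rfl fun A _ => ?_
      simp only [hg]
      split_ifs <;> ring
    have hall : ∑ A : Finset ι, wt q A * (if ∀ D ∈ insert C F, ¬ D ⊆ A then 1 else 0) =
        1 - ∑ A, wt q A * f A - ∑ A, wt q A * g A + ∑ A, wt q A * (f A * g A) := by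
      have : ∑ A : Finset ι, wt q A * (if ∀ D ∈ insert C F, ¬ D ⊆ A then 1 else 0) =
          ∑ A : Finset ι, wt q A - ∑ A, wt q A * f A - ∑ A, wt q A * g A +
            ∑ A, wt q A * (f A * g A) := by
        rw [← sum_sub_distrib, ← sum_sub_distrib, ← sum_add_distrib]
        refine sum_congr rfl fun A _ => ?_
        simp only [hf, hg, forall_mem_insert]
        by_cases h2 : ∀ C ∈ F, ¬ C ⊆ A
        · by_cases h1 : C ⊆ A
          · rw [if_neg (fun h => h.1 h1), if_pos h1, if_pos h2]; ring
          · rw [if_pos ⟨h1, h2⟩, if_neg h1, if_pos h2]; ring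
        · rw [if_neg (fun h => h2 h.2), if_neg h2]; ring
      rw [this, sum_wt]
    rw [hall]
    rw [hEf, hEg] at key ⊢
    have hle : ∏ i ∈ C, q i ≤ 1 := prod_le_one (fun i _ => h0 i) fun i _ => h1 i
    nlinarith [mul_le_mul_of_nonneg_left ih (sub_nonneg.2 hle)]

/-- Harris' inequality for the event that the random set contains `S` and no member of a family. -/
lemma harris_contain_avoid {q : ι → ℝ} (h0 : ∀ i, 0 ≤ q i) (h1 : ∀ i, q i ≤ 1)
    (S : Finset ι) (F : Finset (Finset ι)) :
    (∏ i ∈ S, q i) * ∏ C ∈ F, (1 - ∏ i ∈ C \ S, q i) ≤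
      ∑ A : Finset ι, wt q A * (if S ⊆ A ∧ ∀ C ∈ F, ¬ C ⊆ A then 1 else 0) := by
  set q' : ι → ℝ := fun i => if i ∈ S then 1 else q i with hq'
  have h := harris_avoid (q := q') (fun i => by simp only [hq']; split_ifs; norm_num; exact h0 i)
    (fun i => by simp only [hq']; split_ifs; exact le_rfl; exact h1 i) F
  have hprod : ∀ C : Finset ι, ∏ i ∈ C, q' i = ∏ i ∈ C \ S, q i := by
    intro C
    rw [← prod_subset (sdiff_subset (s := C) (t := S))]
    · refine prod_congr rfl fun i hi => ?_
      simp [hq', (mem_sdiff.1 hi).2]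
    · intro i hi hi'
      have : i ∈ S := by by_contra hS; exact hi' (mem_sdiff.2 ⟨hi, hS⟩)
      simp [hq', this]
  simp_rw [hprod] at h
  have hS0 : 0 ≤ ∏ i ∈ S, q i := prod_nonneg fun i _ => h0 i
  refine (mul_le_mul_of_nonneg_left h hS0).trans (le_of_eq ?_)
  rw [mul_sum]
  refine sum_congr rfl fun A _ => ?_
  have hw : (∏ i ∈ S, q i) * wt q' A = wt q A * if S ⊆ A then 1 else 0 := by
    by_cases hSA : S ⊆ A
    · rw [if_pos hSA, mul_one, wt, wt, prod_subset_one_on_sdiff (s₁ := S) (s₂ := univ)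
        (f := q) (g := fun i => if i ∈ S then q i else 1) (subset_univ S)
        (fun i hi => by simp [(mem_sdiff.1 hi).2]) (fun i hi => by simp [hi]),
        ← prod_mul_distrib]
      refine prod_congr rfl fun i _ => ?_
      by_cases hi : i ∈ S
      · simp [hq', hi, hSA hi]
      · simp [hq', hi]
    · rw [if_neg hSA, mul_zero]
      obtain ⟨i, hi, hiA⟩ := not_subset.1 hSA
      rw [wt, prod_eq_zero (mem_univ i) (by simp [hq', hi, hiA]), mul_zero]
  rw [← mul_assoc, hw, mul_assoc]
  congr 1
  by_cases h1 : S ⊆ A <;> by_cases h2 : ∀ C ∈ F, ¬ C ⊆ A <;> simp [h1, h2]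

end Bernoulli

/-- The potential edges on the vertex set `Fin n`. -/
abbrev Edge (n : ℕ) : Type := {e : Fin n × Fin n // e.1 < e.2}

/-- The endpoints of an edge. -/
def ends {n : ℕ} (e : Edge n) : Finset (Fin n) := {e.1.1, e.1.2}

/-- The graph with a given set of edges. -/
def edgeGraph {n : ℕ} (A : Finset (Edge n)) : SimpleGraph (Fin n) where
  Adj u v := ∃ e ∈ A, (e.1.1 = u ∧ e.1.2 = v) ∨ (e.1.1 = v ∧ e.1.2 = u)
  symm := ⟨fun u v ⟨e, he, h⟩ => ⟨e, he, h.symm⟩⟩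
  loopless := ⟨fun u ⟨e, _, h⟩ => by
    have := e.2
    rcases h with h | h <;> simp [h.1, h.2] at this⟩

lemma edgeGraph_adj_edge {n : ℕ} (A : Finset (Edge n)) (e : Edge n) :
    (edgeGraph A).Adj e.1.1 e.1.2 ↔ e ∈ A := by
  constructor
  · rintro ⟨f, hf, h | h⟩
    · have : f = e := Subtype.ext (Prod.ext h.1 h.2)
      rwa [← this]
    · have h1 := f.2
      have h2 := e.2
      rw [h.1, h.2] at h1
      exact absurd h1 h2.asymm
  · exact fun h => ⟨e, h, Or.inl ⟨rfl, rfl⟩⟩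

lemma card_edgeFinset_edgeGraph {n : ℕ} (A : Finset (Edge n)) :
    (edgeGraph A).edgeFinset.card = A.card := by
  symm
  refine card_bij (fun e _ => s(e.1.1, e.1.2)) ?_ ?_ ?_
  · intro e he
    rw [SimpleGraph.mem_edgeFinset, SimpleGraph.mem_edgeSet]
    exact (edgeGraph_adj_edge A e).2 he
  · intro e _ f _ h
    rw [Sym2.eq_iff] at h
    rcases h with h | h
    · exact Subtype.ext (Prod.ext h.1 h.2)
    · have h1 := f.2
      have h2 := e.2
      rw [h.1, h.2] at h2
      exact absurd h1 h2.asymm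
  · intro b hb
    induction b using Sym2.ind with
    | _ u v =>
      rw [SimpleGraph.mem_edgeFinset, SimpleGraph.mem_edgeSet] at hb
      obtain ⟨e, he, h | h⟩ := hb
      · exact ⟨e, he, by rw [h.1, h.2]⟩
      · exact ⟨e, he, by rw [h.1, h.2, Sym2.eq_swap]⟩

lemma card_edge (n : ℕ) : Fintype.card (Edge n) = n.choose 2 := by
  have h : (edgeGraph (univ : Finset (Edge n))) = ⊤ := by
    ext u v
    simp only [SimpleGraph.top_adj]
    constructor
    · exact fun h => h.ne
    · intro h
      rcases lt_or_gt_of_ne h with h | h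
      · exact ⟨⟨(u, v), h⟩, mem_univ _, Or.inl ⟨rfl, rfl⟩⟩
      · exact ⟨⟨(v, u), h⟩, mem_univ _, Or.inr ⟨rfl, rfl⟩⟩
  have h1 := card_edgeFinset_edgeGraph (univ : Finset (Edge n))
  rw [card_univ] at h1
  have h2 := SimpleGraph.card_edgeFinset_top_eq_card_choose_two (V := Fin n)
  rw [Fintype.card_fin] at h2
  rw [← h1, ← h2]
  congr!

lemma erdosRenyiProb_eq (n : ℕ) (p : ℝ) (P : SimpleGraph (Fin n) → Prop) :
    erdosRenyiProb n p P =
      ∑ A : Finset (Edge n), wt (fun _ => p) A * (if P (edgeGraph A) then 1 else 0) := by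
  unfold erdosRenyiProb
  symm
  refine sum_bij (fun A _ => edgeGraph A) (fun _ _ => mem_univ _) ?_ ?_ ?_
  · intro A _ B _ h
    ext e
    rw [← edgeGraph_adj_edge, ← edgeGraph_adj_edge, h]
  · intro G _
    refine ⟨univ.filter fun e : Edge n => G.Adj e.1.1 e.1.2, mem_univ _, ?_⟩
    ext u v
    constructor
    · rintro ⟨e, he, h | h⟩
      · have := (mem_filter.1 he).2
        rwa [h.1, h.2] at this
      · have := (mem_filter.1 he).2
        rw [h.1, h.2] at this
        exact this.symm
    · intro h
      rcases lt_or_gt_of_ne h.ne with h1 | h1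
      · exact ⟨⟨(u, v), h1⟩, mem_filter.2 ⟨mem_univ _, h⟩, Or.inl ⟨rfl, rfl⟩⟩
      · exact ⟨⟨(v, u), h1⟩, mem_filter.2 ⟨mem_univ _, h.symm⟩, Or.inr ⟨rfl, rfl⟩⟩
  · intro A _
    rw [card_edgeFinset_edgeGraph, ← card_edge]
    have : wt (fun _ => p) A = p ^ A.card * (1 - p) ^ (Fintype.card (Edge n) - A.card) := by
      rw [wt, prod_ite, prod_const, prod_const]
      congr 2
      · congr 1; ext; simp
      · rw [← card_compl]; congr 1; ext; simp
    rw [this]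
    split_ifs <;> simp

lemma sum_pairs_eq {n : ℕ} (f : Fin n → Fin n → ℝ) (hf : ∀ u v, f u v = f v u) :
    ∑ u, ∑ v, f u v = 2 * ∑ e : Edge n, f e.1.1 e.1.2 + ∑ u, f u u := by
  have h1 : ∑ e : Edge n, f e.1.1 e.1.2 =
      ∑ x ∈ (univ : Finset (Fin n × Fin n)).filter (fun x => x.1 < x.2), f x.1 x.2 :=
    (sum_subtype _ (fun x => by simp) (fun x : Fin n × Fin n => f x.1 x.2)).symm
  have h2 : ∑ x ∈ (univ : Finset (Fin n × Fin n)).filter (fun x => x.2 < x.1), f x.1 x.2 =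
      ∑ x ∈ (univ : Finset (Fin n × Fin n)).filter (fun x => x.1 < x.2), f x.1 x.2 := by
    refine sum_bij (fun x _ => x.swap) ?_ ?_ ?_ ?_
    · intro x hx; simpa using hx
    · intro x _ y _ h; exact Prod.swap_injective h
    · intro x hx; exact ⟨x.swap, by simpa using hx, by simp⟩
    · intro x _; exact hf _ _
  have h3 : ∑ x ∈ (univ : Finset (Fin n × Fin n)).filter (fun x => x.1 = x.2), f x.1 x.2 =
      ∑ u, f u u := by
    symm
    refine sum_bij (fun u _ => (u, u)) ?_ ?_ ?_ ?_
    · intro u _; simp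
    · intro u _ v _ h; exact (Prod.ext_iff.1 h).1
    · rintro ⟨u, v⟩ hx
      obtain rfl : u = v := by simpa using hx
      exact ⟨u, mem_univ _, rfl⟩
    · intros; rfl
  rw [← Fintype.sum_prod_type', ← sum_filter_add_sum_filter_not univ
    (fun x : Fin n × Fin n => x.1 < x.2), ← sum_filter_add_sum_filter_not
    (univ.filter fun x : Fin n × Fin n => ¬ x.1 < x.2) (fun x : Fin n × Fin n => x.1 = x.2),
    filter_filter, filter_filter, h1]
  have e1 : (univ : Finset (Fin n × Fin n)).filter (fun x => ¬ x.1 < x.2 ∧ x.1 = x.2) =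
      univ.filter (fun x => x.1 = x.2) := by
    ext x; simp only [mem_filter, mem_univ, true_and, not_lt]
    exact ⟨fun h => h.2, fun h => ⟨h.ge, h⟩⟩
  have e2 : (univ : Finset (Fin n × Fin n)).filter (fun x => ¬ x.1 < x.2 ∧ ¬ x.1 = x.2) =
      univ.filter (fun x => x.2 < x.1) := by
    ext x; simp only [mem_filter, mem_univ, true_and, not_lt]
    exact ⟨fun h => lt_of_le_of_ne h.1 (Ne.symm h.2), fun h => ⟨h.le, h.ne'⟩⟩
  rw [e1, e2, h2, h3]
  ring

lemma sum_sum_color_eq {n K : ℕ} (σ : Fin n → Fin K) :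
    ∑ u, ∑ v, (if σ u = σ v then (1 : ℝ) else 0) =
      ∑ c, ((univ.filter fun u => σ u = c).card : ℝ) ^ 2 := by
  have : ∀ u, ∑ v, (if σ u = σ v then (1 : ℝ) else 0) =
      ((univ.filter fun v => σ v = σ u).card : ℝ) := by
    intro u
    rw [sum_ite, sum_const, sum_const_zero, add_zero, nsmul_eq_mul, mul_one]
    congr 2; ext v; simp [eq_comm]
  simp_rw [this]
  rw [← sum_fiberwise univ σ]
  refine sum_congr rfl fun c _ => ?_
  rw [sum_congr rfl (g := fun _ => ((univ.filter fun v => σ v = c).card : ℝ))]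
  · rw [sum_const, nsmul_eq_mul, sq]
  · intro u hu
    rw [(mem_filter.1 hu).2]

lemma sum_card_color {n K : ℕ} (σ : Fin n → Fin K) :
    ∑ c, ((univ.filter fun u => σ u = c).card : ℝ) = n := by
  have := card_eq_sum_card_fiberwise (s := univ) (t := univ) (f := σ) (fun _ _ => mem_univ _)
  rw [card_univ, Fintype.card_fin] at this
  exact_mod_cast this.symm

lemma mono_count_ge {n K : ℕ} (hK : 0 < K) (σ : Fin n → Fin K) :
    (n : ℝ) ^ 2 / (2 * K) - n / 2 ≤ ∑ e : Edge n, if σ e.1.1 = σ e.1.2 then (1 : ℝ) else 0 := by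
  have h := sum_pairs_eq (fun u v => if σ u = σ v then (1 : ℝ) else 0)
    (fun u v => by simp only [eq_comm])
  simp only [if_true, sum_const, card_univ, Fintype.card_fin, nsmul_eq_mul, mul_one] at h
  rw [sum_sum_color_eq] at h
  have hcs := sq_sum_le_card_mul_sum_sq (s := univ)
    (f := fun c => ((univ.filter fun u => σ u = c).card : ℝ))
  rw [sum_card_color, card_univ, Fintype.card_fin] at hcs
  have hK' : (0 : ℝ) < K := by exact_mod_cast hK
  have : (n : ℝ) ^ 2 / (2 * K) = (n : ℝ) ^ 2 / K / 2 := by field_simp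
  have h2 : (n : ℝ) ^ 2 / K ≤ ∑ c, ((univ.filter fun u => σ u = c).card : ℝ) ^ 2 := by
    rw [div_le_iff₀ hK']; linarith
  linarith

lemma proper_iff {n K : ℕ} (A : Finset (Edge n)) :
    (edgeGraph A).Colorable K ↔ ∃ σ : Fin n → Fin K, ∀ e ∈ A, σ e.1.1 ≠ σ e.1.2 := by
  constructor
  · rintro ⟨c⟩
    exact ⟨c, fun e he => c.valid ((edgeGraph_adj_edge A e).2 he)⟩
  · rintro ⟨σ, hσ⟩
    refine ⟨SimpleGraph.Coloring.mk σ ?_⟩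
    rintro u v ⟨e, he, h | h⟩
    · have := hσ e he; rwa [h.1, h.2] at this
    · have := hσ e he; rw [h.1, h.2] at this; exact this.symm

lemma sum_wt_exp_card {n : ℕ} {p : ℝ} (s : ℝ) (h0 : 0 ≤ p) (h1 : p ≤ 1) :
    ∑ A : Finset (Edge n), wt (fun _ => p) A * Real.exp (s * A.card) ≤
      Real.exp (p * (Real.exp s - 1) * (n.choose 2 : ℕ)) := by
  have : ∀ A : Finset (Edge n), Real.exp (s * A.card) =
      ∏ e, if e ∈ A then Real.exp s else 1 := by
    intro A
    rw [prod_ite, prod_const_one, mul_one, prod_const, mul_comm, Real.exp_nat_mul]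
    congr 2; ext; simp
  simp_rw [this]
  rw [sum_wt_mul_prod_ite, prod_const, card_univ, card_edge, mul_comm _ ((n.choose 2 : ℕ) : ℝ),
    Real.exp_nat_mul]
  refine pow_le_pow_left₀ ?_ ?_ _
  · have := Real.exp_pos s
    have : 0 ≤ 1 - p := by linarith
    positivity
  · have := Real.add_one_le_exp (p * (Real.exp s - 1))
    linarith

lemma sum_wt_proper_exp_card {n K : ℕ} (hK : 0 < K) {p t : ℝ} (h0 : 0 ≤ p) (h1 : p ≤ 1)
    (ht : 0 ≤ t) (σ : Fin n → Fin K) :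
    ∑ A : Finset (Edge n), wt (fun _ => p) A *
      ((if ∀ e ∈ A, σ e.1.1 ≠ σ e.1.2 then 1 else 0) * Real.exp (t * A.card)) ≤
      Real.exp (p * (Real.exp t - 1) * (n.choose 2 : ℕ) -
        p * Real.exp t * ((n : ℝ) ^ 2 / (2 * K) - n / 2)) := by
  have : ∀ A : Finset (Edge n),
      (if ∀ e ∈ A, σ e.1.1 ≠ σ e.1.2 then (1 : ℝ) else 0) * Real.exp (t * A.card) =
      ∏ e, if e ∈ A then (if σ e.1.1 = σ e.1.2 then 0 else Real.exp t) else 1 := by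
    intro A
    split_ifs with h
    · rw [one_mul, prod_ite, prod_const_one, mul_one, mul_comm, Real.exp_nat_mul]
      have e1 : (univ.filter fun e => e ∈ A) = A := by ext; simp
      rw [e1, ← prod_const]
      exact prod_congr rfl fun e he => by rw [if_neg (h e he)]
    · push Not at h
      obtain ⟨e, he, h⟩ := h
      rw [zero_mul, prod_eq_zero (mem_univ e)]
      simp [he, h]
  simp_rw [this]
  rw [sum_wt_mul_prod_ite]
  have ht1 : 0 ≤ Real.exp t - 1 := by linarith [Real.add_one_le_exp t]
  calc _ ≤ ∏ e : Edge n, Real.exp (p * (Real.exp t - 1) - p * Real.exp t *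
        (if σ e.1.1 = σ e.1.2 then 1 else 0)) := by
        refine prod_le_prod (fun e _ => ?_) fun e _ => ?_
        · have : 0 ≤ 1 - p := by linarith
          have := Real.exp_pos t
          split_ifs <;> positivity
        · have := Real.add_one_le_exp (p * (Real.exp t - 1) - p * Real.exp t *
            (if σ e.1.1 = σ e.1.2 then 1 else 0))
          refine le_trans (le_of_eq ?_) this
          split_ifs <;> ring
    _ = Real.exp (p * (Real.exp t - 1) * (n.choose 2 : ℕ) -
        p * Real.exp t * ∑ e : Edge n, (if σ e.1.1 = σ e.1.2 then 1 else 0)) := by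
        rw [← Real.exp_sum, sum_sub_distrib, sum_const, card_univ, card_edge, ← mul_sum,
          nsmul_eq_mul, mul_comm (n.choose 2 : ℝ)]
    _ ≤ _ := by
        rw [Real.exp_le_exp]
        have := mul_le_mul_of_nonneg_left (mono_count_ge hK σ)
          (mul_nonneg h0 (Real.exp_pos t).le)
        linarith

lemma prob_colorable_le {n K : ℕ} (hK : 0 < K) {p t s m : ℝ} (h0 : 0 ≤ p) (h1 : p ≤ 1)
    (ht : 0 ≤ t) (hs : 0 ≤ s) :
    ∑ A : Finset (Edge n), wt (fun _ => p) A * (if (edgeGraph A).Colorable K then 1 else 0) ≤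
      Real.exp (p * (Real.exp (-s) - 1) * (n.choose 2 : ℕ) + s * m) +
      (K : ℝ) ^ n * Real.exp (p * (Real.exp t - 1) * (n.choose 2 : ℕ) -
        p * Real.exp t * ((n : ℝ) ^ 2 / (2 * K) - n / 2) - t * m) := by
  have hw := wt_nonneg (q := fun _ : Edge n => p) (fun _ => h0) (fun _ => h1)
  calc _ ≤ ∑ A : Finset (Edge n), (wt (fun _ => p) A * Real.exp (-s * A.card) * Real.exp (s * m) +
        ∑ σ : Fin n → Fin K, wt (fun _ => p) A *
          ((if ∀ e ∈ A, σ e.1.1 ≠ σ e.1.2 then 1 else 0) * Real.exp (t * A.card)) *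
            Real.exp (-(t * m))) := by
        refine sum_le_sum fun A _ => ?_
        simp_rw [mul_assoc]
        rw [← mul_sum, ← mul_add]
        refine mul_le_mul_of_nonneg_left ?_ (hw A)
        simp_rw [← Real.exp_add]
        have hnn : 0 ≤ ∑ σ : Fin n → Fin K,
            (if ∀ e ∈ A, σ e.1.1 ≠ σ e.1.2 then (1 : ℝ) else 0) *
              Real.exp (t * A.card + -(t * m)) :=
          sum_nonneg fun σ _ => mul_nonneg (by split_ifs <;> norm_num) (Real.exp_pos _).le
        have hpos := Real.exp_pos (-s * A.card + s * m)
        split_ifs with hc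
        · rcases le_total (A.card : ℝ) m with hm | hm
          · have : (1 : ℝ) ≤ Real.exp (-s * A.card + s * m) :=
              Real.one_le_exp (by nlinarith)
            linarith
          · obtain ⟨σ, hσ⟩ := (proper_iff A).1 hc
            have h1 : (1 : ℝ) ≤ Real.exp (t * A.card + -(t * m)) :=
              Real.one_le_exp (by nlinarith)
            have h2 := single_le_sum (f := fun σ : Fin n → Fin K =>
              (if ∀ e ∈ A, σ e.1.1 ≠ σ e.1.2 then (1 : ℝ) else 0) *
              Real.exp (t * A.card + -(t * m)))
              (fun σ _ => mul_nonneg (by split_ifs <;> norm_num) (Real.exp_pos _).le)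
              (mem_univ σ)
            simp only [if_pos hσ, one_mul] at h2
            linarith
        · linarith
    _ = (∑ A : Finset (Edge n), wt (fun _ => p) A * Real.exp (-s * A.card)) * Real.exp (s * m) +
        ∑ σ : Fin n → Fin K, (∑ A : Finset (Edge n), wt (fun _ => p) A *
          ((if ∀ e ∈ A, σ e.1.1 ≠ σ e.1.2 then 1 else 0) * Real.exp (t * A.card))) *
            Real.exp (-(t * m)) := by
        rw [sum_add_distrib, sum_comm]
        simp_rw [sum_mul]
    _ ≤ _ := by
        refine add_le_add ?_ ?_
        · rw [Real.exp_add]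
          exact mul_le_mul_of_nonneg_right (sum_wt_exp_card (-s) h0 h1) (Real.exp_pos _).le
        · calc _ ≤ ∑ σ : Fin n → Fin K, Real.exp (p * (Real.exp t - 1) * (n.choose 2 : ℕ) -
                p * Real.exp t * ((n : ℝ) ^ 2 / (2 * K) - n / 2)) * Real.exp (-(t * m)) :=
                sum_le_sum fun σ _ => mul_le_mul_of_nonneg_right
                  (sum_wt_proper_exp_card hK h0 h1 ht σ) (Real.exp_pos _).le
            _ = _ := by
                rw [sum_const, card_univ, Fintype.card_fun, Fintype.card_fin, Fintype.card_fin,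
                  nsmul_eq_mul, ← Real.exp_add, Nat.cast_pow]
                rfl

lemma exp_sub_one_le {t : ℝ} (h : |t| ≤ 1) : Real.exp t - 1 ≤ t + t ^ 2 := by
  have := (abs_le.1 (Real.abs_exp_sub_one_sub_id_le h)).2
  linarith

lemma tendsto_exp_linear {c C : ℝ} (hc : c < 0) :
    Tendsto (fun n : ℕ => Real.exp (c * n + C)) atTop (nhds 0) := by
  refine Real.tendsto_exp_atBot.comp ?_
  exact tendsto_atBot_add_const_right _ _
    (tendsto_natCast_atTop_atTop.const_mul_atTop_of_neg hc)

/-- Above the first-moment threshold, the random graph is w.h.p. not `K`-colourable. -/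
theorem tendsto_prob_colorable_zero {d : ℝ} (hd : 0 < d) {K : ℕ} (hK : 0 < K)
    (h : 2 * K * Real.log K ≤ d) :
    Tendsto (fun n : ℕ => ∑ A : Finset (Edge n), wt (fun _ => d / n) A *
      (if (edgeGraph A).Colorable K then 1 else 0)) atTop (nhds 0) := by
  have hK' : (1 : ℝ) ≤ K := by exact_mod_cast hK
  have hK0 : (0 : ℝ) < K := by linarith
  set x : ℝ := 1 / K with hx
  have hx0 : 0 < x := by positivity
  have hx1 : x ≤ 1 := by rw [hx, div_le_one hK0]; exact hK'
  have hlog : Real.log K ≤ d / 2 * x := by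
    rw [hx]
    have : Real.log K = 2 * K * Real.log K / (2 * K) := by field_simp
    rw [this, div_le_iff₀ (by positivity)]
    calc _ ≤ d := h
      _ = _ := by field_simp
  set t : ℝ := x / 4 with ht
  set c1 : ℝ := - (d / 2 * (x ^ 2 / 16)) with hc1
  set c2 : ℝ := - (d / 2 * (x ^ 2 / 16)) with hc2
  have hc1' : c1 < 0 := by rw [hc1]; exact neg_lt_zero.2 (by positivity)
  have hT := (tendsto_exp_linear (c := c1) (C := d / 2) hc1').add
    (tendsto_exp_linear (c := c2) (C := d / 2 * Real.exp t) hc1')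
  rw [add_zero] at hT
  refine tendsto_of_tendsto_of_tendsto_of_le_of_le' tendsto_const_nhds hT ?_ ?_
  · filter_upwards [eventually_ge_atTop (max 1 ⌈d⌉₊)] with n hn
    have hn1 : (1 : ℝ) ≤ n := by exact_mod_cast (le_max_left _ _).trans hn
    have hnd : d ≤ n := Nat.ceil_le.1 ((le_max_right _ _).trans hn)
    refine sum_nonneg fun A _ => mul_nonneg (wt_nonneg (fun _ => by positivity)
      (fun _ => div_le_one_of_le₀ hnd (by linarith)) A) (by split_ifs <;> norm_num)
  · filter_upwards [eventually_ge_atTop (max 1 ⌈d⌉₊)] with n hn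
    have hn1 : (1 : ℝ) ≤ n := by exact_mod_cast (le_max_left _ _).trans hn
    have hn0 : (0 : ℝ) < n := by linarith
    have hnd : d ≤ n := Nat.ceil_le.1 ((le_max_right _ _).trans hn)
    have hp0 : 0 ≤ d / n := by positivity
    have hp1 : d / n ≤ 1 := div_le_one_of_le₀ hnd (by linarith)
    refine (prob_colorable_le hK hp0 hp1 (t := t) (s := x / 4) (m := (1 - x / 2) * (d * n / 2))
      (by positivity) (by positivity)).trans ?_
    have hch : ((n.choose 2 : ℕ) : ℝ) = n * (n - 1) / 2 := Nat.cast_choose_two ℝ n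
    have hdN : d / n * (n.choose 2 : ℕ) = d * (n - 1) / 2 := by rw [hch]; field_simp
    refine add_le_add ?_ ?_
    · rw [Real.exp_le_exp]
      have he := exp_sub_one_le (t := -(x / 4))
        (by rw [abs_neg, abs_of_pos (by positivity)]; linarith)
      have : d / n * (Real.exp (-(x / 4)) - 1) * (n.choose 2 : ℕ) =
          (Real.exp (-(x / 4)) - 1) * (d * (n - 1) / 2) := by rw [← hdN]; ring
      rw [this]
      have h1 : 0 ≤ d * (n - 1) / 2 := by
        have : 0 ≤ (n : ℝ) - 1 := by linarith
        positivity
      have h2 := mul_le_mul_of_nonneg_right he h1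
      refine (add_le_add_left h2 _).trans ?_
      rw [hc1]
      have : 0 ≤ d * (1 - x / 4 + x ^ 2 / 16) := mul_nonneg hd.le (by nlinarith)
      nlinarith
    · rw [← Real.exp_log (pow_pos hK0 n), ← Real.exp_add, Real.exp_le_exp, Real.log_pow]
      have he := exp_sub_one_le (t := t) (by rw [abs_of_pos (by positivity), ht]; linarith)
      have e1 : d / n * (Real.exp t - 1) * (n.choose 2 : ℕ) =
          (Real.exp t - 1) * (d * (n - 1) / 2) := by rw [← hdN]; ring
      have e2 : d / n * Real.exp t * ((n : ℝ) ^ 2 / (2 * K) - n / 2) =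
          Real.exp t * (d * n / 2 * x - d / 2) := by rw [hx]; field_simp
      rw [e1, e2]
      have h1 : (n : ℝ) * Real.log K ≤ n * (d / 2 * x) :=
        mul_le_mul_of_nonneg_left hlog hn0.le
      have h3 : 0 ≤ d * n / 2 := by positivity
      have ht1 : 0 ≤ Real.exp t - 1 := by
        have : 0 < t := by rw [ht]; positivity
        linarith [Real.add_one_le_exp t]
      have key : (Real.exp t - 1) * (1 - x) ≤ (t + t ^ 2) * (1 - x) :=
        mul_le_mul_of_nonneg_right he (by linarith)
      have key2 : (t + t ^ 2) * (1 - x) - t * (1 - x / 2) ≤ - (x ^ 2 / 16) := by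
        rw [ht]; nlinarith [pow_pos hx0 3]
      have key3 : d * n / 2 * ((Real.exp t - 1) * (1 - x) - t * (1 - x / 2)) ≤
          d * n / 2 * (- (x ^ 2 / 16)) := mul_le_mul_of_nonneg_left (by linarith) h3
      rw [hc2]
      nlinarith [mul_nonneg ht1 hd.le]

/-- The centred edge weight of a colouring: `-1` on monochromatic edges. -/
noncomputable def xi {n K : ℕ} (σ : Fin n → Fin K) (e : Edge n) : ℝ :=
  if σ e.1.1 = σ e.1.2 then -1 else 1 / ((K : ℝ) - 1)

/-- A colouring is balanced if no colour class exceeds its expected size by much. -/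
def Balanced {n K : ℕ} (σ : Fin n → Fin K) : Prop :=
  ∀ c, ((univ.filter fun u => σ u = c).card : ℝ) ≤
    (1 + 1 / ((K : ℝ) * ((K : ℝ) - 2))) * n / K

lemma sum_class_card {α : Type} [Fintype α] {m : ℕ} (τ : α → Fin m) :
    ∑ j, ((univ.filter fun x => τ x = j).card : ℝ) = Fintype.card α := by
  have := card_eq_sum_card_fiberwise (s := univ) (t := univ) (f := τ) (fun _ _ => mem_univ _)
  rw [card_univ] at this
  exact_mod_cast this.symm

lemma natCast_pow_self_pos (N : ℕ) : (0 : ℝ) < (N : ℝ) ^ N := by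
  rcases Nat.eq_zero_or_pos N with h | h
  · simp [h]
  · have : (0 : ℝ) < N := by exact_mod_cast h
    positivity

lemma selfPow_pos {α : Type} [Fintype α] {m : ℕ} (τ : α → Fin m) : 0 < selfPow τ :=
  prod_pos fun _ _ => natCast_pow_self_pos _

lemma potts_selfPow {α : Type} [Fintype α] {K : ℕ} (hK : 2 ≤ K) (τ : α → Fin K) :
    pottsC K * (∑ j, ((univ.filter fun x => τ x = j).card : ℝ) ^ 2 -
      (Fintype.card α : ℝ) ^ 2 / K) ≤
    Fintype.card α * Real.log (selfPow τ * (K : ℝ) ^ Fintype.card α /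
      (Fintype.card α : ℝ) ^ Fintype.card α) := by
  set N := Fintype.card α with hN
  set c : Fin K → ℕ := fun j => (univ.filter fun x => τ x = j).card with hc
  have hsum : ∑ j, (c j : ℝ) = N := sum_class_card τ
  rcases Nat.eq_zero_or_pos N with h0 | h0
  · have : ∀ j, (c j : ℝ) = 0 := by
      intro j
      rw [h0, Nat.cast_zero] at hsum
      exact (sum_eq_zero_iff_of_nonneg (fun j _ => by positivity)).1 hsum j (mem_univ j)
    simp only [hc] at this
    simp [h0, this]
  have hN0 : (0 : ℝ) < N := by exact_mod_cast h0
  have hK0 : (0 : ℝ) < K := by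
    have : 0 < K := by omega
    exact_mod_cast this
  have hp := potts_inequality K hK (univ : Finset (Fin K)) (by simp) (fun j => (c j : ℝ) / N)
    (fun j _ => by positivity) (by rw [← sum_div, hsum, div_self hN0.ne'])
  have e1 : ∑ j, ((c j : ℝ) / N) ^ 2 - 1 / K = (∑ j, (c j : ℝ) ^ 2 - (N : ℝ) ^ 2 / K) / N ^ 2 := by
    simp_rw [div_pow]
    rw [← sum_div, sub_div]
    congr 1
    field_simp
  have e2 : N * ∑ j, (c j : ℝ) / N * Real.log (K * ((c j : ℝ) / N)) =
      Real.log (selfPow τ * (K : ℝ) ^ N / (N : ℝ) ^ N) := by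
    have hNN := natCast_pow_self_pos N
    rw [Real.log_div (mul_pos (selfPow_pos τ) (by positivity)).ne' hNN.ne',
      Real.log_mul (selfPow_pos τ).ne' (by positivity), Real.log_pow, Real.log_pow, selfPow,
      Real.log_prod (fun j _ => (natCast_pow_self_pos _).ne'), mul_sum]
    have : ∀ j, N * ((c j : ℝ) / N * Real.log (K * ((c j : ℝ) / N))) =
        Real.log ((c j : ℝ) ^ c j) + c j * (Real.log K - Real.log N) := by
      intro j
      rw [Real.log_pow]
      rcases Nat.eq_zero_or_pos (c j) with h | h
      · simp [h]
      · have : (0 : ℝ) < c j := by exact_mod_cast h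
        rw [Real.log_mul hK0.ne' (by positivity), Real.log_div this.ne' hN0.ne']
        field_simp
        ring
    rw [sum_congr rfl fun j _ => this j, sum_add_distrib, ← sum_mul, hsum]
    ring
  rw [e1] at hp
  have := mul_le_mul_of_nonneg_left hp (by positivity : (0 : ℝ) ≤ (N : ℝ) ^ 2)
  change pottsC K * (∑ j, (c j : ℝ) ^ 2 - (N : ℝ) ^ 2 / K) ≤ _
  calc _ = (N : ℝ) ^ 2 * (pottsC K * ((∑ j, (c j : ℝ) ^ 2 - (N : ℝ) ^ 2 / K) / N ^ 2)) := by
        field_simp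
    _ ≤ _ := this
    _ = _ := by rw [← e2]; ring

lemma exp_le_selfPow_rpow {α : Type} [Fintype α] {K : ℕ} (hK : 2 ≤ K) (hc : 0 < pottsC K)
    {θ κ : ℝ} (hκ : 0 ≤ κ) (h : κ * Fintype.card α ≤ θ * pottsC K) (τ : α → Fin K) :
    Real.exp (κ * (∑ j, ((univ.filter fun x => τ x = j).card : ℝ) ^ 2 -
      (Fintype.card α : ℝ) ^ 2 / K)) ≤
    (selfPow τ * (K : ℝ) ^ Fintype.card α / (Fintype.card α : ℝ) ^ Fintype.card α) ^ θ := by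
  have hp := potts_selfPow hK τ
  set N := Fintype.card α with hN
  have hK0 : (0 : ℝ) < K := by
    have : 0 < K := by omega
    exact_mod_cast this
  have hR : 0 < selfPow τ * (K : ℝ) ^ N / (N : ℝ) ^ N :=
    div_pos (mul_pos (selfPow_pos τ) (by positivity)) (natCast_pow_self_pos N)
  rw [Real.rpow_def_of_pos hR, Real.exp_le_exp]
  set Q := ∑ j, ((univ.filter fun x => τ x = j).card : ℝ) ^ 2 - (N : ℝ) ^ 2 / K with hQ
  set l := Real.log (selfPow τ * (K : ℝ) ^ N / (N : ℝ) ^ N) with hl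
  have hQ0 : 0 ≤ Q := by
    have hcs := sq_sum_le_card_mul_sum_sq (s := univ)
      (f := fun j => ((univ.filter fun x => τ x = j).card : ℝ))
    rw [sum_class_card, card_univ, Fintype.card_fin] at hcs
    rw [hQ, sub_nonneg, div_le_iff₀ hK0]
    linarith
  have h1 : κ * Q * pottsC K ≤ κ * (N * l) := by
    rw [mul_assoc, mul_comm Q]
    exact mul_le_mul_of_nonneg_left hp hκ
  rcases Nat.eq_zero_or_pos N with h0 | h0
  · have : κ * Q * pottsC K ≤ 0 := by simpa [h0] using h1
    have hQz : κ * Q ≤ 0 := by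
      by_contra hh
      push Not at hh
      exact absurd (mul_pos hh hc) (not_lt.2 this)
    have hl0 : l = 0 := by
      rw [hl, h0]
      have : IsEmpty α := Fintype.card_eq_zero_iff.1 (hN.symm.trans h0)
      simp [selfPow, Finset.univ_eq_empty]
    rw [hl0, zero_mul]; exact hQz
  · have hN0 : (0 : ℝ) < N := by exact_mod_cast h0
    have hl0 : 0 ≤ l := by
      have : 0 ≤ N * l := (mul_nonneg hc.le hQ0).trans hp
      exact nonneg_of_mul_nonneg_right this hN0
    have h2 : κ * (N * l) ≤ θ * pottsC K * l := by
      rw [← mul_assoc]; exact mul_le_mul_of_nonneg_right h hl0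
    have : κ * Q * pottsC K ≤ (l * θ) * pottsC K := by linarith
    exact le_of_mul_le_mul_right this hc

/-- Restricting a map to the fibres of `σ`. -/
def fiberEquiv {n K : ℕ} (σ : Fin n → Fin K) (β : Type) :
    (Fin n → β) ≃ (∀ i : Fin K, {u // σ u = i} → β) where
  toFun τ _ x := τ x.1
  invFun p u := p (σ u) ⟨u, rfl⟩
  left_inv _ := rfl
  right_inv p := by
    funext i ⟨u, hu⟩
    subst hu
    rfl

lemma sum_prod_fiber {n K m : ℕ} (σ : Fin n → Fin K)
    (g : ∀ i : Fin K, ({u // σ u = i} → Fin m) → ℝ) :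
    ∑ τ : Fin n → Fin m, ∏ i, g i (fun x => τ x.1) = ∏ i, ∑ τ, g i τ := by
  rw [Fintype.prod_sum]
  exact Fintype.sum_equiv (fiberEquiv σ (Fin m)) _ _ fun _ => rfl

lemma xi_eq {n K : ℕ} (hK : 2 ≤ K) (σ : Fin n → Fin K) (e : Edge n) :
    xi σ e = (1 - K * (if σ e.1.1 = σ e.1.2 then 1 else 0)) / ((K : ℝ) - 1) := by
  have : (2 : ℝ) ≤ K := by exact_mod_cast hK
  have h : (K : ℝ) - 1 ≠ 0 := by linarith
  unfold xi
  split_ifs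
  · field_simp; ring
  · simp

lemma sum_xi_mul_xi_le {n K : ℕ} (hK : 2 ≤ K) (σ τ : Fin n → Fin K) :
    ∑ e, xi σ e * xi τ e ≤ (K : ℝ) ^ 2 / (2 * ((K : ℝ) - 1) ^ 2) *
      ∑ i, (∑ j, ((univ.filter fun x : {u // σ u = i} => τ x.1 = j).card : ℝ) ^ 2 -
        (Fintype.card {u // σ u = i} : ℝ) ^ 2 / K) := by
  have hK2 : (2 : ℝ) ≤ K := by exact_mod_cast hK
  have hK1 : 0 < (K : ℝ) - 1 := by linarith
  have h := sum_pairs_eq (fun u v : Fin n =>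
    (1 - K * (if σ u = σ v then (1 : ℝ) else 0)) / ((K : ℝ) - 1) *
    ((1 - K * (if τ u = τ v then (1 : ℝ) else 0)) / ((K : ℝ) - 1)))
    (fun u v => by simp only [eq_comm])
  simp only [← xi_eq hK] at h
  have hdiag : 0 ≤ ∑ u : Fin n, (1 - (K : ℝ) * (if σ u = σ u then 1 else 0)) / ((K : ℝ) - 1) *
    ((1 - K * (if τ u = τ u then (1 : ℝ) else 0)) / ((K : ℝ) - 1)) :=
    sum_nonneg fun u _ => by simp only [if_true]; exact mul_self_nonneg _
  have hexp : ∑ u : Fin n, ∑ v : Fin n,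
      (1 - K * (if σ u = σ v then (1 : ℝ) else 0)) / ((K : ℝ) - 1) *
      ((1 - K * (if τ u = τ v then (1 : ℝ) else 0)) / ((K : ℝ) - 1)) =
      1 / ((K : ℝ) - 1) ^ 2 * ((n : ℝ) ^ 2 -
        K * ∑ u, ∑ v, (if σ u = σ v then (1 : ℝ) else 0) -
        K * ∑ u, ∑ v, (if τ u = τ v then (1 : ℝ) else 0) + K ^ 2 *
        ∑ u, ∑ v, (if σ u = σ v then (1 : ℝ) else 0) * (if τ u = τ v then (1 : ℝ) else 0)) := by
    have hn : (n : ℝ) ^ 2 = ∑ _u : Fin n, ∑ _v : Fin n, (1 : ℝ) := by simp [sq]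
    rw [hn]
    simp only [mul_sum, ← sum_sub_distrib, ← sum_add_distrib]
    refine sum_congr rfl fun u _ => sum_congr rfl fun v _ => ?_
    field_simp
    ring
  have hclass : ∀ i, (univ.filter fun u => σ u = i).card = Fintype.card {u // σ u = i} :=
    fun i => (Fintype.card_subtype _).symm
  have hjoint : ∑ u, ∑ v, (if σ u = σ v then (1 : ℝ) else 0) * (if τ u = τ v then (1 : ℝ) else 0) =
      ∑ i, ∑ j, ((univ.filter fun x : {u // σ u = i} => τ x.1 = j).card : ℝ) ^ 2 := by
    have hN : ∀ i j, (univ.filter fun x : {u // σ u = i} => τ x.1 = j).card =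
        (univ.filter fun u => σ u = i ∧ τ u = j).card := by
      intro i j
      rw [← card_map (Function.Embedding.subtype fun u => σ u = i)]
      congr 1
      ext u
      simp [and_comm]
    have hcount : ∀ u, ∑ v, (if σ u = σ v then (1 : ℝ) else 0) *
        (if τ u = τ v then (1 : ℝ) else 0) =
        ∑ i, ∑ j, if σ u = i ∧ τ u = j then
          ((univ.filter fun v => σ v = i ∧ τ v = j).card : ℝ) else 0 := by
      intro u
      rw [sum_eq_single (σ u), sum_eq_single (τ u)]
      · rw [if_pos ⟨rfl, rfl⟩, card_filter]
        push_cast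
        refine sum_congr rfl fun v _ => ?_
        by_cases h1 : σ u = σ v <;> by_cases h2 : τ u = τ v <;>
          simp [h1, h2, Ne.symm]
      · intro j _ hj; rw [if_neg (fun h => hj h.2.symm)]
      · simp
      · intro i _ hi; exact sum_eq_zero fun j _ => by rw [if_neg (fun h => hi h.1.symm)]
      · simp
    simp_rw [hcount, hN]
    rw [sum_comm]
    refine sum_congr rfl fun i _ => ?_
    rw [sum_comm]
    refine sum_congr rfl fun j _ => ?_
    rw [← sum_filter, sum_const, nsmul_eq_mul, sq]
  rw [hexp, hjoint, sum_sum_color_eq, sum_sum_color_eq] at h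
  have hcs := sq_sum_le_card_mul_sum_sq (s := univ)
    (f := fun c => ((univ.filter fun u => τ u = c).card : ℝ))
  rw [sum_card_color, card_univ, Fintype.card_fin] at hcs
  simp_rw [hclass] at h
  rw [sum_sub_distrib, ← sum_div]
  set S1 := ∑ i, (Fintype.card {u // σ u = i} : ℝ) ^ 2
  set S2 := ∑ i, ∑ j, ((univ.filter fun x : {u // σ u = i} => τ x.1 = j).card : ℝ) ^ 2
  have hle : 2 * ∑ e, xi σ e * xi τ e ≤ 1 / ((K : ℝ) - 1) ^ 2 * (K ^ 2 * S2 - K * S1) := by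
    have h1 : 1 / ((K : ℝ) - 1) ^ 2 * ((n : ℝ) ^ 2 - K * S1 -
        K * ∑ i, (Fintype.card {u // τ u = i} : ℝ) ^ 2 + K ^ 2 * S2) ≤
        1 / ((K : ℝ) - 1) ^ 2 * (K ^ 2 * S2 - K * S1) := by
      refine mul_le_mul_of_nonneg_left ?_ (by positivity)
      have hclass' : ∀ i, (univ.filter fun u => τ u = i).card = Fintype.card {u // τ u = i} :=
        fun i => (Fintype.card_subtype _).symm
      simp_rw [hclass'] at hcs
      linarith
    have hclass' : ∀ i, (univ.filter fun u => τ u = i).card = Fintype.card {u // τ u = i} :=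
      fun i => (Fintype.card_subtype _).symm
    simp_rw [hclass'] at h
    simp only [if_true] at h hdiag
    linarith
  calc _ ≤ 1 / ((K : ℝ) - 1) ^ 2 * (K ^ 2 * S2 - K * S1) / 2 := by linarith
    _ = _ := by field_simp

/-- Conditionally on a balanced colouring, the second-moment exponential is bounded. -/
theorem second_moment_bounded {K : ℕ} (hK : 3 ≤ K) {D : ℝ} (hD0 : 0 ≤ D)
    (hD : D < 2 * ((K : ℝ) - 1) * Real.log ((K : ℝ) - 1)) :
    ∃ C : ℝ, 0 < C ∧ ∀ (n : ℕ) (σ : Fin n → Fin K), Balanced σ →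
      ∑ τ : Fin n → Fin K, Real.exp (D / n * ∑ e, xi σ e * xi τ e) ≤ C * (K : ℝ) ^ n := by
  have hK3 : (3 : ℝ) ≤ K := by exact_mod_cast hK
  have hlog : 0 < Real.log ((K : ℝ) - 1) := Real.log_pos (by linarith)
  have hK1 : 0 < (K : ℝ) - 1 := by linarith
  have hK2 : 0 < (K : ℝ) - 2 := by linarith
  have hK0 : 0 < (K : ℝ) := by linarith
  have hpc : pottsC K = ((K : ℝ) - 1) * Real.log ((K : ℝ) - 1) / ((K : ℝ) - 2) := by
    rw [pottsC, if_neg (by omega)]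
  have hpc0 : 0 < pottsC K := by rw [hpc]; positivity
  set θ : ℝ := D / (2 * ((K : ℝ) - 1) * Real.log ((K : ℝ) - 1)) with hθ
  have hθ0 : 0 ≤ θ := by positivity
  have hθ1 : θ < 1 := by rw [hθ, div_lt_one (by positivity)]; exact hD
  obtain ⟨C, hC, hmult⟩ := multinomial_entropy_moment hθ0 hθ1 K (by omega)
  refine ⟨C ^ K, by positivity, fun n σ hσ => ?_⟩
  rcases Nat.eq_zero_or_pos n with rfl | hn
  · have h1 : (1 : ℝ) ≤ C := by
      have := hmult (Fin 0)
      simpa [selfPow] using this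
    simpa using one_le_pow₀ h1
  have hn0 : (0 : ℝ) < n := by exact_mod_cast hn
  set κ : ℝ := D / n * (K : ℝ) ^ 2 / (2 * ((K : ℝ) - 1) ^ 2) with hκ
  have hκ0 : 0 ≤ κ := by positivity
  have hfib : ∀ i : Fin K, κ * Fintype.card {u // σ u = i} ≤ θ * pottsC K := by
    intro i
    have h := hσ i
    rw [← Fintype.card_subtype] at h
    refine (mul_le_mul_of_nonneg_left h hκ0).trans (le_of_eq ?_)
    rw [hκ, hθ, hpc]
    field_simp
    ring
  have hpt : ∀ τ : Fin n → Fin K, Real.exp (D / n * ∑ e, xi σ e * xi τ e) ≤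
      ∏ i, (selfPow (fun x : {u // σ u = i} => τ x.1) * (K : ℝ) ^ Fintype.card {u // σ u = i} /
        (Fintype.card {u // σ u = i} : ℝ) ^ Fintype.card {u // σ u = i}) ^ θ := by
    intro τ
    have h := mul_le_mul_of_nonneg_left (sum_xi_mul_xi_le (by omega : 2 ≤ K) σ τ)
      (by positivity : 0 ≤ D / n)
    refine (Real.exp_le_exp.2 h).trans ?_
    rw [← mul_assoc, ← mul_div_assoc, ← hκ, mul_sum, Real.exp_sum]
    exact prod_le_prod (fun _ _ => (Real.exp_pos _).le) fun i _ =>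
      exp_le_selfPow_rpow (by omega) hpc0 hκ0 (hfib i) _
  refine (sum_le_sum fun τ _ => hpt τ).trans ?_
  rw [sum_prod_fiber σ (fun i τ => (selfPow τ * (K : ℝ) ^ Fintype.card {u // σ u = i} /
        (Fintype.card {u // σ u = i} : ℝ) ^ Fintype.card {u // σ u = i}) ^ θ)]
  have hi : ∀ i : Fin K, ∑ τ : {u // σ u = i} → Fin K,
      (selfPow τ * (K : ℝ) ^ Fintype.card {u // σ u = i} /
        (Fintype.card {u // σ u = i} : ℝ) ^ Fintype.card {u // σ u = i}) ^ θ ≤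
      C * (K : ℝ) ^ Fintype.card {u // σ u = i} := by
    intro i
    set N := Fintype.card {u // σ u = i} with hN
    have hKN : (0 : ℝ) < (K : ℝ) ^ N := by positivity
    have hNN := natCast_pow_self_pos N
    have e : ∀ τ : {u // σ u = i} → Fin K, (selfPow τ * (K : ℝ) ^ N / (N : ℝ) ^ N) ^ θ =
        selfPow τ ^ θ * (((K : ℝ) ^ N) ^ θ / ((N : ℝ) ^ N) ^ θ) := by
      intro τ
      rw [Real.div_rpow (mul_pos (selfPow_pos τ) hKN).le hNN.le,
        Real.mul_rpow (selfPow_nonneg τ) hKN.le, mul_div_assoc]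
    simp_rw [e]
    rw [← sum_mul]
    have hNt : 0 < ((N : ℝ) ^ N) ^ θ := Real.rpow_pos_of_pos hNN _
    refine (mul_le_mul_of_nonneg_right (hmult {u // σ u = i}) (by positivity)).trans (le_of_eq ?_)
    rw [← hN, Real.rpow_sub hKN, Real.rpow_one]
    have hKt : 0 < ((K : ℝ) ^ N) ^ θ := Real.rpow_pos_of_pos hKN _
    field_simp
  refine (prod_le_prod (fun i _ => sum_nonneg fun τ _ => ?_) fun i _ => hi i).trans (le_of_eq ?_)
  · refine Real.rpow_nonneg ?_ _
    have := selfPow_nonneg τ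
    positivity
  · rw [prod_mul_distrib, prod_const, card_univ, Fintype.card_fin, prod_pow_eq_pow_sum]
    congr 2
    have := card_eq_sum_card_fiberwise (s := univ) (t := univ) (f := σ) (fun _ _ => mem_univ _)
    rw [card_univ, Fintype.card_fin] at this
    exact (sum_congr rfl fun i _ => Fintype.card_subtype _).trans this.symm

/-- The average over all `K`-colourings of `Fin n`. -/
noncomputable def avg {n K : ℕ} (F : (Fin n → Fin K) → ℝ) : ℝ := (∑ σ, F σ) / (K : ℝ) ^ n

section avg

variable {n K : ℕ}

lemma avg_mono {F G : (Fin n → Fin K) → ℝ} (h : ∀ σ, F σ ≤ G σ) : avg F ≤ avg G :=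
  div_le_div_of_nonneg_right (sum_le_sum fun σ _ => h σ) (by positivity)

lemma avg_nonneg {F : (Fin n → Fin K) → ℝ} (h : ∀ σ, 0 ≤ F σ) : 0 ≤ avg F :=
  div_nonneg (sum_nonneg fun σ _ => h σ) (by positivity)

lemma avg_sub (F G : (Fin n → Fin K) → ℝ) : avg (fun σ => F σ - G σ) = avg F - avg G := by
  rw [avg, sum_sub_distrib, sub_div]; rfl

lemma avg_const_mul (a : ℝ) (F : (Fin n → Fin K) → ℝ) : avg (fun σ => a * F σ) = a * avg F := by
  rw [avg, ← mul_sum, mul_div_assoc]; rfl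

lemma avg_mul_const (a : ℝ) (F : (Fin n → Fin K) → ℝ) : avg (fun σ => F σ * a) = avg F * a := by
  simp_rw [mul_comm _ a]; exact avg_const_mul a F

lemma avg_const (hK : 0 < K) (a : ℝ) : avg (fun _ : Fin n → Fin K => a) = a := by
  have : (0 : ℝ) < K := by exact_mod_cast hK
  rw [avg, sum_const, card_univ, Fintype.card_fun, Fintype.card_fin, Fintype.card_fin,
    nsmul_eq_mul, Nat.cast_pow]
  field_simp

lemma avg_sum {ι : Type*} (s : Finset ι) (F : ι → (Fin n → Fin K) → ℝ) :
    avg (fun σ => ∑ i ∈ s, F i σ) = ∑ i ∈ s, avg (F i) := by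
  simp only [avg]
  rw [sum_comm, sum_div]

lemma abs_avg_le (F : (Fin n → Fin K) → ℝ) : |avg F| ≤ avg (fun σ => |F σ|) := by
  rw [avg, avg, abs_div, abs_of_nonneg (by positivity : (0 : ℝ) ≤ (K : ℝ) ^ n)]
  exact div_le_div_of_nonneg_right (abs_sum_le_sum_abs _ _) (by positivity)

lemma avg_mul_of_dependsOn (hK : 0 < K) {F G : (Fin n → Fin K) → ℝ} {U W : Finset (Fin n)}
    (hF : DependsOn F (U : Set (Fin n))) (hG : DependsOn G (W : Set (Fin n)))
    (hUW : Disjoint U W) :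
    avg (fun σ => F σ * G σ) = avg F * avg G := by
  have hK' : (0 : ℝ) < K := by exact_mod_cast hK
  set mix : (Fin n → Fin K) → (Fin n → Fin K) → Fin n → Fin K :=
    fun σ τ u => if u ∈ U then σ u else τ u with hmix
  have hbij : ∑ x : (Fin n → Fin K) × (Fin n → Fin K), F (mix x.1 x.2) * G (mix x.1 x.2) =
      ∑ x : (Fin n → Fin K) × (Fin n → Fin K), F x.1 * G x.1 := by
    refine sum_bij (fun x _ => (mix x.1 x.2, mix x.2 x.1)) (fun _ _ => mem_univ _) ?_ ?_ ?_
    · rintro ⟨a, b⟩ _ ⟨a', b'⟩ _ h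
      have h1 := congrFun (Prod.ext_iff.1 h).1
      have h2 := congrFun (Prod.ext_iff.1 h).2
      simp only [hmix] at h1 h2
      refine Prod.ext (funext fun u => ?_) (funext fun u => ?_)
      · have := h1 u; have := h2 u
        by_cases hu : u ∈ U <;> simp_all
      · have := h1 u; have := h2 u
        by_cases hu : u ∈ U <;> simp_all
    · rintro ⟨a, b⟩ _
      refine ⟨(mix a b, mix b a), mem_univ _, ?_⟩
      refine Prod.ext (funext fun u => ?_) (funext fun u => ?_) <;>
        by_cases hu : u ∈ U <;> simp [hmix, hu]
    · intros; rfl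
  have hl : ∀ x : (Fin n → Fin K) × (Fin n → Fin K),
      F (mix x.1 x.2) * G (mix x.1 x.2) = F x.1 * G x.2 := by
    intro x
    congr 1
    · refine hF fun u hu => ?_
      simp [hmix, mem_coe.1 hu]
    · refine hG fun u hu => ?_
      have : u ∉ U := fun h => (disjoint_left.1 hUW h) (mem_coe.1 hu)
      simp [hmix, this]
  simp_rw [hl] at hbij
  rw [Fintype.sum_prod_type, Fintype.sum_prod_type] at hbij
  simp only [sum_const, card_univ, Fintype.card_fun, Fintype.card_fin, nsmul_eq_mul,
    Nat.cast_pow, ← mul_sum, ← sum_mul] at hbij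
  simp only [avg]
  field_simp
  linarith

lemma avg_update (hK : 0 < K) (v : Fin n) (F : (Fin n → Fin K) → ℝ) :
    avg F = avg (fun σ => (∑ c, F (Function.update σ v c)) / K) := by
  have hK' : (0 : ℝ) < K := by exact_mod_cast hK
  have h : ∑ x : (Fin n → Fin K) × Fin K, F (Function.update x.1 v x.2) =
      ∑ x : (Fin n → Fin K) × Fin K, F x.1 := by
    refine sum_bij (fun x _ => (Function.update x.1 v x.2, x.1 v)) (fun _ _ => mem_univ _) ?_ ?_ ?_
    · rintro ⟨a, b⟩ _ ⟨a', b'⟩ _ h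
      have h1 := congrFun (Prod.ext_iff.1 h).1
      have h2 := (Prod.ext_iff.1 h).2
      simp only at h1 h2
      refine Prod.ext (funext fun u => ?_) ?_
      · have := h1 u
        by_cases hu : u = v
        · subst hu; exact h2
        · simpa [Function.update_of_ne hu] using this
      · simpa using h1 v
    · rintro ⟨a, b⟩ _
      exact ⟨(Function.update a v b, a v), mem_univ _, by simp⟩
    · intros; rfl
  rw [Fintype.sum_prod_type, Fintype.sum_prod_type] at h
  simp only [sum_const, card_univ, Fintype.card_fin, nsmul_eq_mul, ← mul_sum] at h
  simp only [avg]
  rw [← sum_div, h]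
  field_simp

end avg

/-- The kernel defining `xi`. -/
noncomputable def xiKer {K : ℕ} (a b : Fin K) : ℝ := if a = b then -1 else 1 / ((K : ℝ) - 1)

lemma xiKer_comm {K : ℕ} (a b : Fin K) : xiKer a b = xiKer b a := by
  simp only [xiKer, eq_comm]

lemma abs_xiKer_le {K : ℕ} (hK : 2 ≤ K) (a b : Fin K) : |xiKer a b| ≤ 1 := by
  have h2 : (2 : ℝ) ≤ K := by exact_mod_cast hK
  unfold xiKer
  split_ifs
  · simp
  · rw [abs_of_nonneg (by have : 0 ≤ (K : ℝ) - 1 := by linarith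
                          positivity), div_le_one (by linarith)]
    linarith

lemma xiKer_eq {K : ℕ} (hK : 2 ≤ K) (a b : Fin K) :
    xiKer a b = (1 - K * (if a = b then 1 else 0)) / ((K : ℝ) - 1) := by
  have : (2 : ℝ) ≤ K := by exact_mod_cast hK
  have h : (K : ℝ) - 1 ≠ 0 := by linarith
  unfold xiKer
  split_ifs
  · field_simp; ring
  · simp

lemma sum_xiKer {K : ℕ} (hK : 2 ≤ K) (b : Fin K) : ∑ c, xiKer c b = 0 := by
  simp_rw [xiKer_eq hK]
  rw [← sum_div, sum_sub_distrib, ← mul_sum]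
  simp

lemma sum_xiKer_mul_xiKer {K : ℕ} (hK : 2 ≤ K) (a b : Fin K) :
    ∑ c, xiKer c a * xiKer c b = -(K / ((K : ℝ) - 1)) * xiKer a b := by
  have h2 : (2 : ℝ) ≤ K := by exact_mod_cast hK
  have h : (K : ℝ) - 1 ≠ 0 := by linarith
  simp_rw [xiKer_eq hK]
  have e : ∀ c : Fin K, (1 - K * (if c = a then (1 : ℝ) else 0)) / ((K : ℝ) - 1) *
      ((1 - K * (if c = b then 1 else 0)) / ((K : ℝ) - 1)) =
      (1 - K * (if c = a then 1 else 0) - K * (if c = b then 1 else 0) +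
        K ^ 2 * (if c = a then (if a = b then 1 else 0) else 0)) / ((K : ℝ) - 1) ^ 2 := by
    intro c
    by_cases h1 : c = a
    · subst h1; by_cases h2 : c = b <;> simp [h2] <;> field_simp <;> ring
    · by_cases h2 : c = b
      · have h4 : ¬ b = a := fun h => h1 (h2.trans h)
        simp [h2, h4]; field_simp
      · simp [h1, h2]; field_simp
  simp_rw [e]
  rw [← sum_div, sum_add_distrib, sum_sub_distrib, sum_sub_distrib, ← mul_sum, ← mul_sum,
    ← mul_sum]
  simp only [sum_const, card_univ, Fintype.card_fin, nsmul_eq_mul, mul_one, sum_ite_eq', mem_univ,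
    if_true]
  by_cases hab : a = b
  · simp only [hab, if_true]; field_simp; ring
  · simp only [hab, if_false]; field_simp; ring

section xi

variable {n K : ℕ}

lemma abs_xi_le (hK : 2 ≤ K) (σ : Fin n → Fin K) (e : Edge n) : |xi σ e| ≤ 1 :=
  abs_xiKer_le hK _ _

lemma mem_ends {e : Edge n} {v : Fin n} : v ∈ ends e ↔ v = e.1.1 ∨ v = e.1.2 := by
  simp [ends]

lemma exists_xi_eq {e : Edge n} {v : Fin n} (h : v ∈ ends e) :
    ∃ w ≠ v, ∀ σ : Fin n → Fin K, xi σ e = xiKer (σ v) (σ w) := by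
  rcases mem_ends.1 h with rfl | rfl
  · exact ⟨e.1.2, e.2.ne', fun σ => rfl⟩
  · exact ⟨e.1.1, e.2.ne, fun σ => xiKer_comm _ _⟩

lemma xi_update_of_notMem {e : Edge n} {v : Fin n} (h : v ∉ ends e) (σ : Fin n → Fin K)
    (c : Fin K) : xi (Function.update σ v c) e = xi σ e := by
  rw [mem_ends] at h
  push Not at h
  simp [xi, Function.update_of_ne h.1.symm, Function.update_of_ne h.2.symm]

/-- The vertices covered by a set of edges. -/
def supp (S : Finset (Edge n)) : Finset (Fin n) := S.biUnion ends

/-- The degree of a vertex in a set of edges. -/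
def deg (S : Finset (Edge n)) (v : Fin n) : ℕ := (S.filter fun e => v ∈ ends e).card

lemma dependsOn_xi {e : Edge n} {U : Finset (Fin n)} (h : ends e ⊆ U) :
    DependsOn (fun σ : Fin n → Fin K => xi σ e) (U : Set (Fin n)) := by
  intro σ τ hστ
  have h1 : σ e.1.1 = τ e.1.1 := hστ _ (mem_coe.2 (h (mem_ends.2 (Or.inl rfl))))
  have h2 : σ e.1.2 = τ e.1.2 := hστ _ (mem_coe.2 (h (mem_ends.2 (Or.inr rfl))))
  simp [xi, h1, h2]

lemma ends_subset_supp {S : Finset (Edge n)} {e : Edge n} (h : e ∈ S) : ends e ⊆ supp S :=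
  subset_biUnion_of_mem ends h

lemma dependsOn_prod {S : Finset (Edge n)} {U : Finset (Fin n)} (h : supp S ⊆ U)
    (f : ℝ → ℝ) :
    DependsOn (fun σ : Fin n → Fin K => ∏ e ∈ S, f (xi σ e)) (U : Set (Fin n)) := by
  intro σ τ hστ
  refine prod_congr rfl fun e he => ?_
  exact congrArg f (dependsOn_xi ((ends_subset_supp he).trans h) hστ)

lemma abs_prod_xi_le (hK : 2 ≤ K) (σ : Fin n → Fin K) (S : Finset (Edge n)) :
    |∏ e ∈ S, xi σ e| ≤ 1 := by
  rw [abs_prod]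
  exact prod_le_one (fun _ _ => abs_nonneg _) fun e _ => abs_xi_le hK σ e

/-- The mean of `∏ e ∈ S, xi σ e` over all colourings. -/
noncomputable def meanXi (K : ℕ) (S : Finset (Edge n)) : ℝ :=
  avg fun σ : Fin n → Fin K => ∏ e ∈ S, xi σ e

lemma meanXi_eq_zero (hK : 2 ≤ K) {S : Finset (Edge n)} {v : Fin n} (hv : deg S v = 1) :
    meanXi K S = 0 := by
  obtain ⟨e, he⟩ := card_eq_one.1 hv
  have heS : e ∈ S ∧ v ∈ ends e := by
    have : e ∈ S.filter fun e => v ∈ ends e := by rw [he]; exact mem_singleton_self e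
    exact mem_filter.1 this
  obtain ⟨w, hwv, hw⟩ := exists_xi_eq (K := K) heS.2
  rw [meanXi, avg_update (by omega) v, ← avg_const (n := n) (K := K) (by omega) 0]
  congr 1
  funext σ
  have : ∀ c, ∏ f ∈ S, xi (Function.update σ v c) f =
      xiKer c (σ w) * ∏ f ∈ S.erase e, xi σ f := by
    intro c
    rw [← mul_prod_erase S _ heS.1, hw, Function.update_self, Function.update_of_ne hwv]
    congr 1
    refine prod_congr rfl fun f hf => xi_update_of_notMem (fun hvf => ?_) σ c
    have : f ∈ S.filter fun e => v ∈ ends e := mem_filter.2 ⟨mem_of_mem_erase hf, hvf⟩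
    rw [he] at this
    exact (ne_of_mem_erase hf) (mem_singleton.1 this)
  simp_rw [this]
  rw [← sum_mul, sum_xiKer hK]
  simp

lemma abs_meanXi_le (hK : 2 ≤ K) {S : Finset (Edge n)} {v : Fin n} (hv : deg S v = 2) :
    |meanXi K S| ≤ 1 / ((K : ℝ) - 1) := by
  have h2 : (2 : ℝ) ≤ K := by exact_mod_cast hK
  obtain ⟨e, f, hef, he⟩ := card_eq_two.1 hv
  have heS : e ∈ S ∧ v ∈ ends e := by
    have : e ∈ S.filter fun e => v ∈ ends e := by rw [he]; simp
    exact mem_filter.1 this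
  have hfS : f ∈ S ∧ v ∈ ends f := by
    have : f ∈ S.filter fun e => v ∈ ends e := by rw [he]; simp
    exact mem_filter.1 this
  obtain ⟨w, hwv, hw⟩ := exists_xi_eq (K := K) heS.2
  obtain ⟨x, hxv, hx⟩ := exists_xi_eq (K := K) hfS.2
  have hfe : f ∈ S.erase e := mem_erase.2 ⟨hef.symm, hfS.1⟩
  have : ∀ σ : Fin n → Fin K, ∀ c, ∏ g ∈ S, xi (Function.update σ v c) g =
      xiKer c (σ w) * xiKer c (σ x) * ∏ g ∈ (S.erase e).erase f, xi σ g := by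
    intro σ c
    rw [← mul_prod_erase S _ heS.1, ← mul_prod_erase _ _ hfe, hw, hx, Function.update_self,
      Function.update_of_ne hwv, Function.update_of_ne hxv, mul_assoc]
    congr 2
    refine prod_congr rfl fun g hg => xi_update_of_notMem (fun hvg => ?_) σ c
    have hg1 := mem_of_mem_erase hg
    have : g ∈ S.filter fun e => v ∈ ends e := mem_filter.2 ⟨mem_of_mem_erase hg1, hvg⟩
    rw [he, mem_insert, mem_singleton] at this
    rcases this with h | h
    · exact ne_of_mem_erase hg1 h
    · exact ne_of_mem_erase hg h
  rw [meanXi, avg_update (by omega) v]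
  refine (abs_avg_le _).trans ?_
  rw [← avg_const (n := n) (K := K) (by omega) (1 / ((K : ℝ) - 1))]
  refine avg_mono fun σ => ?_
  simp_rw [this]
  rw [← sum_mul, sum_xiKer_mul_xiKer hK]
  have h1 := abs_xiKer_le hK (σ w) (σ x)
  have h3 := abs_prod_xi_le hK σ ((S.erase e).erase f)
  have hK1 : 0 < (K : ℝ) - 1 := by linarith
  have e1 : -(K / ((K : ℝ) - 1)) * xiKer (σ w) (σ x) * (∏ g ∈ (S.erase e).erase f, xi σ g) / K =
      -(1 / ((K : ℝ) - 1)) * (xiKer (σ w) (σ x) * ∏ g ∈ (S.erase e).erase f, xi σ g) := by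
    field_simp
  rw [e1, abs_mul, abs_neg, abs_of_pos (by positivity : 0 < 1 / ((K : ℝ) - 1)), abs_mul]
  have : |xiKer (σ w) (σ x)| * |∏ g ∈ (S.erase e).erase f, xi σ g| ≤ 1 :=
    mul_le_one₀ h1 (abs_nonneg _) h3
  have h0 : 0 < 1 / ((K : ℝ) - 1) := by positivity
  nlinarith

/-- The proportion of unbalanced colourings. -/
noncomputable def unbal (n K : ℕ) : ℝ :=
  avg fun σ : Fin n → Fin K => if Balanced σ then 0 else 1

/-- The mean of `∏ e ∈ S, xi σ e` over balanced colourings (with total mass not normalised). -/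
noncomputable def balMeanXi (K : ℕ) (S : Finset (Edge n)) : ℝ :=
  avg fun σ : Fin n → Fin K => (if Balanced σ then 1 else 0) * ∏ e ∈ S, xi σ e

lemma abs_balMeanXi_sub_le (hK : 2 ≤ K) (S : Finset (Edge n)) :
    |balMeanXi K S - meanXi K S| ≤ unbal n K := by
  rw [balMeanXi, meanXi, ← avg_sub]
  refine (abs_avg_le _).trans (avg_mono fun σ => ?_)
  have := abs_prod_xi_le hK σ S
  split_ifs
  · simp
  · simpa using this

lemma abs_meanXi_le_one (hK : 2 ≤ K) (S : Finset (Edge n)) : |meanXi K S| ≤ 1 := by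
  refine (abs_avg_le _).trans ?_
  exact le_of_le_of_eq (avg_mono (G := fun _ => 1) fun σ => abs_prod_xi_le hK σ S)
    (avg_const (by omega) 1)

lemma abs_balMeanXi_le_one (hK : 2 ≤ K) (S : Finset (Edge n)) : |balMeanXi K S| ≤ 1 := by
  refine (abs_avg_le _).trans ?_
  refine le_of_le_of_eq (avg_mono (G := fun _ => 1) fun σ => ?_) (avg_const (by omega) 1)
  have := abs_prod_xi_le hK σ S
  split_ifs
  · simpa using this
  · simp

lemma unbal_nonneg : 0 ≤ unbal n K := avg_nonneg fun σ => by split_ifs <;> norm_num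

lemma avg_exp_class (t : ℝ) (hK : 0 < K) (c : Fin K) :
    avg (fun σ : Fin n → Fin K => Real.exp (t * (univ.filter fun u => σ u = c).card)) ≤
      Real.exp (n * ((Real.exp t - 1) / K)) := by
  have hK' : (1 : ℝ) ≤ K := by exact_mod_cast hK
  have h : ∀ σ : Fin n → Fin K, Real.exp (t * (univ.filter fun u => σ u = c).card) =
      ∏ u, if σ u = c then Real.exp t else 1 := by
    intro σ
    rw [prod_ite, prod_const_one, mul_one, prod_const, mul_comm, Real.exp_nat_mul]
  simp_rw [h]
  rw [avg, ← Fintype.sum_pow (fun a : Fin K => if a = c then Real.exp t else 1), ← div_pow,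
    Real.exp_nat_mul]
  have h1 : (∑ a : Fin K, if a = c then Real.exp t else 1) = K - 1 + Real.exp t := by
    rw [← add_sum_erase _ _ (mem_univ c), if_pos rfl, sum_congr rfl (g := fun _ => (1 : ℝ))]
    · rw [sum_const, card_erase_of_mem (mem_univ _), card_univ, Fintype.card_fin, nsmul_eq_mul,
        Nat.cast_sub hK]
      push_cast; ring
    · intro a ha; rw [if_neg (ne_of_mem_erase ha)]
  rw [h1]
  refine pow_le_pow_left₀ (div_nonneg (by linarith [Real.exp_pos t]) (by linarith)) ?_ _
  have := Real.add_one_le_exp ((Real.exp t - 1) / K)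
  refine le_trans (le_of_eq ?_) this
  field_simp
  ring

lemma unbal_le (hK : 3 ≤ K) :
    unbal n K ≤ K * Real.exp (-((1 / ((K : ℝ) * ((K : ℝ) - 2))) ^ 2 / (4 * K)) * n) := by
  have hK3 : (3 : ℝ) ≤ K := by exact_mod_cast hK
  set δ : ℝ := 1 / ((K : ℝ) * ((K : ℝ) - 2)) with hδ
  have hK2 : 0 < (K : ℝ) - 2 := by linarith
  have hδ0 : 0 < δ := by positivity
  have hδ1 : δ ≤ 1 := by
    rw [hδ, div_le_one (by positivity)]; nlinarith
  set m : ℝ := (1 + δ) * n / K with hm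
  have h1 : unbal n K ≤ avg (fun σ : Fin n → Fin K =>
      ∑ c, Real.exp (-(δ / 2 * m)) * Real.exp (δ / 2 * (univ.filter fun u => σ u = c).card)) := by
    refine avg_mono fun σ => ?_
    simp_rw [← Real.exp_add]
    split_ifs with h
    · exact sum_nonneg fun c _ => (Real.exp_pos _).le
    · simp only [Balanced, not_forall, not_le] at h
      obtain ⟨c, hc⟩ := h
      refine le_trans ?_ (single_le_sum (fun c _ => (Real.exp_pos _).le) (mem_univ c))
      refine Real.one_le_exp ?_
      nlinarith
  refine h1.trans ?_
  rw [avg_sum]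
  simp_rw [avg_const_mul]
  calc _ ≤ ∑ _c : Fin K, Real.exp (-(δ ^ 2 / (4 * K)) * n) := by
        refine sum_le_sum fun c _ => ?_
        refine (mul_le_mul_of_nonneg_left (avg_exp_class (δ / 2) (by omega) c)
          (Real.exp_pos _).le).trans ?_
        rw [← Real.exp_add, Real.exp_le_exp]
        have he := exp_sub_one_le (t := δ / 2) (by rw [abs_of_pos (by positivity)]; linarith)
        have hnK : 0 ≤ (n : ℝ) / K := by positivity
        have := mul_le_mul_of_nonneg_left he hnK
        have e1 : (n : ℝ) * ((Real.exp (δ / 2) - 1) / K) = n / K * (Real.exp (δ / 2) - 1) := by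
          ring
        have e2 : -(δ ^ 2 / (4 * K)) * n = -(δ / 2 * m) + n / K * (δ / 2 + (δ / 2) ^ 2) := by
          rw [hm]; field_simp; ring
        rw [e1, e2]
        linarith
    _ = _ := by rw [sum_const, card_univ, Fintype.card_fin, nsmul_eq_mul]

end xi

section graph

variable {n : ℕ}

lemma mem_supp {S : Finset (Edge n)} {v : Fin n} : v ∈ supp S ↔ ∃ e ∈ S, v ∈ ends e := by
  simp [supp]

lemma deg_ne_zero_iff {S : Finset (Edge n)} {v : Fin n} : deg S v ≠ 0 ↔ v ∈ supp S := by
  rw [deg, Finset.card_ne_zero, mem_supp, Finset.filter_nonempty_iff]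

lemma card_ends (e : Edge n) : (ends e).card = 2 := card_pair e.2.ne

lemma supp_nonempty {S : Finset (Edge n)} (h : S.Nonempty) : (supp S).Nonempty := by
  obtain ⟨e, he⟩ := h
  exact ⟨e.1.1, mem_supp.2 ⟨e, he, mem_ends.2 (Or.inl rfl)⟩⟩

lemma supp_mono {S T : Finset (Edge n)} (h : S ⊆ T) : supp S ⊆ supp T :=
  biUnion_subset_biUnion_of_subset_left _ h

lemma sum_deg (S : Finset (Edge n)) (W : Finset (Fin n)) :
    ∑ v ∈ W, deg S v = ∑ e ∈ S, (W ∩ ends e).card := by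
  simp only [deg, card_filter]
  rw [sum_comm]
  refine sum_congr rfl fun e _ => ?_
  rw [← card_filter, filter_mem_eq_inter]

lemma card_inter_ends_le (W : Finset (Fin n)) (e : Edge n) : (W ∩ ends e).card ≤ 2 :=
  (card_le_card inter_subset_right).trans (card_ends e).le

lemma card_le_of_two_le_deg {S : Finset (Edge n)} {W : Finset (Fin n)}
    (h : ∀ v ∈ W, 2 ≤ deg S v) : W.card ≤ S.card := by
  have h1 : ∑ v ∈ W, 2 ≤ ∑ v ∈ W, deg S v := sum_le_sum h
  have h2 : ∑ e ∈ S, (W ∩ ends e).card ≤ ∑ e ∈ S, 2 :=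
    sum_le_sum fun e _ => card_inter_ends_le W e
  rw [sum_deg] at h1
  simp only [sum_const, smul_eq_mul] at h1 h2
  omega

lemma card_lt_of_two_le_deg {S : Finset (Edge n)} {W : Finset (Fin n)}
    (h : ∀ v ∈ W, 2 ≤ deg S v) {e : Edge n} (he : e ∈ S) (heW : ¬ ends e ⊆ W) :
    W.card < S.card := by
  have h1 : ∑ v ∈ W, 2 ≤ ∑ v ∈ W, deg S v := sum_le_sum h
  have h2 : ∑ e ∈ S, (W ∩ ends e).card < ∑ e ∈ S, 2 := by
    refine sum_lt_sum (fun e _ => card_inter_ends_le W e) ⟨e, he, ?_⟩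
    rw [← card_ends e]
    refine card_lt_card ⟨inter_subset_right, fun hh => heW (hh.trans inter_subset_left)⟩
  rw [sum_deg] at h1
  simp only [sum_const, smul_eq_mul] at h1 h2
  omega

/-- No vertex is incident to exactly one of the edges. -/
def Leafless (S : Finset (Edge n)) : Prop := ∀ v, deg S v ≠ 1

lemma Leafless.two_le_deg {S : Finset (Edge n)} (h : Leafless S) {v : Fin n} (hv : v ∈ supp S) :
    2 ≤ deg S v := by
  have := deg_ne_zero_iff.2 hv
  have := h v
  omega

lemma Leafless.card_supp_le {S : Finset (Edge n)} (h : Leafless S) : (supp S).card ≤ S.card :=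
  card_le_of_two_le_deg fun _ => h.two_le_deg

lemma deg_eq_of_closed {S T : Finset (Edge n)} (hTS : T ⊆ S) {v : Fin n}
    (h : ∀ e ∈ S, v ∈ ends e → e ∈ T) : deg T v = deg S v := by
  unfold deg
  congr 1
  ext e
  simp only [mem_filter]
  exact ⟨fun he => ⟨hTS he.1, he.2⟩, fun he => ⟨h e he.1 he.2, he.2⟩⟩

lemma Leafless.of_closed {S T : Finset (Edge n)} (hS : Leafless S) (hTS : T ⊆ S)
    (h : ∀ v ∈ supp T, ∀ e ∈ S, v ∈ ends e → e ∈ T) : Leafless T := by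
  intro v
  by_cases hv : v ∈ supp T
  · rw [deg_eq_of_closed hTS (h v hv)]
    exact hS v
  · have : deg T v = 0 := by
      by_contra h0
      exact hv (deg_ne_zero_iff.1 h0)
    omega

/-- The edge set of a cycle, characterised as a minimal nonempty leafless set of edges with as
many edges as vertices. -/
def IsCyc (C : Finset (Edge n)) : Prop :=
  C.Nonempty ∧ Leafless C ∧ (supp C).card = C.card ∧
    ∀ T ⊆ C, T.Nonempty → Leafless T → T = C

/-- Edge sets of cycles of length at most `L`. -/
noncomputable def cyc (n L : ℕ) : Finset (Finset (Edge n)) :=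
  univ.filter fun C => IsCyc C ∧ C.card ≤ L

lemma mem_cyc {L : ℕ} {C : Finset (Edge n)} : C ∈ cyc n L ↔ IsCyc C ∧ C.card ≤ L := by
  simp [cyc]

/-- The vertex sets of the members of the family are pairwise disjoint. -/
def VDisj (M : Finset (Finset (Edge n))) : Prop :=
  ∀ C ∈ M, ∀ C' ∈ M, C ≠ C' → Disjoint (supp C) (supp C')

lemma eq_of_mem_supp {M : Finset (Finset (Edge n))} (hd : VDisj M) {C C' : Finset (Edge n)}
    (hC : C ∈ M) (hC' : C' ∈ M) {v : Fin n} (h : v ∈ supp C) (h' : v ∈ supp C') : C = C' := by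
  by_contra hne
  exact disjoint_left.1 (hd C hC C' hC' hne) h h'

lemma card_diff_biUnion_gt {M : Finset (Finset (Edge n))} (hM : ∀ C ∈ M, IsCyc C)
    (hd : VDisj M) {C' : Finset (Edge n)} (hC' : IsCyc C') (hC'M : C' ∉ M)
    (hmeet : ¬ Disjoint (supp C') (supp (M.biUnion id))) :
    (supp C' \ supp (M.biUnion id)).card + 1 ≤ (C' \ M.biUnion id).card := by
  set U := supp (M.biUnion id) with hU
  set S := C' \ M.biUnion id with hS
  have hdegS : ∀ v ∈ supp C' \ U, ∀ e ∈ C', v ∈ ends e → e ∈ S := by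
    intro v hv e he hve
    refine mem_sdiff.2 ⟨he, fun heM => (mem_sdiff.1 hv).2 ?_⟩
    exact mem_supp.2 ⟨e, heM, hve⟩
  have hdeg : ∀ v ∈ supp C' \ U, 2 ≤ deg S v := by
    intro v hv
    rw [deg_eq_of_closed sdiff_subset (hdegS v hv)]
    exact hC'.2.1.two_le_deg (mem_sdiff.1 hv).1
  by_cases hall : ∀ e ∈ S, ends e ⊆ supp C' \ U
  · exfalso
    by_cases hne : S.Nonempty
    · have hl : Leafless S := by
        refine hC'.2.1.of_closed sdiff_subset fun v hv => hdegS v ?_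
        obtain ⟨e, he, hve⟩ := mem_supp.1 hv
        exact hall e he hve
      have hSC := hC'.2.2.2 S sdiff_subset hne hl
      refine hmeet (disjoint_left.2 fun v hv hvU => ?_)
      rw [← hSC] at hv
      obtain ⟨e, he, hve⟩ := mem_supp.1 hv
      exact (mem_sdiff.1 (hall e he hve)).2 hvU
    · rw [not_nonempty_iff_eq_empty, hS, sdiff_eq_empty_iff_subset] at hne
      obtain ⟨e, he⟩ := hC'.1
      obtain ⟨C, hC, heC⟩ := mem_biUnion.1 (hne he)
      have hcl : Leafless (C' ∩ C) := by
        refine hC'.2.1.of_closed inter_subset_left fun v hv f hf hvf => ?_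
        obtain ⟨C₂, hC₂, hfC₂⟩ := mem_biUnion.1 (hne hf)
        have : C = C₂ := eq_of_mem_supp hd hC hC₂ (supp_mono inter_subset_right hv)
          (mem_supp.2 ⟨f, hfC₂, hvf⟩)
        subst this
        exact mem_inter.2 ⟨hf, hfC₂⟩
      have h1 := hC'.2.2.2 (C' ∩ C) inter_subset_left ⟨e, mem_inter.2 ⟨he, heC⟩⟩ hcl
      have h2 : C' ⊆ C := inter_eq_left.1 h1
      have h3 := (hM C hC).2.2.2 C' h2 hC'.1 hC'.2.1
      exact hC'M (h3 ▸ hC)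
  · push Not at hall
    obtain ⟨e, he, heW⟩ := hall
    exact card_lt_of_two_le_deg hdeg he heW

lemma Leafless.deg_eq_two {S : Finset (Edge n)} (h : Leafless S) (hc : (supp S).card = S.card)
    {v : Fin n} (hv : v ∈ supp S) : deg S v = 2 := by
  have h1 : ∑ v ∈ supp S, deg S v = ∑ v ∈ supp S, 2 := by
    refine le_antisymm ?_ (sum_le_sum fun v hv => h.two_le_deg hv)
    rw [sum_deg]
    refine (sum_le_sum fun e _ => card_inter_ends_le _ e).trans ?_
    simp [hc]
  exact ((sum_eq_sum_iff_of_le fun v hv => h.two_le_deg hv).1 h1.symm v hv).symm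

lemma card_supp_eq_of_deg {S : Finset (Edge n)} (h : ∀ v ∈ supp S, deg S v = 2) :
    (supp S).card = S.card := by
  have h1 := sum_deg S (supp S)
  rw [sum_congr rfl h] at h1
  have h2 : ∑ e ∈ S, (supp S ∩ ends e).card = ∑ e ∈ S, 2 :=
    sum_congr rfl fun e he => by rw [inter_eq_right.2 (ends_subset_supp he), card_ends]
  rw [h2] at h1
  simp only [sum_const, smul_eq_mul] at h1
  omega

lemma deg_mono {S T : Finset (Edge n)} (h : T ⊆ S) (v : Fin n) : deg T v ≤ deg S v :=
  card_le_card (filter_subset_filter _ h)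

/-- A leafless set with as many edges as vertices is a vertex-disjoint union of cycles. -/
lemma exists_cyc_decomposition (S : Finset (Edge n)) (h : Leafless S)
    (hc : (supp S).card = S.card) :
    ∃ M : Finset (Finset (Edge n)), (∀ C ∈ M, IsCyc C) ∧ VDisj M ∧ M.biUnion id = S := by
  induction hm : S.card using Nat.strong_induction_on generalizing S with
  | _ m ih =>
  rcases S.eq_empty_or_nonempty with rfl | hne
  · exact ⟨∅, by simp, by simp [VDisj], by simp⟩
  have hex : (S.powerset.filter fun T => T.Nonempty ∧ Leafless T).Nonempty :=
    ⟨S, mem_filter.2 ⟨mem_powerset_self S, hne, h⟩⟩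
  obtain ⟨T, hT, hTmin⟩ := exists_min_image _ card hex
  rw [mem_filter, mem_powerset] at hT
  obtain ⟨hTS, hTne, hTl⟩ := hT
  have hdS : ∀ v ∈ supp S, deg S v = 2 := fun v => h.deg_eq_two hc
  have hdT : ∀ v ∈ supp T, deg T v = 2 := fun v hv =>
    le_antisymm ((deg_mono hTS v).trans (hdS v (supp_mono hTS hv)).le) (hTl.two_le_deg hv)
  have hcl : ∀ v ∈ supp T, ∀ e ∈ S, v ∈ ends e → e ∈ T := by
    intro v hv e he hve
    have : T.filter (fun e => v ∈ ends e) = S.filter (fun e => v ∈ ends e) := by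
      refine eq_of_subset_of_card_le (filter_subset_filter _ hTS) ?_
      change deg S v ≤ deg T v
      rw [hdT v hv, hdS v (supp_mono hTS hv)]
    have he' : e ∈ S.filter (fun e => v ∈ ends e) := mem_filter.2 ⟨he, hve⟩
    rw [← this] at he'
    exact (mem_filter.1 he').1
  have hTc : IsCyc T := by
    refine ⟨hTne, hTl, card_supp_eq_of_deg hdT, fun T' hT' hne' hl' => ?_⟩
    exact eq_of_subset_of_card_le hT'
      (hTmin T' (mem_filter.2 ⟨mem_powerset.2 (hT'.trans hTS), hne', hl'⟩))
  have hdisj : Disjoint (supp (S \ T)) (supp T) := by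
    refine disjoint_left.2 fun v hv hvT => ?_
    obtain ⟨e, he, hve⟩ := mem_supp.1 hv
    exact (mem_sdiff.1 he).2 (hcl v hvT e (mem_sdiff.1 he).1 hve)
  have hcl2 : ∀ v ∈ supp (S \ T), ∀ e ∈ S, v ∈ ends e → e ∈ S \ T := by
    intro v hv e he hve
    exact mem_sdiff.2 ⟨he, fun heT => disjoint_left.1 hdisj hv (mem_supp.2 ⟨e, heT, hve⟩)⟩
  have hl2 : Leafless (S \ T) := h.of_closed sdiff_subset hcl2
  have hc2 : (supp (S \ T)).card = (S \ T).card := card_supp_eq_of_deg fun v hv => by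
    rw [deg_eq_of_closed sdiff_subset (hcl2 v hv)]
    exact hdS v (supp_mono sdiff_subset hv)
  have hlt : (S \ T).card < m := by
    rw [← hm]
    refine card_lt_card (sdiff_ssubset hTS hTne)
  obtain ⟨M, hM, hMd, hMU⟩ := ih _ hlt _ hl2 hc2 rfl
  have hsM : ∀ C ∈ M, supp C ⊆ supp (S \ T) := fun C hC =>
    supp_mono (hMU ▸ subset_biUnion_of_mem id hC)
  refine ⟨insert T M, ?_, ?_, ?_⟩
  · intro C hC
    rcases mem_insert.1 hC with rfl | hC
    · exact hTc
    · exact hM C hC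
  · intro C hC C' hC' hne
    rcases mem_insert.1 hC with h1 | h1 <;> rcases mem_insert.1 hC' with h2 | h2
    · exact absurd (h1.trans h2.symm) hne
    · rw [h1]; exact (hdisj.mono_left (hsM _ h2)).symm
    · rw [h2]; exact hdisj.mono_left (hsM _ h1)
    · exact hMd C h1 C' h2 hne
  · rw [biUnion_insert, hMU, id, union_sdiff_of_subset hTS]

lemma card_filter_supp_subset_le (X : Finset (Fin n)) :
    ((univ : Finset (Finset (Edge n))).filter fun S => supp S ⊆ X).card ≤ 2 ^ (X.card ^ 2) := by
  have h1 : ((univ : Finset (Finset (Edge n))).filter fun S => supp S ⊆ X) ⊆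
      ((univ : Finset (Edge n)).filter fun e => ends e ⊆ X).powerset := by
    intro S hS
    rw [mem_powerset]
    intro e he
    exact mem_filter.2 ⟨mem_univ _, (ends_subset_supp he).trans (mem_filter.1 hS).2⟩
  refine (card_le_card h1).trans ?_
  rw [card_powerset]
  refine Nat.pow_le_pow_right (by norm_num) ?_
  rw [sq, ← card_product]
  refine card_le_card_of_injOn (fun e => e.1) (fun e he => ?_)
    (fun e _ f _ hef => Subtype.ext hef)
  have := (mem_filter.1 (mem_coe.1 he)).2
  exact mem_coe.2 (mem_product.2 ⟨this (mem_ends.2 (Or.inl rfl)), this (mem_ends.2 (Or.inr rfl))⟩)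

lemma sum_pow_card_eq (t : ℝ) : ∑ X : Finset (Fin n), t ^ X.card = (t + 1) ^ n := by
  have := Finset.prod_add_one (s := (univ : Finset (Fin n))) (f := fun _ => t)
  simp only [prod_const, card_univ, Fintype.card_fin, powerset_univ] at this
  exact this.symm

/-- A weighted count of edge sets by the number of vertices outside a fixed set. -/
lemma sum_pow_le_of_card_supp {U : Finset (Fin n)} {u L a : ℕ} {t c : ℝ} (hu : U.card ≤ u)
    (ht0 : 0 ≤ t) (ht1 : t ≤ 1) (htc : t * n ≤ c) (F : Finset (Finset (Edge n)))
    (m : Finset (Edge n) → ℕ) (hF : ∀ S ∈ F, (supp S \ U).card ≤ L)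
    (hm : ∀ S ∈ F, (supp S \ U).card + a ≤ m S) :
    ∑ S ∈ F, t ^ m S ≤ 2 ^ ((u + L) ^ 2) * Real.exp c * t ^ a := by
  have hbound : ∀ X : Finset (Fin n), ∑ S ∈ F.filter (fun S => supp S \ U = X), t ^ m S ≤
      2 ^ ((u + L) ^ 2) * t ^ a * t ^ X.card := by
    intro X
    by_cases hX : X.card ≤ L
    · calc _ ≤ ∑ S ∈ F.filter (fun S => supp S \ U = X), t ^ a * t ^ X.card := by
            refine sum_le_sum fun S hS => ?_
            rw [mem_filter] at hS
            rw [← pow_add, ← hS.2, add_comm]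
            exact pow_le_pow_of_le_one ht0 ht1 (hm S hS.1)
        _ = ((F.filter (fun S => supp S \ U = X)).card : ℝ) * (t ^ a * t ^ X.card) := by
            rw [sum_const, nsmul_eq_mul]
        _ ≤ 2 ^ ((u + L) ^ 2) * (t ^ a * t ^ X.card) := by
            refine mul_le_mul_of_nonneg_right ?_ (by positivity)
            have h1 : (F.filter (fun S => supp S \ U = X)).card ≤
                ((univ : Finset (Finset (Edge n))).filter fun S => supp S ⊆ U ∪ X).card := by
              refine card_le_card fun S hS => ?_
              refine mem_filter.2 ⟨mem_univ _, ?_⟩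
              rw [← (mem_filter.1 hS).2]
              intro v hv
              by_cases hvU : v ∈ U <;> simp [hv, hvU]
            have h2 := h1.trans (card_filter_supp_subset_le (U ∪ X))
            have h3 : (U ∪ X).card ≤ u + L := (card_union_le _ _).trans (add_le_add hu hX)
            exact_mod_cast h2.trans
              (Nat.pow_le_pow_right (by norm_num) (Nat.pow_le_pow_left h3 2))
        _ = _ := by ring
    · rw [filter_eq_empty_iff.2, sum_empty]
      · positivity
      · intro S hS h
        exact hX (h ▸ hF S hS)
  calc ∑ S ∈ F, t ^ m S = ∑ X : Finset (Fin n), ∑ S ∈ F.filter (fun S => supp S \ U = X), t ^ m S :=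
        (sum_fiberwise _ _ _).symm
    _ ≤ ∑ X : Finset (Fin n), 2 ^ ((u + L) ^ 2) * t ^ a * t ^ X.card :=
        sum_le_sum fun X _ => hbound X
    _ = 2 ^ ((u + L) ^ 2) * t ^ a * (t + 1) ^ n := by
        rw [← mul_sum, sum_pow_card_eq]
    _ ≤ 2 ^ ((u + L) ^ 2) * t ^ a * Real.exp c := by
        refine mul_le_mul_of_nonneg_left ?_ (by positivity)
        calc (t + 1) ^ n ≤ Real.exp t ^ n :=
              pow_le_pow_left₀ (by positivity) (Real.add_one_le_exp t) n
          _ = Real.exp (t * n) := by rw [mul_comm, Real.exp_nat_mul]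
          _ ≤ _ := Real.exp_le_exp.2 htc
    _ = _ := by ring

end graph

lemma exp_sub_sq_le {a : ℝ} (ha : 0 ≤ a) : Real.exp (a - a ^ 2) ≤ 1 + a := by
  by_cases h : a ≤ 1
  · have h1 : 0 ≤ a - a ^ 2 := by nlinarith
    have h2 : a - a ^ 2 ≤ a := by nlinarith
    have := exp_sub_one_le (t := a - a ^ 2) (by rw [abs_of_nonneg h1]; linarith)
    nlinarith
  · have : Real.exp (a - a ^ 2) ≤ 1 := Real.exp_le_one_iff.2 (by nlinarith)
    linarith

section families

variable {ι : Type*}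

lemma prod_one_add_le_exp (s : Finset ι) {a : ι → ℝ} (ha : ∀ i ∈ s, 0 ≤ a i) :
    ∏ i ∈ s, (1 + a i) ≤ Real.exp (∑ i ∈ s, a i) := by
  rw [Real.exp_sum]
  refine prod_le_prod (fun i hi => by linarith [ha i hi]) fun i _ => ?_
  linarith [Real.add_one_le_exp (a i)]

lemma sum_prod_le_exp {s : Finset ι} {F : Finset (Finset ι)} (hF : F ⊆ s.powerset) {a : ι → ℝ}
    (ha : ∀ i ∈ s, 0 ≤ a i) : ∑ M ∈ F, ∏ i ∈ M, a i ≤ Real.exp (∑ i ∈ s, a i) := by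
  refine le_trans ?_ (prod_one_add_le_exp s ha)
  rw [prod_one_add]
  exact sum_le_sum_of_subset_of_nonneg hF fun M hM _ =>
    prod_nonneg fun i hi => ha i (mem_powerset.1 hM hi)

lemma exp_le_prod_one_add (s : Finset ι) {a : ι → ℝ} (ha : ∀ i ∈ s, 0 ≤ a i) :
    Real.exp (∑ i ∈ s, a i - ∑ i ∈ s, a i ^ 2) ≤ ∏ i ∈ s, (1 + a i) := by
  rw [← sum_sub_distrib, Real.exp_sum]
  exact prod_le_prod (fun i hi => (Real.exp_pos _).le) fun i hi => exp_sub_sq_le (ha i hi)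

lemma sum_prod_superset_le [DecidableEq ι] {s T : Finset ι} (hT : T ⊆ s)
    {a : ι → ℝ} (ha : ∀ i ∈ s, 0 ≤ a i) :
    ∑ M ∈ s.powerset with T ⊆ M, ∏ i ∈ M, a i ≤
      (∏ i ∈ T, a i) * Real.exp (∑ i ∈ s, a i) := by
  have h1 : ∀ M ∈ s.powerset, (if T ⊆ M then ∏ i ∈ M, a i else 0) =
      (∏ i ∈ M, a i) * ∏ i ∈ s \ M, (if i ∈ T then 0 else 1 : ℝ) := by
    intro M _
    split_ifs with h
    · rw [prod_eq_one (s := s \ M), mul_one]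
      intro i hi
      rw [if_neg fun hiT => (mem_sdiff.1 hi).2 (h hiT)]
    · obtain ⟨i, hiT, hiM⟩ := not_subset.1 h
      have : ∏ i ∈ s \ M, (if i ∈ T then 0 else 1 : ℝ) = 0 :=
        prod_eq_zero (mem_sdiff.2 ⟨hT hiT, hiM⟩) (if_pos hiT)
      rw [this, mul_zero]
  rw [sum_filter, sum_congr rfl h1, ← prod_add]
  have h2 : ∏ i ∈ s, (a i + if i ∈ T then 0 else 1 : ℝ) =
      (∏ i ∈ T, a i) * ∏ i ∈ s \ T, (1 + a i) := by
    rw [← prod_sdiff hT, mul_comm]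
    congr 1
    · exact prod_congr rfl fun i hi => by rw [if_pos hi, add_zero]
    · exact prod_congr rfl fun i hi => by rw [if_neg (mem_sdiff.1 hi).2, add_comm]
  rw [h2]
  refine mul_le_mul_of_nonneg_left ?_ (prod_nonneg fun i hi => ha i (hT hi))
  refine (prod_one_add_le_exp _ fun i hi => ha i (mem_sdiff.1 hi).1).trans ?_
  exact Real.exp_le_exp.2 (sum_le_sum_of_subset_of_nonneg sdiff_subset fun i hi _ => ha i hi)

lemma sum_prod_card_gt_le (s : Finset ι) {a : ι → ℝ} (ha : ∀ i ∈ s, 0 ≤ a i) (R : ℕ) :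
    ∑ M ∈ s.powerset with R < M.card, ∏ i ∈ M, a i ≤
      (1 / 8) ^ R * Real.exp (8 * ∑ i ∈ s, a i) := by
  have h1 : ∑ M ∈ s.powerset with R < M.card, ∏ i ∈ M, a i ≤
      ∑ M ∈ s.powerset with R < M.card, (1 / 8) ^ R * ∏ i ∈ M, (8 * a i) := by
    refine sum_le_sum fun M hM => ?_
    rw [mem_filter, mem_powerset] at hM
    rw [prod_mul_distrib, prod_const, ← mul_assoc]
    refine le_mul_of_one_le_left (prod_nonneg fun i hi => ha i (hM.1 hi)) ?_
    rw [one_div, inv_pow, inv_mul_eq_div, one_le_div (by positivity)]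
    exact pow_le_pow_right₀ (by norm_num) hM.2.le
  refine h1.trans ?_
  rw [← mul_sum, mul_sum s]
  refine mul_le_mul_of_nonneg_left ?_ (by positivity)
  exact sum_prod_le_exp (filter_subset _ _) fun i hi => mul_nonneg (by norm_num) (ha i hi)

/-- Lower bound for the total weight of the small families avoiding a relation `r`. -/
lemma exp_le_sum_prod_add [DecidableEq ι] (s : Finset ι) {a : ι → ℝ}
    (ha : ∀ i ∈ s, 0 ≤ a i) (R : ℕ) (r : ι → ι → Prop) [DecidableRel r] {F : Finset (Finset ι)}
    (hF : ∀ M, M ∈ F ↔ M ⊆ s ∧ (∀ i ∈ M, ∀ j ∈ M, i ≠ j → ¬ r i j) ∧ M.card ≤ R) :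
    Real.exp (∑ i ∈ s, a i - ∑ i ∈ s, a i ^ 2) ≤
      ∑ M ∈ F, ∏ i ∈ M, a i +
      (∑ i ∈ s, ∑ j ∈ s with i ≠ j ∧ r i j, a i * a j) * Real.exp (∑ i ∈ s, a i) +
      (1 / 8) ^ R * Real.exp (8 * ∑ i ∈ s, a i) := by
  have hF' : F = s.powerset.filter fun M =>
      (∀ i ∈ M, ∀ j ∈ M, i ≠ j → ¬ r i j) ∧ M.card ≤ R := by
    ext M
    rw [hF, mem_filter, mem_powerset]
  rw [hF']
  refine (exp_le_prod_one_add s ha).trans ?_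
  rw [prod_one_add]
  have hnn : ∀ M ∈ s.powerset, 0 ≤ ∏ i ∈ M, a i := fun M hM =>
    prod_nonneg fun i hi => ha i (mem_powerset.1 hM hi)
  have hbad : ∑ M ∈ s.powerset with ¬ (∀ i ∈ M, ∀ j ∈ M, i ≠ j → ¬ r i j), ∏ i ∈ M, a i ≤
      (∑ i ∈ s, ∑ j ∈ s with i ≠ j ∧ r i j, a i * a j) * Real.exp (∑ i ∈ s, a i) := by
    calc _ ≤ ∑ M ∈ s.powerset, ∑ i ∈ s, ∑ j ∈ s with i ≠ j ∧ r i j,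
          if ({i, j} : Finset ι) ⊆ M then ∏ i ∈ M, a i else 0 := by
          rw [sum_filter]
          refine sum_le_sum fun M hM => ?_
          have h0 : ∀ i ∈ s, ∀ j ∈ s.filter (fun j => i ≠ j ∧ r i j),
              0 ≤ if ({i, j} : Finset ι) ⊆ M then ∏ i ∈ M, a i else 0 := by
            intro i _ j _
            split_ifs
            · exact hnn M hM
            · exact le_rfl
          by_cases hb : ∀ i ∈ M, ∀ j ∈ M, i ≠ j → ¬ r i j
          swap
          · rw [if_pos hb]
            push Not at hb
            obtain ⟨i, hi, j, hj, hij, hr⟩ := hb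
            have hMs := mem_powerset.1 hM
            refine le_trans ?_ (single_le_sum (fun i hi => sum_nonneg (h0 i hi)) (hMs hi))
            refine le_trans ?_ (single_le_sum (h0 i (hMs hi))
              (mem_filter.2 ⟨hMs hj, hij, hr⟩))
            rw [if_pos]
            intro x hx
            rcases mem_insert.1 hx with rfl | hx
            · exact hi
            · rw [mem_singleton.1 hx]; exact hj
          · rw [if_neg (not_not.2 hb)]
            exact sum_nonneg fun i hi => sum_nonneg (h0 i hi)
      _ = ∑ i ∈ s, ∑ j ∈ s with i ≠ j ∧ r i j,
          ∑ M ∈ s.powerset with ({i, j} : Finset ι) ⊆ M, ∏ i ∈ M, a i := by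
          rw [sum_comm]
          refine sum_congr rfl fun i _ => ?_
          rw [sum_comm]
          exact sum_congr rfl fun j _ => (sum_filter _ _).symm
      _ ≤ ∑ i ∈ s, ∑ j ∈ s with i ≠ j ∧ r i j, a i * a j * Real.exp (∑ i ∈ s, a i) := by
          refine sum_le_sum fun i hi => sum_le_sum fun j hj => ?_
          rw [mem_filter] at hj
          have hsub : ({i, j} : Finset ι) ⊆ s := by
            intro x hx
            rcases mem_insert.1 hx with rfl | hx
            · exact hi
            · rw [mem_singleton.1 hx]; exact hj.1
          have := sum_prod_superset_le hsub ha
          rwa [prod_pair hj.2.1] at this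
      _ = _ := by simp_rw [sum_mul]
  have hsplit : ∑ M ∈ s.powerset, ∏ i ∈ M, a i ≤
      ∑ M ∈ s.powerset with (∀ i ∈ M, ∀ j ∈ M, i ≠ j → ¬ r i j) ∧ M.card ≤ R, ∏ i ∈ M, a i +
      ∑ M ∈ s.powerset with ¬ (∀ i ∈ M, ∀ j ∈ M, i ≠ j → ¬ r i j), ∏ i ∈ M, a i +
      ∑ M ∈ s.powerset with R < M.card, ∏ i ∈ M, a i := by
    rw [sum_filter, sum_filter, sum_filter, ← sum_add_distrib, ← sum_add_distrib]
    refine sum_le_sum fun M hM => ?_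
    have h0 := hnn M hM
    by_cases h1 : ∀ i ∈ M, ∀ j ∈ M, i ≠ j → ¬ r i j
    · by_cases h2 : M.card ≤ R
      · rw [if_pos ⟨h1, h2⟩, if_neg (not_not.2 h1), if_neg (not_lt.2 h2)]; simp
      · rw [if_neg fun h => h2 h.2, if_neg (not_not.2 h1), if_pos (not_le.1 h2)]; simp
    · rw [if_neg fun h => h1 h.1, if_pos h1]
      split_ifs <;> linarith
  have := sum_prod_card_gt_le s ha R
  linarith

end families

section cyc

variable {n : ℕ}

/-- Families of at most `R` pairwise vertex-disjoint cycles of length at most `L`. -/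
noncomputable def fam (n L R : ℕ) : Finset (Finset (Finset (Edge n))) :=
  (cyc n L).powerset.filter fun M =>
    VDisj M ∧ M.card ≤ R

lemma mem_fam {L R : ℕ} {M : Finset (Finset (Edge n))} :
    M ∈ fam n L R ↔ M ⊆ cyc n L ∧ VDisj M ∧ M.card ≤ R := by
  simp [fam]

lemma card_supp_of_mem_cyc {L : ℕ} {C : Finset (Edge n)} (h : C ∈ cyc n L) :
    (supp C).card = C.card := (mem_cyc.1 h).1.2.2.1

lemma card_le_of_mem_cyc {L : ℕ} {C : Finset (Edge n)} (h : C ∈ cyc n L) : C.card ≤ L :=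
  (mem_cyc.1 h).2

lemma card_pos_of_mem_cyc {L : ℕ} {C : Finset (Edge n)} (h : C ∈ cyc n L) : 0 < C.card :=
  card_pos.2 (mem_cyc.1 h).1.1

lemma sum_cyc_le {L : ℕ} {t c : ℝ} (ht0 : 0 ≤ t) (ht1 : t ≤ 1) (htc : t * n ≤ c) :
    ∑ C ∈ cyc n L, t ^ C.card ≤ 2 ^ L ^ 2 * Real.exp c := by
  have := sum_pow_le_of_card_supp (U := ∅) (u := 0) (L := L) (a := 0) (by simp) ht0 ht1 htc
    (cyc n L) card
    (fun S hS => by rw [sdiff_empty, card_supp_of_mem_cyc hS]; exact card_le_of_mem_cyc hS)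
    (fun S hS => by rw [sdiff_empty, card_supp_of_mem_cyc hS, add_zero])
  simpa using this

lemma sum_cyc_meet_le {L u : ℕ} {t c : ℝ} (ht0 : 0 ≤ t) (ht1 : t ≤ 1) (htc : t * n ≤ c)
    {U : Finset (Fin n)} (hU : U.card ≤ u) :
    ∑ C ∈ cyc n L with ¬ Disjoint (supp C) U, t ^ C.card ≤
      2 ^ (u + L) ^ 2 * Real.exp c * t := by
  have := sum_pow_le_of_card_supp (U := U) (u := u) (L := L) (a := 1) hU ht0 ht1 htc
    ((cyc n L).filter fun C => ¬ Disjoint (supp C) U) card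
    (fun S hS => (card_le_card sdiff_subset).trans (by
      rw [card_supp_of_mem_cyc (mem_filter.1 hS).1]; exact card_le_of_mem_cyc (mem_filter.1 hS).1))
    (fun S hS => by
      rw [mem_filter] at hS
      rw [← card_supp_of_mem_cyc hS.1]
      refine Nat.succ_le_of_lt (card_lt_card ⟨sdiff_subset, fun h => hS.2 ?_⟩)
      exact disjoint_left.2 fun v hv => (mem_sdiff.1 (h hv)).2)
  simpa using this

lemma fam_lower {L R : ℕ} {t c A : ℝ} (ht0 : 0 ≤ t) (ht1 : t ≤ 1) (htc : t * n ≤ c)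
    {a : Finset (Edge n) → ℝ} (ha : ∀ C ∈ cyc n L, 0 ≤ a C)
    (haA : ∀ C ∈ cyc n L, a C ≤ A * t ^ C.card) (hA : 0 ≤ A) :
    Real.exp (∑ C ∈ cyc n L, a C) - Real.exp (A * (2 ^ L ^ 2 * Real.exp c)) *
      (2 * A ^ 2 * (2 ^ L ^ 2 * Real.exp c) * (2 ^ (L + L) ^ 2 * Real.exp c) * t) -
      (1 / 8) ^ R * Real.exp (8 * (A * (2 ^ L ^ 2 * Real.exp c))) ≤
    ∑ M ∈ fam n L R, ∏ C ∈ M, a C := by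
  have h1 := exp_le_sum_prod_add (cyc n L) ha R (fun C C' => ¬ Disjoint (supp C) (supp C'))
    (F := fam n L R) (fun M => by rw [mem_fam]; simp only [VDisj, not_not])
  set Λ : ℝ := 2 ^ L ^ 2 * Real.exp c with hΛ
  set Λ' : ℝ := 2 ^ (L + L) ^ 2 * Real.exp c with hΛ'
  have hΛ0 : 0 ≤ Λ := by positivity
  have hΛ'0 : 0 ≤ Λ' := by positivity
  have hsum : ∑ C ∈ cyc n L, a C ≤ A * Λ := by
    refine (sum_le_sum haA).trans ?_
    rw [← mul_sum]
    exact mul_le_mul_of_nonneg_left (sum_cyc_le ht0 ht1 htc) hA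
  have hΛ1 : 1 ≤ Λ' / Λ := by
    rw [one_le_div (by positivity)]
    refine mul_le_mul_of_nonneg_right ?_ (Real.exp_pos _).le
    exact pow_le_pow_right₀ (by norm_num) (Nat.pow_le_pow_left (by omega) 2)
  have hΛΛ : Λ ≤ Λ' := by
    have : 0 < Λ := by positivity
    rwa [one_le_div this] at hΛ1
  have hexpc : 1 ≤ Λ' := by
    have hc : 0 ≤ c := le_trans (by positivity) htc
    exact one_le_mul_of_one_le_of_one_le (one_le_pow₀ (by norm_num)) (Real.one_le_exp hc)
  have hsq : ∑ C ∈ cyc n L, a C ^ 2 ≤ A ^ 2 * Λ * Λ' * t := by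
    calc _ ≤ ∑ C ∈ cyc n L, A ^ 2 * t * t ^ C.card := by
          refine sum_le_sum fun C hC => ?_
          have h2 : t ^ C.card ≤ t := pow_le_of_le_one ht0 ht1 (card_pos_of_mem_cyc hC).ne'
          have h3 : 0 ≤ t ^ C.card := by positivity
          calc a C ^ 2 ≤ (A * t ^ C.card) ^ 2 := pow_le_pow_left₀ (ha C hC) (haA C hC) 2
            _ = A ^ 2 * t ^ C.card * t ^ C.card := by ring
            _ ≤ A ^ 2 * t * t ^ C.card := by gcongr
      _ = A ^ 2 * t * ∑ C ∈ cyc n L, t ^ C.card := by rw [mul_sum]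
      _ ≤ A ^ 2 * t * Λ := mul_le_mul_of_nonneg_left (sum_cyc_le ht0 ht1 htc) (by positivity)
      _ ≤ A ^ 2 * t * Λ * Λ' := le_mul_of_one_le_right (by positivity) hexpc
      _ = _ := by ring
  have hpair : ∑ C ∈ cyc n L, ∑ C' ∈ cyc n L with C ≠ C' ∧ ¬ Disjoint (supp C) (supp C'),
      a C * a C' ≤ A ^ 2 * Λ * Λ' * t := by
    calc _ ≤ ∑ C ∈ cyc n L, A ^ 2 * (Λ' * t) * t ^ C.card := by
          refine sum_le_sum fun C hC => ?_
          rw [← mul_sum]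
          have h3 : ∑ C' ∈ cyc n L with C ≠ C' ∧ ¬ Disjoint (supp C) (supp C'), a C' ≤
              A * (Λ' * t) := by
            calc _ ≤ ∑ C' ∈ cyc n L with C ≠ C' ∧ ¬ Disjoint (supp C) (supp C'),
                  A * t ^ C'.card := sum_le_sum fun C' hC' => haA C' (mem_filter.1 hC').1
              _ ≤ ∑ C' ∈ cyc n L with ¬ Disjoint (supp C') (supp C), A * t ^ C'.card := by
                  refine sum_le_sum_of_subset_of_nonneg (fun C' hC' => ?_)
                    fun _ _ _ => by positivity
                  rw [mem_filter] at hC' ⊢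
                  exact ⟨hC'.1, fun h => hC'.2.2 h.symm⟩
              _ ≤ _ := by
                  rw [← mul_sum]
                  refine mul_le_mul_of_nonneg_left ?_ hA
                  exact sum_cyc_meet_le ht0 ht1 htc
                    ((card_supp_of_mem_cyc hC).trans_le (card_le_of_mem_cyc hC))
          calc _ ≤ (A * t ^ C.card) * (A * (Λ' * t)) :=
                mul_le_mul (haA C hC) h3
                  (sum_nonneg fun C' hC' => ha C' (mem_filter.1 hC').1) (by positivity)
            _ = _ := by ring
      _ = A ^ 2 * (Λ' * t) * ∑ C ∈ cyc n L, t ^ C.card := by rw [mul_sum]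
      _ ≤ A ^ 2 * (Λ' * t) * Λ :=
          mul_le_mul_of_nonneg_left (sum_cyc_le ht0 ht1 htc) (by positivity)
      _ = _ := by ring
  have hE : Real.exp (∑ C ∈ cyc n L, a C) ≤ Real.exp (A * Λ) := Real.exp_le_exp.2 hsum
  have hE8 : Real.exp (8 * ∑ C ∈ cyc n L, a C) ≤ Real.exp (8 * (A * Λ)) :=
    Real.exp_le_exp.2 (by linarith)
  set X := A ^ 2 * Λ * Λ' * t with hX
  have hX0 : 0 ≤ X := by positivity
  have h4 : Real.exp (∑ C ∈ cyc n L, a C) * (1 - X) ≤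
      Real.exp (∑ C ∈ cyc n L, a C - ∑ C ∈ cyc n L, a C ^ 2) := by
    rw [sub_eq_add_neg (∑ C ∈ cyc n L, a C), Real.exp_add]
    refine mul_le_mul_of_nonneg_left ?_ (Real.exp_pos _).le
    have := Real.add_one_le_exp (-∑ C ∈ cyc n L, a C ^ 2)
    linarith
  have h5 : (∑ C ∈ cyc n L, ∑ C' ∈ cyc n L with C ≠ C' ∧ ¬ Disjoint (supp C) (supp C'),
      a C * a C') * Real.exp (∑ C ∈ cyc n L, a C) ≤ X * Real.exp (A * Λ) :=
    mul_le_mul hpair hE (Real.exp_pos _).le hX0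
  have h6 : (1 / 8 : ℝ) ^ R * Real.exp (8 * ∑ C ∈ cyc n L, a C) ≤
      (1 / 8) ^ R * Real.exp (8 * (A * Λ)) := mul_le_mul_of_nonneg_left hE8 (by positivity)
  have h7 : X * Real.exp (∑ C ∈ cyc n L, a C) ≤ X * Real.exp (A * Λ) :=
    mul_le_mul_of_nonneg_left hE hX0
  have h8 : Real.exp (A * Λ) * (2 * A ^ 2 * Λ * Λ' * t) = 2 * (X * Real.exp (A * Λ)) := by
    rw [hX]; ring
  rw [h8]
  linarith

end cyc

section moment

variable {n K : ℕ}

/-- The density of the graph with colour-dependent edge probabilities `p * (1 + xi σ e)` with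
respect to the uniform one, where `r = p / (1 - p)`. -/
noncomputable def lik (r : ℝ) (σ : Fin n → Fin K) (A : Finset (Edge n)) : ℝ :=
  ∏ e, if e ∈ A then 1 + xi σ e else 1 - r * xi σ e

/-- The average density over balanced colourings. -/
noncomputable def balLik (K : ℕ) (r : ℝ) (A : Finset (Edge n)) : ℝ :=
  avg fun σ : Fin n → Fin K => (if Balanced σ then 1 else 0) * lik r σ A

lemma avg_mul_avg (F G : (Fin n → Fin K) → ℝ) :
    avg F * avg G = avg fun σ => avg fun τ => F σ * G τ := by
  simp_rw [avg_const_mul, avg_mul_const]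

lemma prod_one_add_mul_eq (r : ℝ) (σ τ : Fin n → Fin K) :
    ∏ e, (1 + r * (xi σ e * xi τ e)) =
      ∑ S : Finset (Edge n), r ^ S.card * ((∏ e ∈ S, xi σ e) * ∏ e ∈ S, xi τ e) := by
  rw [prod_one_add, powerset_univ]
  refine sum_congr rfl fun S _ => ?_
  rw [prod_mul_distrib, prod_mul_distrib, prod_const]

lemma avg_avg_expansion (r : ℝ) :
    avg (fun σ : Fin n → Fin K => avg fun τ : Fin n → Fin K =>
      (if Balanced σ then 1 else 0) * (if Balanced τ then 1 else 0) *
        ∏ e, (1 + r * (xi σ e * xi τ e))) =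
    ∑ S : Finset (Edge n), r ^ S.card * balMeanXi K S ^ 2 := by
  simp_rw [prod_one_add_mul_eq, mul_sum, avg_sum]
  refine sum_congr rfl fun S _ => ?_
  rw [sq, balMeanXi, avg_mul_avg, ← avg_const_mul]
  congr 1
  funext σ
  rw [← avg_const_mul]
  congr 1
  funext τ
  ring

lemma sum_wt_mul_lik_mul_lik {p r : ℝ} (hr : (1 - p) * r = p) (σ τ : Fin n → Fin K) :
    ∑ A, wt (fun _ => p) A * (lik r σ A * lik r τ A) = ∏ e, (1 + r * (xi σ e * xi τ e)) := by
  have h : ∀ A : Finset (Edge n), lik r σ A * lik r τ A = ∏ e, if e ∈ A then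
      (1 + xi σ e) * (1 + xi τ e) else (1 - r * xi σ e) * (1 - r * xi τ e) := by
    intro A
    rw [lik, lik, ← prod_mul_distrib]
    exact prod_congr rfl fun e _ => by split_ifs <;> rfl
  simp_rw [h]
  rw [sum_wt_mul_prod_ite]
  refine prod_congr rfl fun e _ => ?_
  linear_combination (-(xi σ e) - xi τ e + xi σ e * xi τ e * (r - 1)) * hr

lemma second_moment_eq {p r : ℝ} (hr : (1 - p) * r = p) :
    ∑ A : Finset (Edge n), wt (fun _ => p) A * balLik K r A ^ 2 =
      ∑ S : Finset (Edge n), r ^ S.card * balMeanXi K S ^ 2 := by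
  rw [← avg_avg_expansion]
  have h : ∀ A : Finset (Edge n), wt (fun _ => p) A * balLik K r A ^ 2 =
      avg (fun σ : Fin n → Fin K => avg fun τ : Fin n → Fin K =>
        (if Balanced σ then 1 else 0) * (if Balanced τ then 1 else 0) *
          (wt (fun _ => p) A * (lik r σ A * lik r τ A))) := by
    intro A
    rw [sq, balLik, avg_mul_avg, ← avg_const_mul]
    congr 1
    funext σ
    rw [← avg_const_mul]
    congr 1
    funext τ
    ring
  simp_rw [h, ← avg_sum, ← mul_sum, sum_wt_mul_lik_mul_lik hr]

lemma exists_sum_le (hK : 3 ≤ K) {D : ℝ} (hD0 : 0 ≤ D)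
    (hD : D < 2 * ((K : ℝ) - 1) * Real.log ((K : ℝ) - 1)) :
    ∃ C > 0, ∀ n : ℕ, D / n ≤ 1 →
      ∑ S : Finset (Edge n), (D / n) ^ S.card * balMeanXi K S ^ 2 ≤ C := by
  obtain ⟨C, hC, h⟩ := second_moment_bounded hK hD0 hD
  refine ⟨C, hC, fun n hn => ?_⟩
  rw [← avg_avg_expansion]
  refine le_of_le_of_eq (avg_mono (G := fun _ => C) fun σ => ?_) (avg_const (by omega) C)
  by_cases hσ : Balanced σ
  · simp only [hσ, if_true, one_mul]
    have h1 : avg (fun τ : Fin n → Fin K => Real.exp (D / n * ∑ e, xi σ e * xi τ e)) ≤ C := by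
      rw [avg, div_le_iff₀ (by have : (0 : ℝ) < K := by exact_mod_cast (by omega : 0 < K)
                               positivity)]
      exact h n σ hσ
    refine le_trans (avg_mono fun τ => ?_) h1
    have hx : ∀ e, |D / n * (xi σ e * xi τ e)| ≤ 1 := by
      intro e
      rw [abs_mul, abs_mul, abs_of_nonneg (by positivity : 0 ≤ D / n)]
      exact mul_le_one₀ hn (by positivity)
        (mul_le_one₀ (abs_xi_le (by omega) σ e) (abs_nonneg _) (abs_xi_le (by omega) τ e))
    have h0 : ∀ e, 0 ≤ 1 + D / n * (xi σ e * xi τ e) := fun e => by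
      linarith [(abs_le.1 (hx e)).1]
    have hprod : ∏ e, (1 + D / n * (xi σ e * xi τ e)) ≤
        Real.exp (D / n * ∑ e, xi σ e * xi τ e) := by
      rw [mul_sum, Real.exp_sum]
      refine prod_le_prod (fun e _ => h0 e) fun e _ => ?_
      linarith [Real.add_one_le_exp (D / n * (xi σ e * xi τ e))]
    split_ifs
    · rw [one_mul]; exact hprod
    · rw [zero_mul]; exact (Real.exp_pos _).le
  · simp only [hσ, if_false, zero_mul]
    rw [avg_const (by omega)]
    exact hC.le

lemma disjoint_of_disjoint_supp {S T : Finset (Edge n)} (h : Disjoint (supp S) (supp T)) :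
    Disjoint S T := by
  refine disjoint_left.2 fun e he he' => ?_
  exact disjoint_left.1 h (ends_subset_supp he (mem_ends.2 (Or.inl rfl)))
    (ends_subset_supp he' (mem_ends.2 (Or.inl rfl)))

lemma VDisj.pairwiseDisjoint {M : Finset (Finset (Edge n))} (h : VDisj M) :
    Set.PairwiseDisjoint (M : Set (Finset (Edge n))) id := fun C hC C' hC' hne =>
  disjoint_of_disjoint_supp (h C (mem_coe.1 hC) C' (mem_coe.1 hC') hne)

lemma avg_prod_biUnion (hK : 0 < K) (f : ℝ → ℝ) {M : Finset (Finset (Edge n))} (h : VDisj M) :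
    avg (fun σ : Fin n → Fin K => ∏ e ∈ M.biUnion id, f (xi σ e)) =
      ∏ C ∈ M, avg (fun σ : Fin n → Fin K => ∏ e ∈ C, f (xi σ e)) := by
  induction M using Finset.induction_on with
  | empty => simp [avg_const hK]
  | insert C M hC ih =>
    have hM : VDisj M := fun A hA B hB => h A (mem_insert_of_mem hA) B (mem_insert_of_mem hB)
    have hd : Disjoint (supp C) (supp (M.biUnion id)) := by
      refine disjoint_left.2 fun v hv hv' => ?_
      obtain ⟨e, he, hve⟩ := mem_supp.1 hv'
      obtain ⟨C', hC', heC'⟩ := mem_biUnion.1 he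
      have : C = C' := eq_of_mem_supp h (mem_insert_self C M) (mem_insert_of_mem hC') hv
        (mem_supp.2 ⟨e, heC', hve⟩)
      exact hC (this ▸ hC')
    rw [prod_insert hC, biUnion_insert, ← ih hM]
    simp only [id]
    simp_rw [prod_union (disjoint_of_disjoint_supp hd)]
    exact avg_mul_of_dependsOn hK (dependsOn_prod subset_rfl f) (dependsOn_prod subset_rfl f) hd

lemma sum_two_regular_le (hK : 0 < K) (L : ℕ) {r : ℝ} (hr : 0 ≤ r) :
    ∑ S : Finset (Edge n) with (Leafless S ∧ (supp S).card = S.card) ∧ S.card ≤ L,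
      r ^ S.card * meanXi K S ^ 2 ≤
    Real.exp (∑ C ∈ cyc n L, r ^ C.card * meanXi K C ^ 2) := by
  set F := (univ : Finset (Finset (Edge n))).filter
    fun S => (Leafless S ∧ (supp S).card = S.card) ∧ S.card ≤ L with hF
  have hex : ∀ S : Finset (Edge n), ∃ M : Finset (Finset (Edge n)), S ∈ F →
      M ⊆ cyc n L ∧ VDisj M ∧ M.biUnion id = S := by
    intro S
    by_cases hS : S ∈ F
    · obtain ⟨⟨h1, h2⟩, h3⟩ := (mem_filter.1 hS).2
      obtain ⟨M, hM, hd, hU⟩ := exists_cyc_decomposition S h1 h2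
      refine ⟨M, fun _ => ⟨fun C hC => mem_cyc.2 ⟨hM C hC, ?_⟩, hd, hU⟩⟩
      exact (card_le_card (hU ▸ subset_biUnion_of_mem id hC)).trans h3
    · exact ⟨∅, fun h => absurd h hS⟩
  choose m hm using hex
  have hinj : Set.InjOn m (F : Set (Finset (Edge n))) := by
    intro S hS T hT h
    rw [← (hm S (mem_coe.1 hS)).2.2, h, (hm T (mem_coe.1 hT)).2.2]
  have heq : ∀ S ∈ F, r ^ S.card * meanXi K S ^ 2 =
      ∏ C ∈ m S, (r ^ C.card * meanXi K C ^ 2) := by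
    intro S hS
    obtain ⟨_, h2, h3⟩ := hm S hS
    have h4 : S.card = ∑ C ∈ m S, C.card := by
      conv_lhs => rw [← h3]
      exact card_biUnion fun C hC C' hC' hne => h2.pairwiseDisjoint hC hC' hne
    have h5 : meanXi K S = ∏ C ∈ m S, meanXi K C := by
      have := avg_prod_biUnion (K := K) hK id h2
      rw [h3] at this
      exact this
    rw [prod_mul_distrib, prod_pow_eq_pow_sum, ← h4, prod_pow, h5]
  rw [sum_congr rfl heq, ← sum_image (f := fun M => ∏ C ∈ M, (r ^ C.card * meanXi K C ^ 2)) hinj]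
  refine sum_prod_le_exp (fun M hM => ?_) fun C _ => by positivity
  obtain ⟨S, hS, rfl⟩ := mem_image.1 hM
  exact mem_powerset.2 (hm S hS).1

lemma abs_sq_sub_le (hK : 2 ≤ K) (S : Finset (Edge n)) :
    |balMeanXi K S ^ 2 - meanXi K S ^ 2| ≤ 2 * unbal n K := by
  have h1 := abs_balMeanXi_sub_le hK S
  have h2 := abs_balMeanXi_le_one hK S
  have h3 := abs_meanXi_le_one hK S
  have : balMeanXi K S ^ 2 - meanXi K S ^ 2 =
    (balMeanXi K S - meanXi K S) * (balMeanXi K S + meanXi K S) := by ring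
  rw [this, abs_mul, mul_comm]
  exact mul_le_mul ((abs_add_le _ _).trans (by linarith)) h1 (abs_nonneg _) (by norm_num)

lemma card_small_le (hn : 1 ≤ n) (L : ℕ) :
    ((univ.filter fun S : Finset (Edge n) => S.card ≤ L).card : ℝ) ≤
      Real.exp 1 * (n : ℝ) ^ (2 * L) := by
  have hn' : (1 : ℝ) ≤ n := by exact_mod_cast hn
  set x : ℝ := 1 / (n : ℝ) ^ 2 with hx
  have hx0 : 0 < x := by positivity
  have hx1 : x ≤ 1 := by
    rw [hx, div_le_one (by positivity)]; exact one_le_pow₀ hn'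
  have h1 : ∑ S : Finset (Edge n), x ^ S.card = (1 + x) ^ Fintype.card (Edge n) := by
    have := Finset.prod_one_add (s := (univ : Finset (Edge n))) (f := fun _ => x)
    simp only [prod_const, card_univ, powerset_univ] at this
    exact this.symm
  have h2 : Fintype.card (Edge n) ≤ n ^ 2 := by
    have := Fintype.card_le_of_injective (fun e : Edge n => e.1) Subtype.val_injective
    simpa [sq] using this
  have h3 : (1 + x) ^ Fintype.card (Edge n) ≤ Real.exp 1 := by
    calc (1 + x) ^ Fintype.card (Edge n) ≤ (1 + x) ^ (n ^ 2) :=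
          pow_le_pow_right₀ (by linarith) h2
      _ ≤ Real.exp x ^ (n ^ 2) := by
          refine pow_le_pow_left₀ (by linarith) ?_ _
          linarith [Real.add_one_le_exp x]
      _ = Real.exp 1 := by
          rw [← Real.exp_nat_mul, hx]; push_cast; congr 1; field_simp
  have h4 : ((univ.filter fun S : Finset (Edge n) => S.card ≤ L).card : ℝ) * x ^ L ≤
      ∑ S : Finset (Edge n), x ^ S.card := by
    rw [← nsmul_eq_mul, ← sum_const]
    calc _ ≤ ∑ S : Finset (Edge n) with S.card ≤ L, x ^ S.card := by
          refine sum_le_sum fun S hS => ?_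
          exact pow_le_pow_of_le_one hx0.le hx1 (mem_filter.1 hS).2
      _ ≤ _ := sum_le_sum_of_subset_of_nonneg (filter_subset _ _) fun _ _ _ => by positivity
  have h5 : x ^ L * (n : ℝ) ^ (2 * L) = 1 := by
    rw [hx, pow_mul, ← mul_pow, one_div_mul_cancel (by positivity), one_pow]
  calc _ = ((univ.filter fun S : Finset (Edge n) => S.card ≤ L).card : ℝ) * x ^ L *
        (n : ℝ) ^ (2 * L) := by rw [mul_assoc, h5, mul_one]
    _ ≤ _ := mul_le_mul_of_nonneg_right (h4.trans (h1.trans_le h3)) (by positivity)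

lemma sum_small_le (hK : 2 ≤ K) (hn : 1 ≤ n) (L : ℕ) {r c : ℝ} (hr : 0 ≤ r) (hr1 : r ≤ 1)
    (hrc : r * n ≤ c) :
    ∑ S : Finset (Edge n) with S.card ≤ L, r ^ S.card * balMeanXi K S ^ 2 ≤
      Real.exp (∑ C ∈ cyc n L, r ^ C.card * meanXi K C ^ 2) +
        2 ^ L ^ 2 * Real.exp c * r + 2 * unbal n K * (Real.exp 1 * (n : ℝ) ^ (2 * L)) := by
  have h1 : ∀ S : Finset (Edge n), S.card ≤ L → r ^ S.card * balMeanXi K S ^ 2 ≤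
      (if Leafless S ∧ (supp S).card = S.card then r ^ S.card * meanXi K S ^ 2 else 0) +
      (if Leafless S ∧ (supp S).card + 1 ≤ S.card then r ^ S.card else 0) + 2 * unbal n K := by
    intro S _
    have ha := (abs_le.1 (abs_sq_sub_le hK S)).2
    have hp1 : r ^ S.card ≤ 1 := pow_le_one₀ hr hr1
    have hp0 : 0 ≤ r ^ S.card := by positivity
    have hb := unbal_nonneg (n := n) (K := K)
    have h2 : r ^ S.card * balMeanXi K S ^ 2 ≤ r ^ S.card * meanXi K S ^ 2 + 2 * unbal n K := by
      nlinarith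
    refine h2.trans (add_le_add_left ?_ _)
    by_cases hl : Leafless S
    · have := hl.card_supp_le
      by_cases hc : (supp S).card = S.card
      · rw [if_pos ⟨hl, hc⟩]
        split_ifs <;> linarith
      · rw [if_neg fun h => hc h.2, if_pos ⟨hl, by omega⟩, zero_add]
        have hm : meanXi K S ^ 2 ≤ 1 := by
          rw [← sq_abs]; exact pow_le_one₀ (abs_nonneg _) (abs_meanXi_le_one hK S)
        nlinarith
    · rw [if_neg fun h => hl h.1, if_neg fun h => hl h.1]
      simp only [Leafless, not_forall, not_not] at hl
      obtain ⟨v, hv⟩ := hl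
      simp [meanXi_eq_zero hK hv]
  calc _ ≤ ∑ S : Finset (Edge n) with S.card ≤ L, _ := sum_le_sum fun S hS =>
        h1 S (mem_filter.1 hS).2
    _ = ∑ S : Finset (Edge n) with (Leafless S ∧ (supp S).card = S.card) ∧ S.card ≤ L,
          r ^ S.card * meanXi K S ^ 2 +
        ∑ S : Finset (Edge n) with (Leafless S ∧ (supp S).card + 1 ≤ S.card) ∧ S.card ≤ L,
          r ^ S.card + 2 * unbal n K *
            ((univ.filter fun S : Finset (Edge n) => S.card ≤ L).card : ℝ) := by
        rw [sum_add_distrib, sum_add_distrib, sum_const, nsmul_eq_mul, ← sum_filter, ← sum_filter,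
          filter_filter, filter_filter, mul_comm (2 * unbal n K)]
        simp only [and_comm]
    _ ≤ _ := by
        refine add_le_add (add_le_add (sum_two_regular_le (by omega) L hr) ?_) ?_
        · have := sum_pow_le_of_card_supp (U := ∅) (u := 0) (L := L) (a := 1) (by simp) hr hr1 hrc
            ((univ : Finset (Finset (Edge n))).filter
              fun S => (Leafless S ∧ (supp S).card + 1 ≤ S.card) ∧ S.card ≤ L) card
            (fun S hS => by
              have := (mem_filter.1 hS).2
              rw [sdiff_empty]; omega)
            (fun S hS => by
              have := (mem_filter.1 hS).2
              rw [sdiff_empty]; omega)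
          simpa using this
        · exact mul_le_mul_of_nonneg_left (card_small_le hn L)
            (mul_nonneg (by norm_num) unbal_nonneg)

lemma sum_large_le (L : ℕ) {r t ρ : ℝ} (hr : 0 ≤ r) (ht : 0 ≤ t) (hρ0 : 0 ≤ ρ) (hρ1 : ρ ≤ 1)
    (hrt : r ≤ ρ * t) :
    ∑ S : Finset (Edge n) with ¬ S.card ≤ L, r ^ S.card * balMeanXi K S ^ 2 ≤
      ρ ^ L * ∑ S : Finset (Edge n), t ^ S.card * balMeanXi K S ^ 2 := by
  rw [mul_sum]
  calc _ ≤ ∑ S : Finset (Edge n) with ¬ S.card ≤ L, ρ ^ L * (t ^ S.card * balMeanXi K S ^ 2) := by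
        refine sum_le_sum fun S hS => ?_
        have h1 : L ≤ S.card := (not_le.1 (mem_filter.1 hS).2).le
        rw [← mul_assoc]
        refine mul_le_mul_of_nonneg_right ?_ (sq_nonneg _)
        calc r ^ S.card ≤ (ρ * t) ^ S.card := pow_le_pow_left₀ hr hrt _
          _ = ρ ^ S.card * t ^ S.card := mul_pow _ _ _
          _ ≤ _ := mul_le_mul_of_nonneg_right (pow_le_pow_of_le_one hρ0 hρ1 h1) (by positivity)
    _ ≤ _ := sum_le_sum_of_subset_of_nonneg (filter_subset _ _) fun _ _ _ => by positivity

lemma sum_cyc_meanXi_le (hK : 2 ≤ K) (L : ℕ) {r c : ℝ} (hr : 0 ≤ r) (hr1 : r ≤ 1)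
    (hrc : r * n ≤ c) :
    ∑ C ∈ cyc n L, r ^ C.card * meanXi K C ^ 2 ≤
      ∑ S : Finset (Edge n), r ^ S.card * balMeanXi K S ^ 2 +
        2 * unbal n K * (2 ^ L ^ 2 * Real.exp c) := by
  calc _ ≤ ∑ C ∈ cyc n L, (r ^ C.card * balMeanXi K C ^ 2 + 2 * unbal n K * r ^ C.card) := by
        refine sum_le_sum fun C _ => ?_
        have ha := (abs_le.1 (abs_sq_sub_le hK C)).1
        have hp0 : 0 ≤ r ^ C.card := by positivity
        nlinarith
    _ ≤ _ := by
        rw [sum_add_distrib, ← mul_sum]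
        refine add_le_add (sum_le_sum_of_subset_of_nonneg (subset_univ _)
          fun _ _ _ => by positivity) ?_
        exact mul_le_mul_of_nonneg_left (sum_cyc_le hr hr1 hrc)
          (mul_nonneg (by norm_num) unbal_nonneg)

end moment

lemma exp_neg_le_one_sub {x : ℝ} (h0 : 0 ≤ x) (h1 : x ≤ 1 / 5) :
    Real.exp (-(x + 2 * x ^ 2)) ≤ 1 - x := by
  have := exp_sub_one_le (t := -(x + 2 * x ^ 2)) (by
    rw [abs_neg, abs_of_nonneg (by positivity)]; nlinarith)
  have h2 : (1 + 2 * x) ^ 2 ≤ 2 := by nlinarith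
  have h3 : (x + 2 * x ^ 2) ^ 2 = x ^ 2 * (1 + 2 * x) ^ 2 := by ring
  have h4 : x ^ 2 * (1 + 2 * x) ^ 2 ≤ x ^ 2 * 2 := mul_le_mul_of_nonneg_left h2 (sq_nonneg x)
  nlinarith

section event

variable {n K : ℕ}

/-- The indicator of the event that, among the cycles of length at most `L`, exactly the members
of `M` are contained in the random edge set. -/
noncomputable def cycEvent (L : ℕ) (M : Finset (Finset (Edge n))) (A : Finset (Edge n)) : ℝ :=
  if M.biUnion id ⊆ A ∧ ∀ C ∈ cyc n L \ M, ¬ C ⊆ A then 1 else 0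

lemma cycEvent_nonneg (L : ℕ) (M : Finset (Finset (Edge n))) (A : Finset (Edge n)) :
    0 ≤ cycEvent L M A := by
  unfold cycEvent; split_ifs <;> norm_num

lemma cycEvent_eq_zero_or_one (L : ℕ) (M : Finset (Finset (Edge n))) (A : Finset (Edge n)) :
    cycEvent L M A = 0 ∨ cycEvent L M A = 1 := by
  unfold cycEvent; split_ifs <;> simp

lemma eq_filter_of_cycEvent {L : ℕ} {M : Finset (Finset (Edge n))} {A : Finset (Edge n)}
    (hM : M ⊆ cyc n L) (h : cycEvent L M A ≠ 0) : M = (cyc n L).filter (· ⊆ A) := by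
  unfold cycEvent at h
  split_ifs at h with h1
  · ext C
    rw [mem_filter]
    refine ⟨fun hC => ⟨hM hC, (subset_biUnion_of_mem id hC).trans h1.1⟩, fun hC => ?_⟩
    by_contra hCM
    exact h1.2 C (mem_sdiff.2 ⟨hC.1, hCM⟩) hC.2
  · exact absurd rfl h

lemma card_supp_biUnion_le {L R : ℕ} {M : Finset (Finset (Edge n))} (hM : M ∈ fam n L R) :
    (supp (M.biUnion id)).card ≤ R * L := by
  rw [mem_fam] at hM
  have h1 : supp (M.biUnion id) ⊆ M.biUnion supp := by
    intro v hv
    obtain ⟨e, he, hve⟩ := mem_supp.1 hv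
    obtain ⟨C, hC, heC⟩ := mem_biUnion.1 he
    exact mem_biUnion.2 ⟨C, hC, mem_supp.2 ⟨e, heC, hve⟩⟩
  refine (card_le_card h1).trans ((card_biUnion_le_card_mul M supp L fun C hC => ?_).trans
    (Nat.mul_le_mul_right L hM.2.2))
  rw [card_supp_of_mem_cyc (hM.1 hC)]
  exact card_le_of_mem_cyc (hM.1 hC)

lemma cycEvent_prob_ge {L R : ℕ} {q : Edge n → ℝ} {t c : ℝ} (h0 : ∀ e, 0 ≤ q e)
    (h1 : ∀ e, q e ≤ t) (ht : t ≤ 1 / 5) (ht0 : 0 ≤ t) (htc : t * n ≤ c)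
    {M : Finset (Finset (Edge n))} (hM : M ∈ fam n L R) :
    (∏ e ∈ M.biUnion id, q e) * Real.exp (-((1 + 2 * t) *
      (∑ C ∈ cyc n L with Disjoint (supp C) (supp (M.biUnion id)), ∏ e ∈ C, q e +
        2 ^ (R * L + L) ^ 2 * Real.exp c * t))) ≤
    ∑ A : Finset (Edge n), wt q A * cycEvent L M A := by
  have hMf := mem_fam.1 hM
  have hMc : ∀ C ∈ M, IsCyc C := fun C hC => (mem_cyc.1 (hMf.1 hC)).1
  set U := M.biUnion id with hU
  have hq1 : ∀ e, q e ≤ 1 := fun e => (h1 e).trans (by linarith)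
  refine le_trans ?_ (harris_contain_avoid h0 hq1 U (cyc n L \ M))
  refine mul_le_mul_of_nonneg_left ?_ (prod_nonneg fun e _ => h0 e)
  have hgt : ∀ C ∈ cyc n L \ M, ¬ Disjoint (supp C) (supp U) →
      (supp C \ supp U).card + 1 ≤ (C \ U).card := fun C hC hmeet =>
    card_diff_biUnion_gt hMc hMf.2.1 (mem_cyc.1 (mem_sdiff.1 hC).1).1 (mem_sdiff.1 hC).2 hmeet
  have hdj : ∀ C : Finset (Edge n), Disjoint (supp C) (supp U) → C \ U = C := fun C h =>
    sdiff_eq_self_of_disjoint (disjoint_of_disjoint_supp h)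
  have hprod_le : ∀ S : Finset (Edge n), ∏ e ∈ S, q e ≤ t ^ S.card := fun S => by
    rw [← prod_const]
    exact prod_le_prod (fun e _ => h0 e) fun e _ => h1 e
  have hx : ∀ C ∈ cyc n L \ M, ∏ e ∈ C \ U, q e ≤ t := by
    intro C hC
    have hpos : (C \ U).card ≠ 0 := by
      by_cases h : Disjoint (supp C) (supp U)
      · rw [hdj C h]
        exact (card_pos_of_mem_cyc (mem_sdiff.1 hC).1).ne'
      · have := hgt C hC h
        omega
    exact (hprod_le _).trans (pow_le_of_le_one ht0 (by linarith) hpos)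
  have hx0 : ∀ C : Finset (Edge n), 0 ≤ ∏ e ∈ C \ U, q e := fun C =>
    prod_nonneg fun e _ => h0 e
  have hsum : ∑ C ∈ cyc n L \ M, ∏ e ∈ C \ U, q e ≤
      ∑ C ∈ cyc n L with Disjoint (supp C) (supp U), ∏ e ∈ C, q e +
        2 ^ (R * L + L) ^ 2 * Real.exp c * t := by
    rw [← sum_filter_add_sum_filter_not (cyc n L \ M) (fun C => Disjoint (supp C) (supp U))]
    refine add_le_add ?_ ?_
    · rw [sum_congr rfl fun C hC => by rw [hdj C (mem_filter.1 hC).2]]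
      refine sum_le_sum_of_subset_of_nonneg (filter_subset_filter _ sdiff_subset)
        fun C _ _ => prod_nonneg fun e _ => h0 e
    · have h := sum_pow_le_of_card_supp (U := supp U) (u := R * L) (L := L) (a := 1)
        (card_supp_biUnion_le hM) ht0 (by linarith : t ≤ 1) htc
        ((cyc n L \ M).filter fun C => ¬ Disjoint (supp C) (supp U)) (fun C => (C \ U).card)
        (fun C hC => (card_le_card sdiff_subset).trans (by
          have hC1 := (mem_sdiff.1 (mem_filter.1 hC).1).1
          rw [card_supp_of_mem_cyc hC1]; exact card_le_of_mem_cyc hC1))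
        (fun C hC => hgt C (mem_filter.1 hC).1 (mem_filter.1 hC).2)
      rw [pow_one] at h
      exact (sum_le_sum fun C _ => hprod_le _).trans h
  calc Real.exp (-((1 + 2 * t) * (∑ C ∈ cyc n L with Disjoint (supp C) (supp U), ∏ e ∈ C, q e +
        2 ^ (R * L + L) ^ 2 * Real.exp c * t)))
      ≤ Real.exp (∑ C ∈ cyc n L \ M, -((1 + 2 * t) * ∏ e ∈ C \ U, q e)) := by
        rw [sum_neg_distrib, ← mul_sum, Real.exp_le_exp, neg_le_neg_iff]
        exact mul_le_mul_of_nonneg_left hsum (by linarith)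
    _ = ∏ C ∈ cyc n L \ M, Real.exp (-((1 + 2 * t) * ∏ e ∈ C \ U, q e)) := Real.exp_sum _ _
    _ ≤ _ := by
        refine prod_le_prod (fun C _ => (Real.exp_pos _).le) fun C hC => ?_
        refine le_trans ?_ (exp_neg_le_one_sub (hx0 C) ((hx C hC).trans ht))
        rw [Real.exp_le_exp, neg_le_neg_iff]
        have h2 := hx C hC
        have h3 := hx0 C
        nlinarith

/-- The mean of `∏ e ∈ C, (1 + s * xi σ e)`. -/
noncomputable def tiltMean (K : ℕ) (s : ℝ) (C : Finset (Edge n)) : ℝ :=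
  avg fun σ : Fin n → Fin K => ∏ e ∈ C, (1 + s * xi σ e)

lemma one_add_mul_xi_mem (hK : 2 ≤ K) {s : ℝ} (hs0 : 0 ≤ s) (hs1 : s ≤ 1) (σ : Fin n → Fin K)
    (e : Edge n) : 0 ≤ 1 + s * xi σ e ∧ 1 + s * xi σ e ≤ 2 := by
  have h := abs_le.1 (abs_xi_le hK σ e)
  constructor <;> nlinarith

lemma tiltMean_nonneg (hK : 2 ≤ K) {s : ℝ} (hs0 : 0 ≤ s) (hs1 : s ≤ 1) (C : Finset (Edge n)) :
    0 ≤ tiltMean K s C :=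
  avg_nonneg fun σ => prod_nonneg fun e _ => (one_add_mul_xi_mem hK hs0 hs1 σ e).1

lemma tiltMean_le (hK : 2 ≤ K) {s : ℝ} (hs0 : 0 ≤ s) (hs1 : s ≤ 1) (C : Finset (Edge n)) :
    tiltMean K s C ≤ 2 ^ C.card := by
  refine le_of_le_of_eq (avg_mono (G := fun _ => 2 ^ C.card) fun σ => ?_) (avg_const (by omega) _)
  rw [← prod_const]
  exact prod_le_prod (fun e _ => (one_add_mul_xi_mem hK hs0 hs1 σ e).1)
    fun e _ => (one_add_mul_xi_mem hK hs0 hs1 σ e).2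

lemma avg_weighted_exp_ge (hK : 2 ≤ K) {s p b x₀ : ℝ} (hs0 : 0 ≤ s) (hs1 : s ≤ 1) (hp : 0 ≤ p)
    (hb : 0 ≤ b) {L : ℕ} {M : Finset (Finset (Edge n))} (hM : VDisj M)
    (hx₀ : ∑ C ∈ cyc n L, p ^ C.card * tiltMean K s C ≤ x₀) :
    p ^ (M.biUnion id).card * (∏ C ∈ M, tiltMean K s C) * Real.exp (-(b * x₀)) ≤
      avg fun σ : Fin n → Fin K => (∏ e ∈ M.biUnion id, (p * (1 + s * xi σ e))) *
        Real.exp (-(b * ∑ C ∈ cyc n L with Disjoint (supp C) (supp (M.biUnion id)),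
          ∏ e ∈ C, (p * (1 + s * xi σ e)))) := by
  set U := M.biUnion id with hU
  set w : (Fin n → Fin K) → ℝ := fun σ => ∏ e ∈ U, (1 + s * xi σ e) with hw
  set X : (Fin n → Fin K) → ℝ := fun σ => ∑ C ∈ cyc n L with Disjoint (supp C) (supp U),
    ∏ e ∈ C, (p * (1 + s * xi σ e)) with hX
  have hw0 : ∀ σ, 0 ≤ w σ := fun σ =>
    prod_nonneg fun e _ => (one_add_mul_xi_mem hK hs0 hs1 σ e).1
  have havgw : avg w = ∏ C ∈ M, tiltMean K s C :=
    avg_prod_biUnion (by omega) (fun x => 1 + s * x) hM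
  have havgwX : avg (fun σ => w σ * X σ) = avg w * avg X := by
    refine avg_mul_of_dependsOn (U := supp U) (W := (supp U)ᶜ) (by omega)
      (dependsOn_prod subset_rfl (fun x => 1 + s * x)) ?_ disjoint_compl_right
    intro σ τ hστ
    refine sum_congr rfl fun C hC => ?_
    refine dependsOn_prod (K := K) (U := (supp U)ᶜ) ?_ (fun x => p * (1 + s * x)) hστ
    intro v hv
    exact mem_compl.2 (disjoint_left.1 (mem_filter.1 hC).2 hv)
  have havgX : avg X ≤ x₀ := by
    refine le_trans ?_ hx₀
    rw [hX, avg_sum]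
    refine le_trans (sum_le_sum fun C _ => le_of_eq ?_) (sum_le_sum_of_subset_of_nonneg
      (filter_subset _ _) fun C _ _ => mul_nonneg (by positivity) (tiltMean_nonneg hK hs0 hs1 C))
    rw [tiltMean, ← avg_const_mul]
    congr 1
    funext σ
    rw [prod_mul_distrib, prod_const]
  have hpt : ∀ σ, p ^ U.card * Real.exp (-(b * x₀)) * ((1 + b * x₀) * w σ - b * (w σ * X σ)) ≤
      (∏ e ∈ U, (p * (1 + s * xi σ e))) * Real.exp (-(b * X σ)) := by
    intro σ
    rw [prod_mul_distrib, prod_const]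
    have h1 := Real.add_one_le_exp (b * x₀ - b * X σ)
    have h2 : Real.exp (-(b * X σ)) = Real.exp (-(b * x₀)) * Real.exp (b * x₀ - b * X σ) := by
      rw [← Real.exp_add]; congr 1; ring
    rw [h2]
    have h3 : 0 ≤ p ^ U.card * Real.exp (-(b * x₀)) * w σ :=
      mul_nonneg (by positivity) (hw0 σ)
    have := mul_le_mul_of_nonneg_left h1 h3
    calc _ = p ^ U.card * Real.exp (-(b * x₀)) * w σ * (b * x₀ - b * X σ + 1) := by ring
      _ ≤ _ := this
      _ = _ := by simp only [hw]; ring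
  refine le_trans ?_ (avg_mono hpt)
  rw [avg_const_mul, avg_sub, avg_const_mul, avg_const_mul, havgwX, ← havgw]
  have hwn : 0 ≤ avg w := avg_nonneg hw0
  have h4 : avg w ≤ (1 + b * x₀) * avg w - b * (avg w * avg X) := by
    have : 0 ≤ b * avg w * (x₀ - avg X) := mul_nonneg (mul_nonneg hb hwn) (by linarith)
    nlinarith
  calc _ = p ^ U.card * Real.exp (-(b * x₀)) * avg w := by ring
    _ ≤ _ := mul_le_mul_of_nonneg_left h4 (by positivity)

lemma avg_cycEvent_prob_ge (hK : 2 ≤ K) {L R : ℕ} {s p c : ℝ} (hs0 : 0 ≤ s) (hs1 : s ≤ 1)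
    (hp0 : 0 ≤ p) (hp : 2 * p ≤ 1 / 5) (hpc : 2 * p * n ≤ c)
    {M : Finset (Finset (Edge n))} (hM : M ∈ fam n L R) :
    (1 - 8 * (2 ^ L ^ 2 * Real.exp c + 2 ^ (R * L + L) ^ 2 * Real.exp c) * p) *
      ((∏ C ∈ M, (p ^ C.card * tiltMean K s C)) *
        Real.exp (-∑ C ∈ cyc n L, p ^ C.card * tiltMean K s C)) ≤
    avg fun σ : Fin n → Fin K =>
      ∑ A : Finset (Edge n), wt (fun e => p * (1 + s * xi σ e)) A * cycEvent L M A := by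
  have hMf := mem_fam.1 hM
  set Λ : ℝ := 2 ^ L ^ 2 * Real.exp c with hΛ
  set κ : ℝ := 2 ^ (R * L + L) ^ 2 * Real.exp c with hκ
  set x₀ : ℝ := ∑ C ∈ cyc n L, p ^ C.card * tiltMean K s C with hx₀
  set b : ℝ := 1 + 2 * (2 * p) with hb
  have hx₀0 : 0 ≤ x₀ :=
    sum_nonneg fun C _ => mul_nonneg (by positivity) (tiltMean_nonneg hK hs0 hs1 C)
  have hx₀Λ : x₀ ≤ Λ := by
    refine le_trans (sum_le_sum fun C _ => ?_)
      (sum_cyc_le (L := L) (by linarith : 0 ≤ 2 * p) (by linarith) hpc)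
    rw [mul_pow, mul_comm]
    exact mul_le_mul_of_nonneg_right (tiltMean_le hK hs0 hs1 C) (by positivity)
  have hpt : ∀ σ : Fin n → Fin K, Real.exp (-(b * (κ * (2 * p)))) *
      ((∏ e ∈ M.biUnion id, (p * (1 + s * xi σ e))) *
        Real.exp (-(b * ∑ C ∈ cyc n L with Disjoint (supp C) (supp (M.biUnion id)),
          ∏ e ∈ C, (p * (1 + s * xi σ e))))) ≤
      ∑ A : Finset (Edge n), wt (fun e => p * (1 + s * xi σ e)) A * cycEvent L M A := by
    intro σ
    have h := cycEvent_prob_ge (q := fun e => p * (1 + s * xi σ e)) (t := 2 * p) (c := c)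
      (fun e => mul_nonneg hp0 (one_add_mul_xi_mem hK hs0 hs1 σ e).1)
      (fun e => by nlinarith [(one_add_mul_xi_mem hK hs0 hs1 σ e).2]) hp (by linarith) hpc hM
    refine le_of_eq_of_le ?_ h
    rw [mul_left_comm, ← Real.exp_add]
    congr 2
    ring
  refine le_trans ?_ (avg_mono hpt)
  rw [avg_const_mul]
  have h1 := avg_weighted_exp_ge hK hs0 hs1 hp0 (by linarith : 0 ≤ b) hMf.2.1 (le_refl x₀)
  refine le_trans ?_ (mul_le_mul_of_nonneg_left h1 (Real.exp_pos _).le)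
  have hcard : p ^ (M.biUnion id).card = ∏ C ∈ M, p ^ C.card := by
    rw [prod_pow_eq_pow_sum]
    congr 1
    exact card_biUnion fun C hC C' hC' hne => hMf.2.1.pairwiseDisjoint hC hC' hne
  rw [hcard, ← prod_mul_distrib]
  have hP0 : 0 ≤ ∏ C ∈ M, (p ^ C.card * tiltMean K s C) :=
    prod_nonneg fun C _ => mul_nonneg (by positivity) (tiltMean_nonneg hK hs0 hs1 C)
  have hκ0 : 0 ≤ κ := by positivity
  have h2 : 1 - 8 * (Λ + κ) * p ≤ Real.exp (-(b * (κ * (2 * p))) - 4 * p * x₀) := by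
    have := Real.add_one_le_exp (-(b * (κ * (2 * p))) - 4 * p * x₀)
    have h3 : b * (κ * (2 * p)) ≤ 4 * (κ * p) := by
      have : 0 ≤ κ * p := by positivity
      nlinarith
    have h4 : p * x₀ ≤ p * Λ := mul_le_mul_of_nonneg_left hx₀Λ hp0
    have h5 : 0 ≤ p * κ := by positivity
    have h6 : 0 ≤ p * Λ := by positivity
    nlinarith
  have h7 : Real.exp (-(b * (κ * (2 * p)))) * Real.exp (-(b * x₀)) =
      Real.exp (-(b * (κ * (2 * p))) - 4 * p * x₀) * Real.exp (-x₀) := by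
    rw [← Real.exp_add, ← Real.exp_add]
    congr 1
    rw [hb]; ring
  calc _ ≤ Real.exp (-(b * (κ * (2 * p))) - 4 * p * x₀) *
        ((∏ C ∈ M, (p ^ C.card * tiltMean K s C)) * Real.exp (-x₀)) :=
        mul_le_mul_of_nonneg_right h2 (mul_nonneg hP0 (Real.exp_pos _).le)
    _ = (∏ C ∈ M, (p ^ C.card * tiltMean K s C)) *
        (Real.exp (-(b * (κ * (2 * p)))) * Real.exp (-(b * x₀))) := by rw [h7]; ring
    _ = _ := by ring

lemma tiltMean_zero (hK : 0 < K) (C : Finset (Edge n)) : tiltMean K 0 C = 1 := by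
  simp [tiltMean, avg_const hK]

lemma tiltMean_one (hK : 2 ≤ K) {C : Finset (Edge n)} (hC : IsCyc C) :
    tiltMean K 1 C = 1 + meanXi K C := by
  have h1 : tiltMean K 1 C = ∑ T ∈ C.powerset, meanXi K T := by
    simp only [tiltMean, meanXi, one_mul]
    rw [← avg_sum]
    congr 1
    funext σ
    exact prod_one_add C
  have hne : (∅ : Finset (Edge n)) ≠ C := hC.1.ne_empty.symm
  have hsub : ({∅, C} : Finset (Finset (Edge n))) ⊆ C.powerset := by
    intro T hT
    rcases mem_insert.1 hT with rfl | hT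
    · exact empty_mem_powerset C
    · rw [mem_singleton.1 hT]; exact mem_powerset_self C
  rw [h1, ← sum_subset hsub, sum_pair hne]
  · congr 1
    simp [meanXi, avg_const (by omega : 0 < K)]
  · intro T hT hT'
    by_cases hl : Leafless T
    · exfalso
      refine hT' ?_
      rcases T.eq_empty_or_nonempty with rfl | hTne
      · exact mem_insert_self _ _
      · exact mem_insert_of_mem (mem_singleton.2 (hC.2.2.2 T (mem_powerset.1 hT) hTne hl))
    · simp only [Leafless, not_forall, not_not] at hl
      obtain ⟨v, hv⟩ := hl
      exact meanXi_eq_zero hK hv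

lemma abs_meanXi_cyc_le (hK : 3 ≤ K) {C : Finset (Edge n)} (hC : IsCyc C) :
    |meanXi K C| ≤ 1 / 2 := by
  obtain ⟨v, hv⟩ := supp_nonempty hC.1
  refine (abs_meanXi_le (by omega) (hC.2.1.deg_eq_two hC.2.2.1 hv)).trans ?_
  have : (3 : ℝ) ≤ K := by exact_mod_cast hK
  exact one_div_le_one_div_of_le (by norm_num) (by linarith)

lemma wt_mul_lik {p r : ℝ} (hr : (1 - p) * r = p) (σ : Fin n → Fin K) (A : Finset (Edge n)) :
    wt (fun _ => p) A * lik r σ A = wt (fun e => p * (1 + 1 * xi σ e)) A := by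
  rw [wt, lik, wt, ← prod_mul_distrib]
  refine prod_congr rfl fun e _ => ?_
  split_ifs
  · ring
  · linear_combination (-xi σ e) * hr

end event

/-- The conditional second moment method: if the second moment of `ℓ` is explained by the
disjoint events with indicators `a M`, then `ℓ` rarely vanishes. -/
theorem sum_zero_le_of_explained_variance {Ω ι : Type*} [Fintype Ω] {μ : Ω → ℝ}
    (hμ : ∀ ω, 0 ≤ μ ω) (hμ1 : ∑ ω, μ ω = 1) (s : Finset ι) {a : ι → Ω → ℝ}
    (ha : ∀ i ω, a i ω = 0 ∨ a i ω = 1)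
    (hdisj : ∀ ω, ∀ i ∈ s, ∀ j ∈ s, a i ω ≠ 0 → a j ω ≠ 0 → i = j)
    {P W u : ι → ℝ} {ℓ : Ω → ℝ} {κ ε₁ ε₂ β w E F η : ℝ}
    (hκ0 : 0 ≤ κ) (hκ1 : κ ≤ 1) (hε₁ : 0 ≤ ε₁) (hη : 0 < η)
    (hP0 : ∀ i ∈ s, 0 ≤ P i) (hW0 : ∀ i ∈ s, 0 < W i) (hWw : ∀ i ∈ s, W i ≤ w)
    (hu0 : ∀ i ∈ s, 0 ≤ u i) (huβ : ∑ i ∈ s, u i ≤ β)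
    (hPa : ∀ i ∈ s, (1 - κ) * P i ≤ ∑ ω, μ ω * a i ω)
    (hQa : ∀ i ∈ s, (1 - κ) * (W i * P i) - u i ≤ ∑ ω, μ ω * (ℓ ω * a i ω))
    (hP1 : 1 - ε₁ ≤ ∑ i ∈ s, P i)
    (hE1 : E - ε₁ ≤ ∑ i ∈ s, W i ^ 2 * P i) (hE2 : ∑ i ∈ s, W i ^ 2 * P i ≤ E)
    (hF : ∑ i ∈ s, P i / W i ≤ F) (hw : 0 ≤ w)
    (hℓ : ∑ ω, μ ω * ℓ ω ^ 2 ≤ E + ε₂) :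
    ∑ ω, μ ω * (if ℓ ω = 0 then 1 else 0) ≤ η * F + 2 * (κ + ε₁) +
      (ε₂ + w ^ 2 * (κ + ε₁) + 2 * κ * E + 2 * ε₁ + 2 * w * β) / η ^ 2 := by
  set pa : ι → ℝ := fun i => ∑ ω, μ ω * a i ω with hpa
  set h : Ω → ℝ := fun ω => ∑ i ∈ s, W i * a i ω with hh
  have ha0 : ∀ i ω, 0 ≤ a i ω := fun i ω => by rcases ha i ω with h | h <;> rw [h]; norm_num
  -- pointwise description of `a`
  have hpt : ∀ ω, (∀ i ∈ s, a i ω = 0) ∨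
      ∃ i ∈ s, a i ω = 1 ∧ ∀ j ∈ s, j ≠ i → a j ω = 0 := by
    intro ω
    by_cases h0 : ∀ i ∈ s, a i ω = 0
    · exact Or.inl h0
    · push Not at h0
      obtain ⟨i, hi, hne⟩ := h0
      refine Or.inr ⟨i, hi, (ha i ω).resolve_left hne, fun j hj hji => ?_⟩
      by_contra h2
      exact hji (hdisj ω j hj i hi h2 hne)
  have hsum : ∀ (f : ι → ℝ) ω i, i ∈ s → a i ω = 1 → (∀ j ∈ s, j ≠ i → a j ω = 0) →
      ∑ j ∈ s, f j * a j ω = f i := by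
    intro f ω i hi h1 h2
    rw [sum_eq_single_of_mem i hi (fun j hj hji => by rw [h2 j hj hji, mul_zero]), h1, mul_one]
  have hsw : ∀ f : ι → ℝ, ∑ ω, μ ω * ∑ i ∈ s, f i * a i ω = ∑ i ∈ s, f i * pa i := by
    intro f
    simp_rw [hpa, mul_sum]
    rw [sum_comm]
    exact sum_congr rfl fun i _ => sum_congr rfl fun ω _ => by ring
  have htot : ∑ i ∈ s, pa i ≤ 1 := by
    have := hsw fun _ => 1
    simp only [one_mul] at this
    rw [← this, ← hμ1]
    refine sum_le_sum fun ω _ => mul_le_of_le_one_right (hμ ω) ?_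
    rcases hpt ω with h0 | ⟨i, hi, h1, h2⟩
    · rw [sum_eq_zero h0]; norm_num
    · have := hsum (fun _ => 1) ω i hi h1 h2
      simp only [one_mul] at this
      exact this.le
  have hlow : (1 - κ) * (1 - ε₁) ≤ (1 - κ) * ∑ i ∈ s, P i :=
    mul_le_mul_of_nonneg_left hP1 (by linarith)
  have hκε : 0 ≤ κ * ε₁ := mul_nonneg hκ0 hε₁
  set x : ι → ℝ := fun i => pa i - (1 - κ) * P i with hx
  have hx0 : ∀ i ∈ s, 0 ≤ x i := fun i hi => sub_nonneg.2 (hPa i hi)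
  have hxs : ∑ i ∈ s, x i ≤ κ + ε₁ := by
    rw [hx, sum_sub_distrib, ← mul_sum]
    nlinarith
  have hpx : ∀ i, pa i = (1 - κ) * P i + x i := fun i => by simp [hx]
  have hsq : ∑ ω, μ ω * h ω ^ 2 ≤ E + w ^ 2 * (κ + ε₁) := by
    have e1 : ∀ ω, h ω ^ 2 = ∑ i ∈ s, W i ^ 2 * a i ω := by
      intro ω
      rcases hpt ω with h0 | ⟨i, hi, h1, h2⟩
      · rw [hh]
        simp only
        rw [sum_eq_zero fun i hi => by rw [h0 i hi, mul_zero],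
          sum_eq_zero fun i hi => by rw [h0 i hi, mul_zero]]
        norm_num
      · rw [hsum _ ω i hi h1 h2, hh]
        simp only
        rw [hsum W ω i hi h1 h2]
    simp_rw [e1]
    rw [hsw]
    calc ∑ i ∈ s, W i ^ 2 * pa i ≤ ∑ i ∈ s, (W i ^ 2 * P i + w ^ 2 * x i) := by
          refine sum_le_sum fun i hi => ?_
          rw [hpx]
          have h1 : W i ^ 2 ≤ w ^ 2 := pow_le_pow_left₀ (hW0 i hi).le (hWw i hi) 2
          have h2 := mul_le_mul_of_nonneg_right h1 (hx0 i hi)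
          have h3 : 0 ≤ κ * (W i ^ 2 * P i) := mul_nonneg hκ0 (mul_nonneg (sq_nonneg _) (hP0 i hi))
          nlinarith
      _ ≤ _ := by
          rw [sum_add_distrib, ← mul_sum]
          exact add_le_add hE2 (mul_le_mul_of_nonneg_left hxs (sq_nonneg _))
  have hcross : E - ε₁ - κ * E - w * β ≤ ∑ ω, μ ω * (ℓ ω * h ω) := by
    have e1 : ∑ ω, μ ω * (ℓ ω * h ω) = ∑ i ∈ s, W i * ∑ ω, μ ω * (ℓ ω * a i ω) := by
      simp_rw [hh, mul_sum]
      rw [sum_comm]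
      exact sum_congr rfl fun i _ => sum_congr rfl fun ω _ => by ring
    rw [e1]
    have h1 : ∑ i ∈ s, ((1 - κ) * (W i ^ 2 * P i) - w * u i) ≤
        ∑ i ∈ s, W i * ∑ ω, μ ω * (ℓ ω * a i ω) := by
      refine sum_le_sum fun i hi => ?_
      have h2 := mul_le_mul_of_nonneg_left (hQa i hi) (hW0 i hi).le
      have h3 := mul_le_mul_of_nonneg_right (hWw i hi) (hu0 i hi)
      nlinarith
    rw [sum_sub_distrib, ← mul_sum, ← mul_sum] at h1
    have h4 := mul_le_mul_of_nonneg_left hE1 (by linarith : 0 ≤ 1 - κ)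
    have h5 := mul_le_mul_of_nonneg_left huβ hw
    nlinarith
  have hvar : ∑ ω, μ ω * (ℓ ω - h ω) ^ 2 ≤
      ε₂ + w ^ 2 * (κ + ε₁) + 2 * κ * E + 2 * ε₁ + 2 * w * β := by
    have e1 : ∑ ω, μ ω * (ℓ ω - h ω) ^ 2 =
        ∑ ω, μ ω * ℓ ω ^ 2 - 2 * ∑ ω, μ ω * (ℓ ω * h ω) + ∑ ω, μ ω * h ω ^ 2 := by
      rw [mul_sum, ← sum_sub_distrib, ← sum_add_distrib]
      exact sum_congr rfl fun ω _ => by ring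
    rw [e1]
    linarith
  have hsmall : ∑ i ∈ s, (if W i < η then 1 else 0) * pa i ≤ η * F + (κ + ε₁) := by
    calc _ ≤ ∑ i ∈ s, (η * (P i / W i) + x i) := by
          refine sum_le_sum fun i hi => ?_
          have h1 : 0 ≤ P i / W i := div_nonneg (hP0 i hi) (hW0 i hi).le
          split_ifs with hlt
          · rw [one_mul, hpx]
            have h2 : W i * (P i / W i) = P i := mul_div_cancel₀ _ (hW0 i hi).ne'
            have h3 := mul_nonneg hκ0 (hP0 i hi)
            nlinarith [mul_le_mul_of_nonneg_right hlt.le h1]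
          · rw [zero_mul]
            exact add_nonneg (mul_nonneg hη.le h1) (hx0 i hi)
      _ ≤ _ := by
          rw [sum_add_distrib, ← mul_sum]
          exact add_le_add (mul_le_mul_of_nonneg_left hF hη.le) hxs
  have hmain : ∀ ω, (if ℓ ω = 0 then (1 : ℝ) else 0) ≤ (1 - ∑ i ∈ s, 1 * a i ω) +
      ∑ i ∈ s, (if W i < η then 1 else 0) * a i ω + (ℓ ω - h ω) ^ 2 / η ^ 2 := by
    intro ω
    have hq : 0 ≤ (ℓ ω - h ω) ^ 2 / η ^ 2 := by positivity
    rcases hpt ω with h0 | ⟨i, hi, h1, h2⟩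
    · rw [sum_eq_zero fun i hi => by rw [h0 i hi, mul_zero],
        sum_eq_zero fun i hi => by rw [h0 i hi, mul_zero]]
      split_ifs <;> linarith
    · rw [hsum _ ω i hi h1 h2, hsum _ ω i hi h1 h2]
      have e : h ω = W i := hsum W ω i hi h1 h2
      by_cases hl : ℓ ω = 0
      · rw [if_pos hl]
        split_ifs with hlt
        · linarith
        · have : 1 ≤ (ℓ ω - h ω) ^ 2 / η ^ 2 := by
            rw [le_div_iff₀ (by positivity), one_mul, hl, zero_sub, neg_sq, e]
            exact pow_le_pow_left₀ hη.le (not_lt.1 hlt) 2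
          linarith
      · rw [if_neg hl]
        split_ifs <;> linarith
  calc _ ≤ ∑ ω, μ ω * ((1 - ∑ i ∈ s, 1 * a i ω) +
      ∑ i ∈ s, (if W i < η then 1 else 0) * a i ω + (ℓ ω - h ω) ^ 2 / η ^ 2) :=
        sum_le_sum fun ω _ => mul_le_mul_of_nonneg_left (hmain ω) (hμ ω)
    _ = (1 - ∑ i ∈ s, 1 * pa i) + ∑ i ∈ s, (if W i < η then 1 else 0) * pa i +
        (∑ ω, μ ω * (ℓ ω - h ω) ^ 2) / η ^ 2 := by
        simp_rw [mul_add, mul_sub, mul_one]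
        rw [sum_add_distrib, sum_add_distrib, sum_sub_distrib, hμ1, hsw, hsw, sum_div]
        simp_rw [mul_div_assoc]
    _ ≤ _ := by
        have h1 : 1 - (κ + ε₁) ≤ ∑ i ∈ s, 1 * pa i := by
          have : ∑ i ∈ s, 1 * pa i = ∑ i ∈ s, x i + (1 - κ) * ∑ i ∈ s, P i := by
            rw [mul_sum, ← sum_add_distrib]
            exact sum_congr rfl fun i _ => by rw [hpx]; ring
          rw [this]
          have := sum_nonneg hx0
          nlinarith
        have h2 := div_le_div_of_nonneg_right hvar (sq_nonneg η)
        linarith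

section conditioning

variable {n K : ℕ}

lemma balLik_eq_zero_of_not_colorable {r : ℝ} {A : Finset (Edge n)}
    (h : ¬ (edgeGraph A).Colorable K) : balLik K r A = 0 := by
  rw [balLik, avg]
  refine div_eq_zero_iff.2 (Or.inl (sum_eq_zero fun σ _ => mul_eq_zero_of_right _ ?_))
  have : ∃ e ∈ A, σ e.1.1 = σ e.1.2 := by
    by_contra hc
    push Not at hc
    exact h ((proper_iff A).2 ⟨σ, hc⟩)
  obtain ⟨e, he, hσ⟩ := this
  refine prod_eq_zero (mem_univ e) ?_
  rw [if_pos he, xi, if_pos hσ]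
  norm_num

/-- The limiting probability that `M` is the family of short cyclic subgraphs. -/
noncomputable def poissonWeight (n L : ℕ) (p : ℝ) (M : Finset (Finset (Edge n))) : ℝ :=
  (∏ C ∈ M, p ^ C.card) * Real.exp (-∑ C ∈ cyc n L, p ^ C.card)

/-- The limiting ratio between the planted and the null probability of the family `M`. -/
noncomputable def tiltWeight (K L : ℕ) (p : ℝ) (M : Finset (Finset (Edge n))) : ℝ :=
  (∏ C ∈ M, (1 + meanXi K C)) * Real.exp (-∑ C ∈ cyc n L, p ^ C.card * meanXi K C)

lemma isCyc_of_mem_cyc {L : ℕ} {C : Finset (Edge n)} (h : C ∈ cyc n L) : IsCyc C :=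
  (mem_cyc.1 h).1

lemma meanXi_bounds (hK : 3 ≤ K) {L : ℕ} {C : Finset (Edge n)} (h : C ∈ cyc n L) :
    -(1 / 2) ≤ meanXi K C ∧ meanXi K C ≤ 1 / 2 :=
  abs_le.1 (abs_meanXi_cyc_le hK (isCyc_of_mem_cyc h))

lemma poissonWeight_nonneg {L : ℕ} {p : ℝ} (hp : 0 ≤ p) (M : Finset (Finset (Edge n))) :
    0 ≤ poissonWeight n L p M :=
  mul_nonneg (prod_nonneg fun _ _ => pow_nonneg hp _) (Real.exp_pos _).le

lemma tiltWeight_pos (hK : 3 ≤ K) {L R : ℕ} {p : ℝ} {M : Finset (Finset (Edge n))}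
    (hM : M ∈ fam n L R) : 0 < tiltWeight K L p M :=
  mul_pos (prod_pos fun C hC => by linarith [(meanXi_bounds hK ((mem_fam.1 hM).1 hC)).1])
    (Real.exp_pos _)

lemma tiltWeight_le (hK : 3 ≤ K) {L R : ℕ} {p c : ℝ} (hp0 : 0 ≤ p) (hp1 : p ≤ 1)
    (hpc : p * n ≤ c) {M : Finset (Finset (Edge n))} (hM : M ∈ fam n L R) :
    tiltWeight K L p M ≤ (3 / 2) ^ R * Real.exp (2 ^ L ^ 2 * Real.exp c) := by
  have hf := mem_fam.1 hM
  refine mul_le_mul ?_ ?_ (Real.exp_pos _).le (by positivity)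
  · calc ∏ C ∈ M, (1 + meanXi K C) ≤ ∏ C ∈ M, (3 / 2 : ℝ) :=
          prod_le_prod (fun C hC => by linarith [(meanXi_bounds hK (hf.1 hC)).1])
            fun C hC => by linarith [(meanXi_bounds hK (hf.1 hC)).2]
      _ = (3 / 2) ^ M.card := prod_const _
      _ ≤ _ := pow_le_pow_right₀ (by norm_num) hf.2.2
  · refine Real.exp_le_exp.2 (le_trans ?_ (sum_cyc_le hp0 hp1 hpc))
    rw [← sum_neg_distrib]
    refine sum_le_sum fun C hC => ?_
    have := (meanXi_bounds hK hC).1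
    have h2 : 0 ≤ p ^ C.card := pow_nonneg hp0 _
    nlinarith

lemma fam_subset_powerset (L R : ℕ) : fam n L R ⊆ (cyc n L).powerset := filter_subset _ _

/-- The error in replacing a sum over bounded disjoint families by an exponential. -/
noncomputable def famError (L R : ℕ) (c p : ℝ) : ℝ :=
  Real.exp (9 / 4 * (2 ^ L ^ 2 * Real.exp c)) * (2 * (9 / 4) ^ 2 * (2 ^ L ^ 2 * Real.exp c) *
    (2 ^ (L + L) ^ 2 * Real.exp c) * p) +
    (1 / 8) ^ R * Real.exp (8 * (9 / 4 * (2 ^ L ^ 2 * Real.exp c)))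

lemma famError_nonneg (L R : ℕ) (c : ℝ) {p : ℝ} (hp : 0 ≤ p) : 0 ≤ famError L R c p := by
  unfold famError; positivity

lemma exp_mul_sum_fam_ge {L R : ℕ} {p c : ℝ} (hp0 : 0 ≤ p) (hp1 : p ≤ 1) (hpc : p * n ≤ c)
    {a : Finset (Edge n) → ℝ} (ha : ∀ C ∈ cyc n L, 0 ≤ a C)
    (haA : ∀ C ∈ cyc n L, a C ≤ 9 / 4 * p ^ C.card) {x : ℝ} (hx : x ≤ 0) :
    Real.exp (x + ∑ C ∈ cyc n L, a C) - famError L R c p ≤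
      Real.exp x * ∑ M ∈ fam n L R, ∏ C ∈ M, a C := by
  have h := fam_lower (R := R) hp0 hp1 hpc ha haA (by norm_num)
  have h1 := mul_le_mul_of_nonneg_left h (Real.exp_pos x).le
  have h2 : Real.exp x * famError L R c p ≤ famError L R c p :=
    mul_le_of_le_one_left (famError_nonneg L R c hp0) (Real.exp_le_one_iff.2 hx)
  refine le_trans ?_ h1
  rw [Real.exp_add]
  unfold famError at *
  linarith

lemma sum_poissonWeight_ge {L R : ℕ} {p c : ℝ} (hp0 : 0 ≤ p) (hp1 : p ≤ 1) (hpc : p * n ≤ c) :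
    1 - famError L R c p ≤ ∑ M ∈ fam n L R, poissonWeight n L p M := by
  have h := exp_mul_sum_fam_ge (n := n) (L := L) (R := R) hp0 hp1 hpc
    (a := fun C => p ^ C.card) (fun C _ => pow_nonneg hp0 _)
    (fun C _ => by have := pow_nonneg hp0 C.card; linarith)
    (x := -∑ C ∈ cyc n L, p ^ C.card) (neg_nonpos.2 (sum_nonneg fun C _ => pow_nonneg hp0 _))
  rw [neg_add_cancel, Real.exp_zero, mul_comm, sum_mul] at h
  exact h

lemma tiltWeight_sq_mul (K L : ℕ) (p : ℝ) (M : Finset (Finset (Edge n))) :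
    tiltWeight K L p M ^ 2 * poissonWeight n L p M =
      Real.exp (-∑ C ∈ cyc n L, p ^ C.card * (1 + 2 * meanXi K C)) *
        ∏ C ∈ M, (p ^ C.card * (1 + meanXi K C) ^ 2) := by
  have : (-∑ C ∈ cyc n L, p ^ C.card * (1 + 2 * meanXi K C)) =
      (-∑ C ∈ cyc n L, p ^ C.card * meanXi K C) + (-∑ C ∈ cyc n L, p ^ C.card * meanXi K C) +
        (-∑ C ∈ cyc n L, p ^ C.card) := by
    rw [← neg_add, ← neg_add, ← sum_add_distrib, ← sum_add_distrib]
    exact congrArg Neg.neg (sum_congr rfl fun C _ => by ring)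
  rw [this, Real.exp_add, Real.exp_add, prod_mul_distrib, prod_pow, tiltWeight, poissonWeight]
  ring

lemma sum_sq_expand (K L : ℕ) (p : ℝ) :
    (-∑ C ∈ cyc n L, p ^ C.card * (1 + 2 * meanXi K C)) +
      ∑ C ∈ cyc n L, p ^ C.card * (1 + meanXi K C) ^ 2 =
      ∑ C ∈ cyc n L, p ^ C.card * meanXi K C ^ 2 := by
  rw [neg_add_eq_sub, ← sum_sub_distrib]
  exact sum_congr rfl fun C _ => by ring

lemma sum_tiltWeight_sq_ge (hK : 3 ≤ K) {L R : ℕ} {p c : ℝ} (hp0 : 0 ≤ p) (hp1 : p ≤ 1)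
    (hpc : p * n ≤ c) :
    Real.exp (∑ C ∈ cyc n L, p ^ C.card * meanXi K C ^ 2) - famError L R c p ≤
      ∑ M ∈ fam n L R, tiltWeight K L p M ^ 2 * poissonWeight n L p M := by
  simp_rw [tiltWeight_sq_mul]
  rw [← mul_sum, ← sum_sq_expand]
  refine exp_mul_sum_fam_ge hp0 hp1 hpc (fun C _ => by positivity) (fun C hC => ?_)
    (neg_nonpos.2 (sum_nonneg fun C hC => mul_nonneg (pow_nonneg hp0 _) ?_))
  · rw [mul_comm]
    refine mul_le_mul_of_nonneg_right ?_ (pow_nonneg hp0 _)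
    have := meanXi_bounds hK hC
    nlinarith
  · linarith [(meanXi_bounds hK hC).1]

lemma sum_tiltWeight_sq_le (K : ℕ) {L R : ℕ} {p : ℝ} (hp0 : 0 ≤ p) :
    ∑ M ∈ fam n L R, tiltWeight K L p M ^ 2 * poissonWeight n L p M ≤
      Real.exp (∑ C ∈ cyc n L, p ^ C.card * meanXi K C ^ 2) := by
  simp_rw [tiltWeight_sq_mul]
  rw [← mul_sum, ← sum_sq_expand, Real.exp_add]
  exact mul_le_mul_of_nonneg_left
    (sum_prod_le_exp (fam_subset_powerset L R) fun C _ => by positivity) (Real.exp_pos _).le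

lemma sum_poissonWeight_div_le (hK : 3 ≤ K) {L R : ℕ} {p : ℝ} (hp0 : 0 ≤ p) :
    ∑ M ∈ fam n L R, poissonWeight n L p M / tiltWeight K L p M ≤
      Real.exp (2 * ∑ C ∈ cyc n L, p ^ C.card * meanXi K C ^ 2) := by
  have e : ∀ M, poissonWeight n L p M / tiltWeight K L p M =
      Real.exp (∑ C ∈ cyc n L, p ^ C.card * (meanXi K C - 1)) *
        ∏ C ∈ M, (p ^ C.card / (1 + meanXi K C)) := by
    intro M
    have : ∑ C ∈ cyc n L, p ^ C.card * (meanXi K C - 1) =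
        (-∑ C ∈ cyc n L, p ^ C.card) - (-∑ C ∈ cyc n L, p ^ C.card * meanXi K C) := by
      rw [neg_sub_neg, ← sum_sub_distrib]
      exact sum_congr rfl fun C _ => by ring
    rw [this, Real.exp_sub, prod_div_distrib, tiltWeight, poissonWeight, mul_div_mul_comm, mul_comm]
  simp_rw [e]
  rw [← mul_sum]
  calc _ ≤ Real.exp (∑ C ∈ cyc n L, p ^ C.card * (meanXi K C - 1)) *
        Real.exp (∑ C ∈ cyc n L, p ^ C.card / (1 + meanXi K C)) :=
        mul_le_mul_of_nonneg_left (sum_prod_le_exp (fam_subset_powerset L R) fun C hC =>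
          div_nonneg (pow_nonneg hp0 _) (by linarith [(meanXi_bounds hK hC).1]))
          (Real.exp_pos _).le
    _ ≤ _ := by
        rw [← Real.exp_add, ← sum_add_distrib, mul_sum]
        refine Real.exp_le_exp.2 (sum_le_sum fun C hC => ?_)
        have h := (meanXi_bounds hK hC).1
        have hpos : 0 < 1 + meanXi K C := by linarith
        have h2 : p ^ C.card * (meanXi K C - 1) + p ^ C.card / (1 + meanXi K C) =
            p ^ C.card * (meanXi K C ^ 2 / (1 + meanXi K C)) := by
          field_simp; ring
        rw [h2, mul_left_comm]
        refine mul_le_mul_of_nonneg_left ?_ (pow_nonneg hp0 _)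
        rw [div_le_iff₀ hpos]
        nlinarith [sq_nonneg (meanXi K C)]

/-- The loss in the lower bounds for the probabilities of the cycle events. -/
noncomputable def cycLoss (L R : ℕ) (c p : ℝ) : ℝ :=
  8 * (2 ^ L ^ 2 * Real.exp c + 2 ^ (R * L + L) ^ 2 * Real.exp c) * p

lemma cycEvent_null_ge (hK : 2 ≤ K) {L R : ℕ} {p c : ℝ} (hp0 : 0 ≤ p) (hp : 2 * p ≤ 1 / 5)
    (hpc : 2 * p * n ≤ c) {M : Finset (Finset (Edge n))} (hM : M ∈ fam n L R) :
    (1 - cycLoss L R c p) * poissonWeight n L p M ≤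
      ∑ A : Finset (Edge n), wt (fun _ => p) A * cycEvent L M A := by
  have h := avg_cycEvent_prob_ge hK le_rfl zero_le_one hp0 hp hpc hM
  simp only [zero_mul, add_zero, mul_one, tiltMean_zero (show 0 < K by omega)] at h
  rwa [avg_const (by omega)] at h

lemma cycEvent_planted_ge (hK : 2 ≤ K) {L R : ℕ} {p r c : ℝ} (hp0 : 0 ≤ p) (hp : 2 * p ≤ 1 / 5)
    (hpc : 2 * p * n ≤ c) (hr : (1 - p) * r = p) {M : Finset (Finset (Edge n))}
    (hM : M ∈ fam n L R) :
    (1 - cycLoss L R c p) * (tiltWeight K L p M * poissonWeight n L p M) -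
      avg (fun σ : Fin n → Fin K => (if Balanced σ then 0 else 1) *
        ∑ A, wt (fun e => p * (1 + 1 * xi σ e)) A * cycEvent L M A) ≤
      ∑ A : Finset (Edge n), wt (fun _ => p) A * (balLik K r A * cycEvent L M A) := by
  have h := avg_cycEvent_prob_ge hK zero_le_one le_rfl hp0 hp hpc hM
  have hf := mem_fam.1 hM
  have e1 : (∏ C ∈ M, (p ^ C.card * tiltMean K 1 C)) *
      Real.exp (-∑ C ∈ cyc n L, p ^ C.card * tiltMean K 1 C) =
      tiltWeight K L p M * poissonWeight n L p M := by
    rw [prod_congr rfl fun C hC => by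
        rw [tiltMean_one hK (isCyc_of_mem_cyc (hf.1 hC))],
      sum_congr rfl fun C hC => by rw [tiltMean_one hK (isCyc_of_mem_cyc hC), mul_add, mul_one],
      sum_add_distrib, neg_add, Real.exp_add, prod_mul_distrib, tiltWeight, poissonWeight]
    ring
  rw [e1] at h
  have e2 : ∑ A : Finset (Edge n), wt (fun _ => p) A * (balLik K r A * cycEvent L M A) =
      avg (fun σ : Fin n → Fin K => ∑ A, wt (fun e => p * (1 + 1 * xi σ e)) A * cycEvent L M A) -
      avg (fun σ : Fin n → Fin K => (if Balanced σ then 0 else 1) *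
        ∑ A, wt (fun e => p * (1 + 1 * xi σ e)) A * cycEvent L M A) := by
    rw [← avg_sub]
    simp_rw [balLik, ← avg_mul_const, ← avg_const_mul]
    rw [← avg_sum]
    refine congrArg avg (funext fun σ => ?_)
    rw [mul_sum, ← sum_sub_distrib]
    refine sum_congr rfl fun A _ => ?_
    rw [← wt_mul_lik hr]
    split_ifs <;> ring
  rw [e2]
  exact sub_le_sub_right h _

lemma sum_cycEvent_le_one {L R : ℕ} (A : Finset (Edge n)) :
    ∑ M ∈ fam n L R, cycEvent L M A ≤ 1 := by
  by_cases h : (cyc n L).filter (· ⊆ A) ∈ fam n L R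
  · rw [sum_eq_single_of_mem _ h fun M hM hne => ?_]
    · rcases cycEvent_eq_zero_or_one L ((cyc n L).filter (· ⊆ A)) A with h | h <;> rw [h]
      norm_num
    · by_contra hc
      exact hne (eq_filter_of_cycEvent (mem_fam.1 hM).1 hc)
  · rw [sum_eq_zero fun M hM => ?_]
    · norm_num
    · by_contra hc
      exact h (eq_filter_of_cycEvent (mem_fam.1 hM).1 hc ▸ hM)

lemma planted_weight_mem (hK : 3 ≤ K) {p : ℝ} (hp0 : 0 ≤ p) (hp : 2 * p ≤ 1)
    (σ : Fin n → Fin K) (e : Edge n) :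
    0 ≤ p * (1 + 1 * xi σ e) ∧ p * (1 + 1 * xi σ e) ≤ 1 := by
  have h := one_add_mul_xi_mem (show 2 ≤ K by omega) zero_le_one le_rfl σ e
  exact ⟨mul_nonneg hp0 h.1, by nlinarith⟩

/-- The non-colourability probability in terms of the second moment of the likelihood ratio. -/
theorem prob_not_colorable_le (hK : 3 ≤ K) {L R : ℕ} {p r c ε₂ η : ℝ} (hp0 : 0 ≤ p)
    (hp : 2 * p ≤ 1 / 5) (hpc : 2 * p * n ≤ c) (hr : (1 - p) * r = p) (hη : 0 < η)
    (hκ : cycLoss L R c p ≤ 1)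
    (hℓ : ∑ A : Finset (Edge n), wt (fun _ => p) A * balLik K r A ^ 2 ≤
      Real.exp (∑ C ∈ cyc n L, p ^ C.card * meanXi K C ^ 2) + ε₂) :
    ∑ A : Finset (Edge n), wt (fun _ => p) A * (if (edgeGraph A).Colorable K then 0 else 1) ≤
      η * Real.exp (2 * ∑ C ∈ cyc n L, p ^ C.card * meanXi K C ^ 2) +
      2 * (cycLoss L R c p + famError L R c p) +
      (ε₂ + ((3 / 2) ^ R * Real.exp (2 ^ L ^ 2 * Real.exp c)) ^ 2 *
          (cycLoss L R c p + famError L R c p) +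
        2 * cycLoss L R c p * Real.exp (∑ C ∈ cyc n L, p ^ C.card * meanXi K C ^ 2) +
        2 * famError L R c p +
        2 * ((3 / 2) ^ R * Real.exp (2 ^ L ^ 2 * Real.exp c)) * unbal n K) / η ^ 2 := by
  have hpn : p * n ≤ c := by
    have : 0 ≤ p * n := by positivity
    linarith
  have hp1 : p ≤ 1 := by linarith
  have h0 : ∀ A : Finset (Edge n), 0 ≤ wt (fun _ => p) A :=
    fun A => wt_nonneg (fun _ => hp0) (fun _ => hp1) A
  refine (sum_le_sum fun A _ => mul_le_mul_of_nonneg_left ?_ (h0 A)).trans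
    (sum_zero_le_of_explained_variance h0 (sum_wt _) (fam n L R)
      (a := fun M A => cycEvent L M A) (fun M A => cycEvent_eq_zero_or_one L M A) ?_
      (P := poissonWeight n L p) (W := tiltWeight K L p)
      (u := fun M => avg (fun σ : Fin n → Fin K => (if Balanced σ then 0 else 1) *
        ∑ A, wt (fun e => p * (1 + 1 * xi σ e)) A * cycEvent L M A))
      (ℓ := balLik K r) (by unfold cycLoss; positivity) hκ (famError_nonneg L R c hp0) hη
      (fun M _ => poissonWeight_nonneg hp0 M) (fun M hM => tiltWeight_pos hK hM)
      (fun M hM => tiltWeight_le hK hp0 hp1 hpn hM) ?_ ?_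
      (fun M hM => cycEvent_null_ge (by omega : 2 ≤ K) hp0 hp hpc hM)
      (fun M hM => cycEvent_planted_ge (by omega) hp0 hp hpc hr hM)
      (sum_poissonWeight_ge hp0 hp1 hpn) (sum_tiltWeight_sq_ge hK hp0 hp1 hpn)
      (sum_tiltWeight_sq_le K hp0) (sum_poissonWeight_div_le hK hp0) (by positivity) hℓ)
  · split_ifs with h1 h2 h2
    · norm_num
    · norm_num
    · norm_num
    · exact absurd (balLik_eq_zero_of_not_colorable h1) h2
  · intro A M hM M' hM' h1 h2
    rw [eq_filter_of_cycEvent (mem_fam.1 hM).1 h1, eq_filter_of_cycEvent (mem_fam.1 hM').1 h2]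
  · intro M _
    refine avg_nonneg fun σ => mul_nonneg (by split_ifs <;> norm_num) (sum_nonneg fun A _ =>
      mul_nonneg (wt_nonneg ?_ ?_ A) (cycEvent_nonneg L M A))
    · exact fun e => (planted_weight_mem hK hp0 (by linarith) σ e).1
    · exact fun e => (planted_weight_mem hK hp0 (by linarith) σ e).2
  · rw [← avg_sum, unbal]
    refine avg_mono fun σ => ?_
    rw [← mul_sum]
    refine mul_le_of_le_one_right (by split_ifs <;> norm_num) ?_
    rw [sum_comm]
    simp_rw [← mul_sum]
    refine le_of_le_of_eq (sum_le_sum fun A _ => mul_le_of_le_one_right (wt_nonneg ?_ ?_ A)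
      (sum_cycEvent_le_one A)) (sum_wt _)
    · exact fun e => (planted_weight_mem hK hp0 (by linarith) σ e).1
    · exact fun e => (planted_weight_mem hK hp0 (by linarith) σ e).2

end conditioning

lemma tendsto_pow_mul_unbal {K : ℕ} (hK : 3 ≤ K) (m : ℕ) :
    Tendsto (fun n : ℕ => (n : ℝ) ^ m * unbal n K) atTop (nhds 0) := by
  have hK' : (3 : ℝ) ≤ K := by exact_mod_cast hK
  set a : ℝ := (1 / ((K : ℝ) * ((K : ℝ) - 2))) ^ 2 / (4 * K) with ha
  have hapos : 0 < a := by
    have : 0 < (K : ℝ) * ((K : ℝ) - 2) := by nlinarith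
    positivity
  have h := (tendsto_pow_const_mul_const_pow_of_abs_lt_one m (r := Real.exp (-a)) (by
    rw [abs_of_pos (Real.exp_pos _)]; rw [Real.exp_lt_one_iff]; linarith)).const_mul (K : ℝ)
  rw [mul_zero] at h
  refine squeeze_zero (fun n => mul_nonneg (by positivity) unbal_nonneg) (fun n => ?_) h
  have h1 := unbal_le (n := n) hK
  have h2 : Real.exp (-a * n) = Real.exp (-a) ^ n := by
    rw [← Real.exp_nat_mul, mul_comm]
  rw [← ha, h2] at h1
  calc (n : ℝ) ^ m * unbal n K ≤ (n : ℝ) ^ m * (K * Real.exp (-a) ^ n) :=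
        mul_le_mul_of_nonneg_left h1 (by positivity)
    _ = _ := by ring

lemma exp_sub_exp_le (x y : ℝ) : Real.exp x - Real.exp y ≤ Real.exp x * (x - y) := by
  have h := Real.add_one_le_exp (y - x)
  have h2 : Real.exp y = Real.exp x * Real.exp (y - x) := by rw [← Real.exp_add]; ring_nf
  rw [h2]
  nlinarith [Real.exp_pos x]

section fixed

variable {n K L : ℕ} {p r D c C ρ : ℝ}

lemma sum_cyc_odds_sub_le (hK : 2 ≤ K) (hp0 : 0 ≤ p) (hp1 : p < 1) (hr : (1 - p) * r = p)
    (hr0 : 0 ≤ r) (hr1 : r ≤ 1) (hrc : r * n ≤ c) :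
    ∑ C ∈ cyc n L, r ^ C.card * meanXi K C ^ 2 - ∑ C ∈ cyc n L, p ^ C.card * meanXi K C ^ 2 ≤
      2 ^ L ^ 2 * Real.exp c * (L * p) := by
  rw [← sum_sub_distrib]
  calc _ ≤ ∑ C ∈ cyc n L, r ^ C.card * (L * p) := by
        refine sum_le_sum fun C hC => ?_
        have h1 : p ^ C.card = r ^ C.card * (1 - p) ^ C.card := by
          rw [← mul_pow, mul_comm r, hr]
        have h2 : 1 - C.card * p ≤ (1 - p) ^ C.card := by
          have := one_add_mul_le_pow (a := -p) (by linarith) C.card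
          rw [← sub_eq_add_neg] at this
          linarith
        have h3 : (C.card : ℝ) * p ≤ L * p :=
          mul_le_mul_of_nonneg_right (by exact_mod_cast card_le_of_mem_cyc hC) hp0
        have h4 : meanXi K C ^ 2 ≤ 1 := by
          rw [sq_le_one_iff_abs_le_one]
          exact abs_meanXi_le_one hK C
        rw [h1, ← sub_mul, ← mul_one_sub, mul_assoc]
        refine mul_le_mul_of_nonneg_left ?_ (pow_nonneg hr0 _)
        have h5 : 0 ≤ 1 - (1 - p) ^ C.card :=
          sub_nonneg.2 (pow_le_one₀ (by linarith) (by linarith))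
        nlinarith [sq_nonneg (meanXi K C)]
    _ ≤ _ := by
        rw [← sum_mul]
        exact mul_le_mul_of_nonneg_right (sum_cyc_le hr0 hr1 hrc) (by positivity)

/-- The second moment of the balanced likelihood ratio exceeds the contribution of the short
cyclic subgraphs by little. -/
lemma second_moment_le (hK : 3 ≤ K) (hn : 1 ≤ n) (hp0 : 0 ≤ p) (hp1 : p < 1)
    (hr : (1 - p) * r = p) (hr0 : 0 ≤ r) (hD0 : 0 ≤ D) (hρ0 : 0 ≤ ρ) (hρ1 : ρ ≤ 1)
    (hrD : r ≤ ρ * (D / n)) (hD1 : D / n ≤ 1)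
    (hC : ∑ S : Finset (Edge n), (D / n) ^ S.card * balMeanXi K S ^ 2 ≤ C)
    (hβ : 2 * unbal n K * (2 ^ L ^ 2 * Real.exp D) ≤ 1) :
    ∑ C ∈ cyc n L, p ^ C.card * meanXi K C ^ 2 ≤ C + 1 ∧
    ∑ A : Finset (Edge n), wt (fun _ => p) A * balLik K r A ^ 2 ≤
      Real.exp (∑ C ∈ cyc n L, p ^ C.card * meanXi K C ^ 2) +
      (Real.exp (C + 1) * (2 ^ L ^ 2 * Real.exp D * (L * p)) + 2 ^ L ^ 2 * Real.exp D * r +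
        2 * unbal n K * (Real.exp 1 * (n : ℝ) ^ (2 * L)) + ρ ^ L * C) := by
  have hn' : (0 : ℝ) < n := by exact_mod_cast hn
  have hDn : 0 ≤ D / n := by positivity
  have hrD' : r ≤ D / n := hrD.trans (mul_le_of_le_one_left hDn hρ1)
  have hr1 : r ≤ 1 := hrD'.trans hD1
  have hrc : r * n ≤ D := by
    rwa [le_div_iff₀ hn'] at hrD'
  have hTr : ∑ C ∈ cyc n L, r ^ C.card * meanXi K C ^ 2 ≤ C + 1 := by
    refine (sum_cyc_meanXi_le (by omega) L hr0 hr1 hrc).trans (add_le_add (le_trans ?_ hC) hβ)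
    exact sum_le_sum fun S _ => mul_le_mul_of_nonneg_right
      (pow_le_pow_left₀ hr0 hrD' _) (sq_nonneg _)
  have hpr : p ≤ r := by nlinarith
  have hTp : ∑ C ∈ cyc n L, p ^ C.card * meanXi K C ^ 2 ≤
      ∑ C ∈ cyc n L, r ^ C.card * meanXi K C ^ 2 :=
    sum_le_sum fun S _ => mul_le_mul_of_nonneg_right (pow_le_pow_left₀ hp0 hpr _) (sq_nonneg _)
  refine ⟨hTp.trans hTr, ?_⟩
  rw [second_moment_eq hr, ← sum_filter_add_sum_filter_not _ (fun S => S.card ≤ L)]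
  have h1 := sum_small_le (K := K) (by omega) hn L hr0 hr1 hrc
  have h2 := sum_large_le (n := n) (K := K) L hr0 hDn hρ0 hρ1 hrD
  have h3 := mul_le_mul_of_nonneg_left hC (pow_nonneg hρ0 L)
  have h4 := exp_sub_exp_le (∑ C ∈ cyc n L, r ^ C.card * meanXi K C ^ 2)
    (∑ C ∈ cyc n L, p ^ C.card * meanXi K C ^ 2)
  have h5 := mul_le_mul (Real.exp_le_exp.2 hTr)
    (sum_cyc_odds_sub_le (K := K) (L := L) (by omega) hp0 hp1 hr hr0 hr1 hrc) (by linarith)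
    (Real.exp_pos _).le
  linarith

end fixed

/-- The error bound in the second moment argument for fixed parameters. -/
noncomputable def errorBound (C ρ D η : ℝ) (L R : ℕ) (p r β β' : ℝ) : ℝ :=
  η * Real.exp (2 * (C + 1)) + 2 * (cycLoss L R (2 * D) p + famError L R (2 * D) p) +
    ((Real.exp (C + 1) * (2 ^ L ^ 2 * Real.exp D * (L * p)) + 2 ^ L ^ 2 * Real.exp D * r +
        2 * (Real.exp 1 * β') + ρ ^ L * C) +
      ((3 / 2) ^ R * Real.exp (2 ^ L ^ 2 * Real.exp (2 * D))) ^ 2 *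
          (cycLoss L R (2 * D) p + famError L R (2 * D) p) +
        2 * cycLoss L R (2 * D) p * Real.exp (C + 1) +
        2 * famError L R (2 * D) p +
        2 * ((3 / 2) ^ R * Real.exp (2 ^ L ^ 2 * Real.exp (2 * D))) * β) / η ^ 2

lemma errorBound_zero (C ρ D η : ℝ) (L R : ℕ) :
    errorBound C ρ D η L R 0 0 0 0 = η * Real.exp (2 * (C + 1)) + ρ ^ L * C / η ^ 2 +
      ((1 / 8) ^ R * (2 * Real.exp (8 * (9 / 4 * (2 ^ L ^ 2 * Real.exp (2 * D)))) * (1 + 1 / η ^ 2))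
      + (9 / 32) ^ R * (Real.exp (8 * (9 / 4 * (2 ^ L ^ 2 * Real.exp (2 * D)))) *
        Real.exp (2 ^ L ^ 2 * Real.exp (2 * D)) ^ 2 / η ^ 2)) := by
  have : ((9 : ℝ) / 32) ^ R = ((3 / 2) ^ R) ^ 2 * (1 / 8) ^ R := by
    rw [← pow_mul, mul_comm R, pow_mul, ← mul_pow]; norm_num
  rw [errorBound, cycLoss, famError, this]
  ring

lemma tendsto_errorBound (C ρ D η : ℝ) (L R : ℕ) {p r β β' : ℕ → ℝ}
    (hp : Tendsto p atTop (nhds 0)) (hr : Tendsto r atTop (nhds 0))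
    (hβ : Tendsto β atTop (nhds 0)) (hβ' : Tendsto β' atTop (nhds 0)) :
    Tendsto (fun n => errorBound C ρ D η L R (p n) (r n) (β n) (β' n)) atTop
      (nhds (errorBound C ρ D η L R 0 0 0 0)) := by
  have hc : Continuous fun x : ℝ × ℝ × ℝ × ℝ =>
      errorBound C ρ D η L R x.1 x.2.1 x.2.2.1 x.2.2.2 := by
    unfold errorBound cycLoss famError
    fun_prop
  exact (hc.tendsto (0, 0, 0, 0)).comp
    (hp.prodMk_nhds (hr.prodMk_nhds (hβ.prodMk_nhds hβ')))

lemma exists_errorBound_lt {C ρ : ℝ} (hρ0 : 0 ≤ ρ) (hρ1 : ρ < 1) (D : ℝ) {ε : ℝ} (hε : 0 < ε) :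
    ∃ η > 0, ∃ L R : ℕ, errorBound C ρ D η L R 0 0 0 0 < ε := by
  set F := Real.exp (2 * (C + 1)) with hF
  have hFpos : 0 < F := Real.exp_pos _
  set η := ε / (4 * F) with hη
  have hηpos : 0 < η := by positivity
  have hL : Tendsto (fun L : ℕ => ρ ^ L * C / η ^ 2) atTop (nhds 0) := by
    have := ((tendsto_pow_atTop_nhds_zero_of_lt_one hρ0 hρ1).mul_const C).div_const (η ^ 2)
    simpa using this
  obtain ⟨L, hL⟩ := (hL.eventually (gt_mem_nhds (show 0 < ε / 4 by positivity))).exists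
  have hR : ∀ a b : ℝ, Tendsto (fun R : ℕ => (1 / 8 : ℝ) ^ R * a + (9 / 32) ^ R * b) atTop
      (nhds 0) := by
    intro a b
    have h1 := (tendsto_pow_atTop_nhds_zero_of_lt_one (by norm_num : (0 : ℝ) ≤ 1 / 8)
      (by norm_num)).mul_const a
    have h2 := (tendsto_pow_atTop_nhds_zero_of_lt_one (by norm_num : (0 : ℝ) ≤ 9 / 32)
      (by norm_num)).mul_const b
    simpa using h1.add h2
  obtain ⟨R, hR⟩ := ((hR (2 * Real.exp (8 * (9 / 4 * (2 ^ L ^ 2 * Real.exp (2 * D)))) *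
    (1 + 1 / η ^ 2)) (Real.exp (8 * (9 / 4 * (2 ^ L ^ 2 * Real.exp (2 * D)))) *
        Real.exp (2 ^ L ^ 2 * Real.exp (2 * D)) ^ 2 / η ^ 2)).eventually
          (gt_mem_nhds (show 0 < ε / 4 by positivity))).exists
  refine ⟨η, hηpos, L, R, ?_⟩
  rw [errorBound_zero]
  have : η * F = ε / 4 := by rw [hη]; field_simp
  linarith

/-- Below the second moment threshold, `G(n, d/n)` is `K`-colourable w.h.p. -/
theorem tendsto_prob_not_colorable_zero {d : ℝ} {K : ℕ} (hd : 0 < d) (hK : 3 ≤ K)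
    (h : d < 2 * ((K : ℝ) - 1) * Real.log ((K : ℝ) - 1)) :
    Tendsto (fun n : ℕ => ∑ A : Finset (Edge n), wt (fun _ => d / n) A *
      (if (edgeGraph A).Colorable K then 0 else 1)) atTop (nhds 0) := by
  obtain ⟨D, hdD, hD⟩ := exists_between h
  have hD0 : 0 < D := hd.trans hdD
  obtain ⟨C, hC0, hC⟩ := exists_sum_le hK hD0.le hD
  obtain ⟨d', hdd', hd'D⟩ := exists_between hdD
  set ρ := d' / D with hρ
  have hρ0 : 0 ≤ ρ := div_nonneg (hd.trans hdd').le hD0.le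
  have hρ1 : ρ < 1 := (div_lt_one hD0).2 hd'D
  have hp : Tendsto (fun n : ℕ => d / n) atTop (nhds 0) := tendsto_const_div_atTop_nhds_zero_nat d
  have hDn : Tendsto (fun n : ℕ => D / n) atTop (nhds 0) := tendsto_const_div_atTop_nhds_zero_nat D
  have hr : Tendsto (fun n : ℕ => d / n / (1 - d / n)) atTop (nhds 0) := by
    have := hp.div (hp.const_sub 1) (by norm_num)
    rw [zero_div] at this
    exact this
  have hβ : Tendsto (fun n : ℕ => unbal n K) atTop (nhds 0) := by
    simpa using tendsto_pow_mul_unbal hK 0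
  have hpos : ∀ n : ℕ, 0 ≤ d / (n : ℝ) := fun n => by positivity
  refine tendsto_order.2 ⟨fun b hb => ?_, fun ε hε => ?_⟩
  · filter_upwards [hp.eventually (gt_mem_nhds (show (0 : ℝ) < 1 by norm_num))] with n hn
    refine hb.trans_le (sum_nonneg fun A _ => mul_nonneg
      (wt_nonneg (fun _ => hpos n) (fun _ => hn.le) A) ?_)
    split_ifs <;> norm_num
  obtain ⟨η, hη, L, R, hlt⟩ := exists_errorBound_lt (C := C) hρ0 hρ1 D hε
  have hlim := tendsto_errorBound C ρ D η L R hp hr hβ (tendsto_pow_mul_unbal hK (2 * L))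
  have hcyc : Tendsto (fun n : ℕ => cycLoss L R (2 * D) (d / n)) atTop (nhds 0) := by
    simpa [cycLoss] using hp.const_mul
      (8 * (2 ^ L ^ 2 * Real.exp (2 * D) + 2 ^ (R * L + L) ^ 2 * Real.exp (2 * D)))
  have hub : Tendsto (fun n : ℕ => 2 * unbal n K * (2 ^ L ^ 2 * Real.exp D)) atTop (nhds 0) := by
    simpa using (hβ.const_mul 2).mul_const (2 ^ L ^ 2 * Real.exp D)
  filter_upwards [hlim.eventually (gt_mem_nhds hlt),
    hcyc.eventually (gt_mem_nhds (show (0 : ℝ) < 1 by norm_num)),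
    hub.eventually (gt_mem_nhds (show (0 : ℝ) < 1 by norm_num)),
    hDn.eventually (gt_mem_nhds (show (0 : ℝ) < 1 by norm_num)),
    hp.eventually (gt_mem_nhds (show (0 : ℝ) < 1 / 10 by norm_num)),
    hp.eventually (gt_mem_nhds (show (0 : ℝ) < 1 - d / d' from
      sub_pos.2 ((div_lt_one (hd.trans hdd')).2 hdd'))), eventually_ge_atTop 1]
    with n h1 h2 h3 h4 h5 h6 hn
  have hn' : (0 : ℝ) < n := by exact_mod_cast hn
  set p := d / (n : ℝ) with hpdef
  have hp0 : 0 ≤ p := hpos n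
  have h1p : 0 < 1 - p := by linarith
  set r := p / (1 - p) with hrdef
  have hr0 : 0 ≤ r := by positivity
  have hreq : (1 - p) * r = p := mul_div_cancel₀ _ h1p.ne'
  have hd'pos : 0 < d' := hd.trans hdd'
  have hrD : r ≤ ρ * (D / n) := by
    have e : ρ * (D / n) = d' / n := by rw [hρ]; field_simp
    rw [e, hrdef, div_le_iff₀ h1p]
    have h7 : d / d' ≤ 1 - p := by linarith
    have h8 := mul_le_mul_of_nonneg_left h7 (show 0 ≤ d' / (n : ℝ) by positivity)
    refine le_trans (le_of_eq ?_) h8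
    rw [hpdef]; field_simp
  obtain ⟨hT, hS⟩ := second_moment_le (L := L) hK hn hp0 (by linarith) hreq hr0 hD0.le hρ0 hρ1.le
    hrD h4.le (hC n h4.le) h3.le
  have hpn : p * n = d := div_mul_cancel₀ _ hn'.ne'
  have hmain := prob_not_colorable_le (R := R) (c := 2 * D) (η := η) hK hp0 (by linarith)
    (by rw [mul_assoc, hpn]; linarith) hreq hη h2.le hS
  refine lt_of_le_of_lt (hmain.trans ?_) h1
  have hκ0 : 0 ≤ cycLoss L R (2 * D) p := by unfold cycLoss; positivity
  unfold errorBound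
  refine add_le_add (add_le_add_left (mul_le_mul_of_nonneg_left
    (Real.exp_le_exp.2 (by linarith)) hη.le) _) (div_le_div_of_nonneg_right ?_ (sq_nonneg η))
  have := mul_le_mul_of_nonneg_left (Real.exp_le_exp.2 hT)
    (show 0 ≤ 2 * cycLoss L R (2 * D) p by linarith)
  have e : 2 * unbal n K * (Real.exp 1 * (n : ℝ) ^ (2 * L)) =
    2 * (Real.exp 1 * ((n : ℝ) ^ (2 * L) * unbal n K)) := by ring
  rw [e]
  linarith

lemma chromaticNumber_eq_or {V : Type*} (G : SimpleGraph V) {k : ℕ}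
    (h1 : ¬ G.Colorable (k - 1)) (h2 : G.Colorable (k + 1)) :
    G.chromaticNumber = (k : ℕ∞) ∨ G.chromaticNumber = (k : ℕ∞) + 1 := by
  have hle : G.chromaticNumber ≤ ((k + 1 : ℕ) : ℕ∞) := h2.chromaticNumber_le
  obtain ⟨m, hm⟩ := ENat.ne_top_iff_exists.1 (ne_top_of_le_ne_top (ENat.natCast_ne_top _) hle)
  rw [← hm] at hle ⊢
  have hcol : G.Colorable m := SimpleGraph.chromaticNumber_le_iff_colorable.1 hm.ge
  have hlt : ¬ m ≤ k - 1 := fun h => h1 (hcol.mono h)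
  have hle' : m ≤ k + 1 := by exact_mod_cast hle
  rcases (show m = k ∨ m = k + 1 by omega) with rfl | rfl
  · exact Or.inl rfl
  · exact Or.inr (by push_cast; rfl)

end RandomColoring

open RandomColoring in
/-- For every real `d > 0`, if `k` is the smallest integer with `d < 2 k log k`, then
w.h.p. the chromatic number of `G(n, d/n)` lies in `{k, k+1}`. -/
theorem chromatic_number_two_values (d : ℝ) (hd : 0 < d) (k : ℕ)
    (hk : d < 2 * k * Real.log k)
    (hmin : ∀ j : ℕ, j < k → ¬ (d < 2 * j * Real.log j)) :
    Tendsto (fun n : ℕ =>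
        erdosRenyiProb n (d / n) (fun G =>
          G.chromaticNumber = (k : ℕ∞) ∨ G.chromaticNumber = (k : ℕ∞) + 1))
      atTop (nhds 1) := by
  have hk2 : 2 ≤ k := by
    by_contra hlt
    rcases (show k = 0 ∨ k = 1 by omega) with rfl | rfl <;> simp at hk <;> linarith
  have hlow := tendsto_prob_colorable_zero hd (show 0 < k - 1 by omega)
    (not_lt.1 (hmin (k - 1) (by omega)))
  have hupp := tendsto_prob_not_colorable_zero (K := k + 1) hd (by omega)
    (by push_cast; rwa [add_sub_cancel_right])
  have hlim := (hlow.add hupp).const_sub 1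
  rw [add_zero, sub_zero] at hlim
  have hp : Tendsto (fun n : ℕ => d / n) atTop (nhds 0) := tendsto_const_div_atTop_nhds_zero_nat d
  have hsmall := hp.eventually (gt_mem_nhds (show (0 : ℝ) < 1 by norm_num))
  refine tendsto_of_tendsto_of_tendsto_of_le_of_le' hlim tendsto_const_nhds ?_ ?_
  · filter_upwards [hsmall] with n hn
    have h0 : ∀ A : Finset (Edge n), 0 ≤ wt (fun _ => d / (n : ℝ)) A :=
      fun A => wt_nonneg (fun _ => by positivity) (fun _ => hn.le) A
    rw [erdosRenyiProb_eq, sub_le_iff_le_add, ← sum_add_distrib, ← sum_add_distrib]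
    refine le_of_eq_of_le (sum_wt (fun _ : Edge n => d / (n : ℝ))).symm
      (sum_le_sum fun A _ => ?_)
    rw [← mul_add, ← mul_add]
    refine le_mul_of_one_le_right (h0 A) ?_
    by_cases h1 : (edgeGraph A).Colorable (k - 1)
    · rw [if_pos h1, if_pos (h1.mono (by omega))]
      split_ifs <;> norm_num
    · by_cases h2 : (edgeGraph A).Colorable (k + 1)
      · rw [if_neg h1, if_pos h2, if_pos (chromaticNumber_eq_or _ h1 h2)]
        norm_num
      · rw [if_neg h1, if_neg h2]
        split_ifs <;> norm_num
  · filter_upwards [hsmall] with n hn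
    rw [erdosRenyiProb_eq]
    refine le_of_le_of_eq (sum_le_sum fun A _ => mul_le_of_le_one_right
      (wt_nonneg (fun _ => by positivity) (fun _ => hn.le) A) ?_)
      (sum_wt (fun _ : Edge n => d / (n : ℝ)))
    split_ifs <;> norm_num
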